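/- For every bounded continuous function φ : ℝ → ℝ, the limit as X → ∞ of (1/N_X) · Σ_{d negative odd fundamental discriminant, −X < d < 0} φ( f̃(d) / 3^{ω(d)} ) equals φ(1/32), where N_X is the number of negative odd fundamental discriminants d with −X < d < 0; that is, the empirical distributions of the values f̃(d)/3^{ω(d)} over negative odd fundamental discriminants converge weakly to the point mass at 1/32. -/

import Mathlib

open Finset Filter Asymptotics

open scoped Classical

noncomputable section

/-- `D` is a fundamental discriminant: either `D ≡ 1 (mod 4)` and `D` is squarefree,
or `D = 4m` with `m` squarefree and `m ≡ 2, 3 (mod 4)`. -/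
def IsFundDisc (D : ℤ) : Prop :=
  (D % 4 = 1 ∧ Squarefree D) ∨
    ∃ m : ℤ, D = 4 * m ∧ Squarefree m ∧ (m % 4 = 2 ∨ m % 4 = 3)

/-- `ω(d)`, the number of distinct primes dividing `|d|`. -/
def omegaZ (d : ℤ) : ℕ := d.natAbs.primeFactors.card

/-- The Legendre symbol `(m/p)` for odd primes `p`, and the Kronecker symbol at `p = 2`
(`0` if `m` is even, `1` if `m ≡ ±1 (mod 8)`, `-1` if `m ≡ ±3 (mod 8)`). -/
def kron (m : ℤ) (p : ℕ) : ℤ :=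
  if p = 2 then
    if m % 2 = 0 then 0 else if m % 8 = 1 ∨ m % 8 = 7 then 1 else -1
  else jacobiSym m p

/-- `α(d) = 1` if `d > 0` and `α(d) = 0` if `d < 0`. -/
def alphaFD (d : ℤ) : ℕ := if 0 < d then 1 else 0

/-- Ordered triples `(d₁, d₂, d₃)` of pairwise coprime fundamental discriminants,
each `≠ 1`, with `d₁ * d₂ * d₃ = d`. -/
def fdTriples (d : ℤ) : Finset (ℤ × ℤ × ℤ) :=
  (Finset.Icc (-(d.natAbs : ℤ)) (d.natAbs : ℤ) ×ˢ
      Finset.Icc (-(d.natAbs : ℤ)) (d.natAbs : ℤ) ×ˢ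
      Finset.Icc (-(d.natAbs : ℤ)) (d.natAbs : ℤ)).filter
    fun t =>
      IsFundDisc t.1 ∧ IsFundDisc t.2.1 ∧ IsFundDisc t.2.2 ∧
      t.1 ≠ 1 ∧ t.2.1 ≠ 1 ∧ t.2.2 ≠ 1 ∧
      IsCoprime t.1 t.2.1 ∧ IsCoprime t.1 t.2.2 ∧ IsCoprime t.2.1 t.2.2 ∧
      t.1 * t.2.1 * t.2.2 = d

/-- The summand attached to a factorization `d = d₁ d₂ d₃`:
`∏_{p ∣ d₃} (1 + (d₁d₂/p)) · ∏_{p ∣ d₂} (1 + (d₁d₃/p)) · ∏_{p ∣ d₁} (1 + (d₂d₃/p))`. -/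
def tripleTerm (t : ℤ × ℤ × ℤ) : ℤ :=
  (∏ p ∈ t.2.2.natAbs.primeFactors, (1 + kron (t.1 * t.2.1) p)) *
    (∏ p ∈ t.2.1.natAbs.primeFactors, (1 + kron (t.1 * t.2.2) p)) *
    (∏ p ∈ t.1.natAbs.primeFactors, (1 + kron (t.2.1 * t.2.2) p))

/-- `f̃(d) = 2^{-3-α(d)} Σ_{{d₁,d₂,d₃}} (…)`, the sum over *unordered* triples of
pairwise coprime fundamental discriminants `≠ 1` with product `d`.  Since the summand is
symmetric and the entries of any such triple are pairwise distinct, the unordered sum is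
one sixth of the ordered sum. -/
def ftilde (d : ℤ) : ℝ :=
  (1 / 2 ^ (3 + alphaFD d) : ℝ) * ((1 : ℝ) / 6) * ∑ t ∈ fdTriples d, (tripleTerm t : ℝ)

/-- `D⁻(X, n, m)`: fundamental discriminants `d` with `0 < -d < X` and `d ≡ n (mod m)`. -/
def Dminus (X : ℝ) (n m : ℤ) : Finset ℤ :=
  (Finset.Icc (-⌈X⌉) ⌈X⌉).filter fun d =>
    IsFundDisc d ∧ d < 0 ∧ -X < (d : ℝ) ∧ d % m = n % m

/-- `D⁺(X, n, m)`: fundamental discriminants `d` with `0 < d < X` and `d ≡ n (mod m)`. -/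
def Dplus (X : ℝ) (n m : ℤ) : Finset ℤ :=
  (Finset.Icc (-⌈X⌉) ⌈X⌉).filter fun d =>
    IsFundDisc d ∧ 0 < d ∧ (d : ℝ) < X ∧ d % m = n % m

/-- Negative odd fundamental discriminants `d` with `-X < d < 0`:
squarefree integers `d < 0` with `d ≡ 1 (mod 4)`. -/
def DnegOdd (X : ℝ) : Finset ℤ :=
  (Finset.Icc (-⌈X⌉) 0).filter fun d =>
    d < 0 ∧ Squarefree d ∧ d % 4 = 1 ∧ -X < (d : ℝ)

theorem prod_primesLE_pow_div_dvd_factorial (N : ℕ) :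
    ∏ p ∈ Nat.primesLE N, p ^ (N / p) ∣ N.factorial := by
  apply Finset.prod_dvd_of_isRelPrime
  · intro p hp q hq hpq
    have hp' := Nat.prime_of_mem_primesLE hp
    have hq' := Nat.prime_of_mem_primesLE hq
    exact Nat.coprime_iff_isRelPrime.mp
      (Nat.Coprime.pow _ _ ((Nat.coprime_primes hp' hq').mpr hpq))
  · intro p hp
    have hp' := Nat.prime_of_mem_primesLE hp
    rw [hp'.pow_dvd_iff_le_factorization (Nat.factorial_ne_zero N)]
    have h1 : (p * (N / p)).factorial ∣ N.factorial :=
      Nat.factorial_dvd_factorial (Nat.mul_div_le N p)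
    have h2 := (Nat.factorization_le_iff_dvd (Nat.factorial_ne_zero _)
      (Nat.factorial_ne_zero _)).mpr h1 p
    rw [Nat.factorization_factorial_mul hp'] at h2
    omega

/-- Mertens' first theorem, upper bound. -/
theorem sum_log_div_prime_le {N : ℕ} (hN : 1 ≤ N) :
    ∑ p ∈ Nat.primesLE N, Real.log p / p ≤ Real.log N + Real.log 4 := by
  have hN0 : (0 : ℝ) < N := by exact_mod_cast hN
  have h1 : ∑ p ∈ Nat.primesLE N, ((N / p : ℕ) : ℝ) * Real.log p ≤ N * Real.log N := by
    have hle := Nat.le_of_dvd (Nat.factorial_pos N) (prod_primesLE_pow_div_dvd_factorial N)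
    have hle2 : ((∏ p ∈ Nat.primesLE N, p ^ (N / p) : ℕ) : ℝ) ≤ (N : ℝ) ^ N := by
      exact_mod_cast hle.trans (Nat.factorial_le_pow N)
    have hpos : (0 : ℝ) < ((∏ p ∈ Nat.primesLE N, p ^ (N / p) : ℕ) : ℝ) := by
      exact_mod_cast Finset.prod_pos fun p hp => pow_pos (Nat.prime_of_mem_primesLE hp).pos _
    have := Real.log_le_log hpos hle2
    rw [Real.log_pow] at this
    refine le_trans (le_of_eq ?_) this
    push_cast
    rw [Real.log_prod]
    · exact Finset.sum_congr rfl fun p _ => by rw [Real.log_pow]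
    · intro p hp
      exact pow_ne_zero _ (by exact_mod_cast (Nat.prime_of_mem_primesLE hp).ne_zero)
  have h2 : ∑ p ∈ Nat.primesLE N, Real.log p ≤ Real.log 4 * N := by
    rw [← Chebyshev.theta_eq_sum_primesLE_log]
    exact Chebyshev.theta_le_log4_mul_x hN0.le
  have h3 : (N : ℝ) * ∑ p ∈ Nat.primesLE N, Real.log p / p ≤
      ∑ p ∈ Nat.primesLE N, (((N / p : ℕ) : ℝ) * Real.log p + Real.log p) := by
    rw [Finset.mul_sum]
    refine Finset.sum_le_sum fun p hp => ?_
    have hp' := Nat.prime_of_mem_primesLE hp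
    have hp0 : (0 : ℝ) < p := by exact_mod_cast hp'.pos
    have hl : 0 ≤ Real.log p := Real.log_natCast_nonneg p
    have : (N : ℝ) / p ≤ ((N / p : ℕ) : ℝ) + 1 := by
      have h := (Nat.lt_floor_add_one ((N : ℝ) / p)).le
      rwa [Nat.floor_div_natCast, Nat.floor_natCast] at h
    calc (N : ℝ) * (Real.log p / p) = (N / p) * Real.log p := by ring
      _ ≤ (((N / p : ℕ) : ℝ) + 1) * Real.log p := mul_le_mul_of_nonneg_right this hl
      _ = _ := by ring
  rw [Finset.sum_add_distrib] at h3
  have h4 : (N : ℝ) * ∑ p ∈ Nat.primesLE N, Real.log p / p ≤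
      N * (Real.log N + Real.log 4) := by nlinarith
  exact le_of_mul_le_mul_left h4 hN0

theorem exp_le_one_sub_inv {x : ℝ} (h1 : x < 1) : Real.exp x ≤ (1 - x)⁻¹ := by
  have hx : 0 < 1 - x := by linarith
  rw [le_inv_comm₀ (Real.exp_pos x) hx, ← Real.exp_neg]
  exact Real.one_sub_le_exp_neg x

theorem one_sub_inv_le_exp {x : ℝ} (h0 : 0 ≤ x) (h1 : x ≤ 1 / 2) :
    (1 - x)⁻¹ ≤ Real.exp (x + x ^ 2) := by
  have hx : 0 < 1 - x := by linarith
  rw [inv_le_iff_one_le_mul₀ hx]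
  have := Real.quadratic_le_exp_of_nonneg (x := x + x ^ 2) (by positivity)
  have h3 : 0 ≤ x ^ 3 := by positivity
  nlinarith [mul_le_mul_of_nonneg_right this hx.le, mul_nonneg h0 h0,
    mul_nonneg (mul_nonneg h0 h0) (sub_nonneg.2 h1), mul_nonneg h3 (sub_nonneg.2 h1),
    mul_nonneg (mul_nonneg h3 h0) (sub_nonneg.2 h1)]

/-- The completely multiplicative function `n ↦ n ^ (-s)`. -/
def rpowNegHom (s : ℝ) (hs : s ≠ 0) : ℕ →*₀ ℝ where
  toFun n := (n : ℝ) ^ (-s)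
  map_zero' := by
    simp [Real.zero_rpow (neg_ne_zero.mpr hs)]
  map_one' := by simp
  map_mul' m n := by
    push_cast
    exact Real.mul_rpow (Nat.cast_nonneg m) (Nat.cast_nonneg n)

theorem rpowNegHom_apply (s : ℝ) (hs : s ≠ 0) (n : ℕ) :
    rpowNegHom s hs n = (n : ℝ) ^ (-s) := rfl

theorem sum_inv_sq_primes_le (F : Finset ℕ) (hF : ∀ p ∈ F, 2 ≤ p) :
    ∑ p ∈ F, ((p : ℝ) ^ 2)⁻¹ ≤ 1 := by
  have key : ∀ N : ℕ, 1 ≤ N → ∑ p ∈ Finset.Icc 2 N, ((p : ℝ) ^ 2)⁻¹ ≤ 1 - 1 / N := by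
    intro N hN
    induction N, hN using Nat.le_induction with
    | base => simp
    | succ n hn ih =>
      rw [Finset.sum_Icc_succ_top (by omega)]
      have hn0 : (0 : ℝ) < n := by exact_mod_cast hn
      have : (((n + 1 : ℕ) : ℝ) ^ 2)⁻¹ ≤ 1 / n - 1 / ((n + 1 : ℕ) : ℝ) := by
        push_cast
        rw [div_sub_div _ _ hn0.ne' (by positivity), inv_eq_one_div,
          div_le_div_iff₀ (by positivity) (by positivity)]
        nlinarith
      linarith
  obtain ⟨N, hN⟩ : ∃ N : ℕ, ∀ p ∈ F, p ≤ N := ⟨F.sup id, fun p hp => Finset.le_sup (f := id) hp⟩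
  have hsub : F ⊆ Finset.Icc 2 (N + 1) := fun p hp =>
    Finset.mem_Icc.mpr ⟨hF p hp, (hN p hp).trans (Nat.le_succ N)⟩
  refine (Finset.sum_le_sum_of_subset_of_nonneg hsub fun _ _ _ => by positivity).trans
    ((key (N + 1) (by omega)).trans ?_)
  have : (0 : ℝ) ≤ 1 / ((N + 1 : ℕ) : ℝ) := by positivity
  linarith

/-- Mertens' second theorem, lower bound. -/
theorem loglog_le_sum_inv_prime {N : ℕ} (hN : 2 ≤ N) :
    Real.log (Real.log N) - 1 ≤ ∑ p ∈ Nat.primesLE N, 1 / (p : ℝ) := by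
  have hlog : 0 < Real.log N := Real.log_pos (by exact_mod_cast hN)
  let f := rpowNegHom 1 one_ne_zero
  have hf : ∀ n : ℕ, f n = (n : ℝ)⁻¹ := fun n => by
    simp [f, rpowNegHom_apply, Real.rpow_neg_one]
  have hs := EulerProduct.summable_and_hasSum_smoothNumbers_prod_primesBelow_geometric
    (f := (f : ℕ →* ℝ)) (fun {p} hp => by
      have : (1 : ℝ) < p := by exact_mod_cast hp.one_lt
      show ‖f p‖ < 1
      rw [hf, Real.norm_of_nonneg (by positivity)]
      exact inv_lt_one_of_one_lt₀ this) (N + 1)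
  have h1 : ∑ n ∈ Finset.Icc 1 N, (n : ℝ)⁻¹ ≤ ∏ p ∈ Nat.primesLE N, (1 - (p : ℝ)⁻¹)⁻¹ := by
    have hmem : ∀ n ∈ Finset.Icc 1 N, n ∈ Nat.smoothNumbers (N + 1) := by
      intro n hn
      rw [Finset.mem_Icc] at hn
      exact Nat.mem_smoothNumbers_of_lt (by omega) (by omega)
    have h2 := hs.2
    have h3 := sum_le_hasSum ((Finset.Icc 1 N).attach.image
      (fun n => (⟨n.1, hmem n.1 n.2⟩ : Nat.smoothNumbers (N + 1)))) (fun i _ => by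
        show 0 ≤ f i
        rw [hf]; positivity) h2
    rw [Finset.sum_image (by
      intro a _ b _ hab
      exact Subtype.ext (congrArg (fun z : Nat.smoothNumbers (N + 1) => (z : ℕ)) hab))] at h3
    rw [← Finset.sum_attach]
    calc _ = ∑ n ∈ (Finset.Icc 1 N).attach, f n.1 :=
          Finset.sum_congr rfl fun n _ => (hf _).symm
      _ ≤ _ := h3
      _ = _ := Finset.prod_congr rfl fun p _ => by
          show (1 - f p)⁻¹ = _
          rw [hf]
  have h4 : Real.log N ≤ ∑ n ∈ Finset.Icc 1 N, (n : ℝ)⁻¹ := by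
    have := log_add_one_le_harmonic N
    rw [harmonic_eq_sum_Icc] at this
    push_cast at this
    refine (Real.log_le_log (by positivity) ?_).trans this
    linarith
  have h5 : ∏ p ∈ Nat.primesLE N, (1 - (p : ℝ)⁻¹)⁻¹ ≤
      Real.exp (∑ p ∈ Nat.primesLE N, ((p : ℝ)⁻¹ + ((p : ℝ)⁻¹) ^ 2)) := by
    rw [Real.exp_sum]
    refine Finset.prod_le_prod (fun p hp => ?_) (fun p hp => ?_)
    · have : (1 : ℝ) < p := by exact_mod_cast (Nat.prime_of_mem_primesLE hp).one_lt
      have := inv_lt_one_of_one_lt₀ this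
      exact inv_nonneg.mpr (by linarith)
    · have : (2 : ℝ) ≤ p := by exact_mod_cast (Nat.prime_of_mem_primesLE hp).two_le
      refine one_sub_inv_le_exp (by positivity) ?_
      rw [one_div]
      exact inv_anti₀ (by norm_num) this
  have h6 := (Real.log_le_log hlog ((h4.trans h1).trans h5))
  rw [Real.log_exp, Finset.sum_add_distrib] at h6
  have h7 := sum_inv_sq_primes_le (Nat.primesLE N) (fun p hp => Nat.two_le_of_mem_primesLE hp)
  simp only [one_div]
  simp only [inv_pow] at h6
  linarith

theorem sum_Icc_rpow_neg_le {s : ℝ} (hs : 1 < s) (M : ℕ) :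
    ∑ n ∈ Icc 1 (M + 1), (n : ℝ) ^ (-s) ≤ 1 + (1 - ((M + 1 : ℕ) : ℝ) ^ (1 - s)) / (s - 1) := by
  have ht : 0 < s - 1 := by linarith
  induction M with
  | zero => simp
  | succ M ih =>
    rw [Finset.sum_Icc_succ_top (by omega)]
    have hM : (0 : ℝ) < (M : ℝ) + 1 := by positivity
    have hM' : (0 : ℝ) < (M : ℝ) + 2 := by positivity
    have key : ((M : ℝ) + 2) ^ (1 - s) * (1 + (s - 1) / (M + 2)) ≤ ((M : ℝ) + 1) ^ (1 - s) := by
      have e1 : Real.log (M + 1) ≤ Real.log (M + 2) - 1 / (M + 2) := by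
        have := Real.log_le_sub_one_of_pos (div_pos hM hM')
        rw [Real.log_div hM.ne' hM'.ne'] at this
        have e : ((M : ℝ) + 1) / (M + 2) - 1 = - (1 / (M + 2)) := by field_simp; ring
        linarith
      rw [Real.rpow_def_of_pos hM, Real.rpow_def_of_pos hM']
      have e2 : 1 + (s - 1) / ((M : ℝ) + 2) ≤ Real.exp ((s - 1) / ((M : ℝ) + 2)) := by
        have := Real.add_one_le_exp ((s - 1) / ((M : ℝ) + 2)); linarith
      calc _ ≤ Real.exp (Real.log (M + 2) * (1 - s)) * Real.exp ((s - 1) / ((M : ℝ) + 2)) := by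
            gcongr
        _ = Real.exp ((1 - s) * (Real.log (M + 2) - 1 / (M + 2))) := by
            rw [← Real.exp_add]; congr 1; ring
        _ ≤ _ := by
            apply Real.exp_le_exp.2
            nlinarith
    have e3 : (((M + 1 + 1 : ℕ) : ℝ)) ^ (-s) = ((M : ℝ) + 2) ^ (1 - s) / (M + 2) := by
      push_cast
      rw [show (M : ℝ) + 1 + 1 = M + 2 by ring, show (1 - s) = -s + 1 by ring,
        Real.rpow_add_one hM'.ne']
      field_simp
    push_cast at ih e3 ⊢
    rw [e3]
    rw [show (M : ℝ) + 1 + 1 = M + 2 by ring]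
    have : ((M : ℝ) + 2) ^ (1 - s) / (M + 2) ≤
        (((M : ℝ) + 1) ^ (1 - s) - ((M : ℝ) + 2) ^ (1 - s)) / (s - 1) := by
      rw [le_div_iff₀ ht]
      calc _ = ((M : ℝ) + 2) ^ (1 - s) * ((s - 1) / (M + 2)) := by ring
        _ ≤ _ := by nlinarith [key]
    calc _ ≤ _ := add_le_add ih this
      _ = _ := by ring

theorem summable_rpowNegHom {s : ℝ} (hs : 1 < s) (hs0 : s ≠ 0) :
    Summable (fun n => ‖rpowNegHom s hs0 n‖) := by
  refine (Real.summable_nat_rpow.2 (by linarith : -s < -1)).congr fun n => ?_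
  rw [rpowNegHom_apply, Real.norm_of_nonneg (by positivity)]

theorem tsum_rpow_neg_le {s : ℝ} (hs : 1 < s) (hs0 : s ≠ 0) :
    ∑' n, rpowNegHom s hs0 n ≤ 1 + 1 / (s - 1) := by
  have ht : 0 < s - 1 := by linarith
  refine Real.tsum_le_of_sum_range_le (fun n => ?_) fun n => ?_
  · rw [rpowNegHom_apply]; positivity
  · calc _ ≤ ∑ m ∈ Icc 1 (n + 1), (m : ℝ) ^ (-s) := by
          simp only [rpowNegHom_apply]
          rw [← Finset.sum_subset_zero_on_sdiff (s₁ := (range n).erase 0) (s₂ := range n)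
            (f := fun m : ℕ => (m : ℝ) ^ (-s)) (g := fun m : ℕ => (m : ℝ) ^ (-s)) (by simp [erase_subset])
            ?_ (fun _ _ => rfl)]
          · refine Finset.sum_le_sum_of_subset_of_nonneg ?_ (fun _ _ _ => by positivity)
            intro m hm; simp at hm ⊢; omega
          · intro m hm
            simp at hm
            by_cases h0 : m = 0
            · rw [h0]; simp; exact Real.zero_rpow (by linarith)
            · exact absurd (hm.2 h0) (by omega)
      _ ≤ _ := sum_Icc_rpow_neg_le hs n
      _ ≤ _ := by
        have : (0:ℝ) ≤ ((n + 1 : ℕ) : ℝ) ^ (1 - s) := by positivity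
        gcongr
        linarith

theorem prod_le_tsum_rpow_neg {s : ℝ} (hs : 1 < s) (hs0 : s ≠ 0) (F : Finset Nat.Primes) :
    ∏ p ∈ F, (1 - rpowNegHom s hs0 p)⁻¹ ≤ ∑' n, rpowNegHom s hs0 n := by
  have h := EulerProduct.eulerProduct_completely_multiplicative_hasProd (summable_rpowNegHom hs hs0)
  refine ge_of_tendsto h ?_
  filter_upwards [eventually_ge_atTop F] with G hG
  have hp1 : ∀ p : Nat.Primes, 0 ≤ rpowNegHom s hs0 p ∧ rpowNegHom s hs0 p < 1 := fun p =>
    ⟨by rw [rpowNegHom_apply]; positivity, Real.rpow_lt_one_of_one_lt_of_neg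
      (by exact_mod_cast p.2.one_lt) (by linarith)⟩
  refine Finset.prod_le_prod_of_subset_of_one_le hG (fun p _ => ?_) fun p _ _ => ?_
  · have := hp1 p; exact inv_nonneg.2 (by linarith)
  · have := hp1 p; exact one_le_inv_iff₀.2 ⟨by linarith, by linarith⟩

theorem sum_primes_rpow_neg_le {s : ℝ} (hs : 1 < s) (F : Finset ℕ) (hF : ∀ p ∈ F, p.Prime) :
    ∑ p ∈ F, (p : ℝ) ^ (-s) ≤ Real.log (1 + 1 / (s - 1)) := by
  have hs0 : s ≠ 0 := by linarith
  have ht : 0 < s - 1 := by linarith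
  rw [Real.le_log_iff_exp_le (by positivity), Real.exp_sum]
  have h1 := prod_le_tsum_rpow_neg hs hs0 (F.attach.map
    ⟨fun p : F => (⟨p.1, hF p.1 p.2⟩ : Nat.Primes), fun a b h =>
      Subtype.ext (congrArg (fun q : Nat.Primes => (q : ℕ)) h)⟩)
  rw [Finset.prod_map] at h1
  refine le_trans ?_ (h1.trans (tsum_rpow_neg_le hs hs0))
  rw [← Finset.prod_attach]
  refine Finset.prod_le_prod (fun _ _ => (Real.exp_pos _).le) fun p _ => ?_
  rw [rpowNegHom_apply]
  apply exp_le_one_sub_inv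
  exact Real.rpow_lt_one_of_one_lt_of_neg
      (by exact_mod_cast (hF p.1 p.2).one_lt) (by linarith)

theorem inv_sub_le_rpow_neg {N p : ℕ} (hN : 0 < Real.log N) (hp : 0 < p) :
    1 / (p : ℝ) - 1 / Real.log N * (Real.log p / p) ≤ (p : ℝ) ^ (-(1 + 1 / Real.log N)) := by
  have hp' : (0 : ℝ) < p := by exact_mod_cast hp
  rw [neg_add, Real.rpow_add hp', Real.rpow_neg_one, Real.rpow_def_of_pos hp']
  have := Real.add_one_le_exp (Real.log p * (-(1 / Real.log N)))
  calc _ = (p : ℝ)⁻¹ * (Real.log p * (-(1 / Real.log N)) + 1) := by field_simp; ring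
    _ ≤ _ := by gcongr

theorem one_le_log_of_three_le {N : ℕ} (hN : 3 ≤ N) : 1 ≤ Real.log N := by
  rw [Real.le_log_iff_exp_le (by positivity)]
  exact Real.exp_one_lt_d9.le.trans
    (le_trans (by norm_num) (show (3 : ℝ) ≤ N by exact_mod_cast hN))

theorem sum_inv_prime_sub_le {N : ℕ} (hN : 3 ≤ N) :
    ∑ p ∈ Nat.primesLE N, 1 / (p : ℝ) - 3 ≤
      ∑ p ∈ Nat.primesLE N, (p : ℝ) ^ (-(1 + 1 / Real.log N)) := by
  have hl := one_le_log_of_three_le hN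
  have h4 : Real.log 4 ≤ 2 := by
    rw [Real.log_le_iff_le_exp (by norm_num)]
    have := Real.exp_one_gt_d9
    calc (4 : ℝ) ≤ Real.exp 1 * Real.exp 1 := by nlinarith
      _ = _ := by rw [← Real.exp_add]; norm_num
  have h1 := sum_log_div_prime_le (N := N) (by omega)
  have h2 : 1 / Real.log N * ∑ p ∈ Nat.primesLE N, Real.log p / p ≤ 3 := by
    rw [one_div, inv_mul_le_iff₀ (by linarith)]; linarith
  have h3 : ∑ p ∈ Nat.primesLE N, (1 / (p : ℝ) - 1 / Real.log N * (Real.log p / p)) ≤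
      ∑ p ∈ Nat.primesLE N, (p : ℝ) ^ (-(1 + 1 / Real.log N)) :=
    Finset.sum_le_sum fun p hp => inv_sub_le_rpow_neg (by linarith)
      (Nat.prime_of_mem_primesLE hp).pos
  rw [Finset.sum_sub_distrib, ← Finset.mul_sum] at h3
  linarith

theorem log_one_add_log_le {N : ℕ} (hN : 3 ≤ N) :
    Real.log (1 + 1 / (1 + 1 / Real.log N - 1)) ≤ Real.log (Real.log N) + 1 := by
  have hl := one_le_log_of_three_le hN
  have e : 1 + 1 / (1 + 1 / Real.log N - 1) = 1 + Real.log N := by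
    rw [add_sub_cancel_left, one_div_one_div]
  rw [e, Real.log_le_iff_le_exp (by linarith), Real.exp_add, Real.exp_log (by linarith)]
  have := Real.exp_one_gt_d9
  nlinarith

/-- Mertens' second theorem, upper bound. -/
theorem sum_inv_prime_le_loglog {N : ℕ} (hN : 3 ≤ N) :
    ∑ p ∈ Nat.primesLE N, 1 / (p : ℝ) ≤ Real.log (Real.log N) + 4 := by
  have hl := one_le_log_of_three_le hN
  have h1 := sum_primes_rpow_neg_le (s := 1 + 1 / Real.log N)
    (by have : 0 < 1 / Real.log N := by positivity
        linarith) (Nat.primesLE N) fun p hp => Nat.prime_of_mem_primesLE hp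
  have h2 := sum_inv_prime_sub_le hN
  have h3 := log_one_add_log_le hN
  linarith

theorem sum_primes_tail_le {N : ℕ} (hN : 3 ≤ N) (F : Finset ℕ)
    (hF : ∀ p ∈ F, p.Prime ∧ N < p) :
    ∑ p ∈ F, (p : ℝ) ^ (-(1 + 1 / Real.log N)) ≤ 5 := by
  have hl := one_le_log_of_three_le hN
  have h1 := sum_primes_rpow_neg_le (s := 1 + 1 / Real.log N)
    (by have : 0 < 1 / Real.log N := by positivity
        linarith) (F ∪ Nat.primesLE N) fun p hp => by
      rcases Finset.mem_union.1 hp with h | h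
      exacts [(hF p h).1, Nat.prime_of_mem_primesLE h]
  rw [Finset.sum_union (Finset.disjoint_left.2 fun p hp hp' =>
    absurd (Nat.mem_primesLE.1 hp').1 (not_le.2 (hF p hp).2))] at h1
  have h2 := sum_inv_prime_sub_le hN
  have h3 := log_one_add_log_le hN
  have h4 := loglog_le_sum_inv_prime (N := N) (by omega)
  linarith

/-- The multiplicative function supported on squarefree integers with prescribed values at
the primes. -/
def sqfMul (g : ℕ → ℝ) (n : ℕ) : ℝ := if Squarefree n then ∏ p ∈ n.primeFactors, g p else 0

theorem sqfMul_nonneg {g : ℕ → ℝ} (hg : ∀ p, 0 ≤ g p) (n : ℕ) : 0 ≤ sqfMul g n := by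
  unfold sqfMul; split_ifs
  · exact Finset.prod_nonneg fun p _ => hg p
  · exact le_rfl

theorem sqfMul_eq_mul_div {g : ℕ → ℝ} {n p : ℕ} (hn : Squarefree n) (hp : p ∈ n.primeFactors) :
    sqfMul g n = g p * sqfMul g (n / p) := by
  have hpp := Nat.prime_of_mem_primeFactors hp
  obtain ⟨m, rfl⟩ := Nat.dvd_of_mem_primeFactors hp
  rw [Nat.mul_div_cancel_left _ hpp.pos]
  have hc : Nat.Coprime p m := Nat.coprime_of_squarefree_mul hn
  have hm : Squarefree m := hn.of_mul_right
  rw [sqfMul, if_pos hn, sqfMul, if_pos hm, hc.primeFactors_mul, hpp.primeFactors,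
    Finset.prod_union, Finset.prod_singleton]
  rw [Finset.disjoint_singleton_left]
  intro h
  exact (hpp.coprime_iff_not_dvd.1 hc) (Nat.dvd_of_mem_primeFactors h)

theorem sum_sqfMul_div_le {g : ℕ → ℝ} (hg : ∀ p, 0 ≤ g p) (N : ℕ) :
    ∑ n ∈ Icc 1 N, sqfMul g n / n ≤ Real.exp (∑ p ∈ Nat.primesLE N, g p / p) := by
  have h1 : ∏ p ∈ Nat.primesLE N, (1 + g p / p) ≤ Real.exp (∑ p ∈ Nat.primesLE N, g p / p) := by
    rw [Real.exp_sum]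
    refine Finset.prod_le_prod (fun p _ => ?_) fun p _ => ?_
    · have := hg p; positivity
    · have := Real.add_one_le_exp (g p / p); linarith
  refine le_trans ?_ h1
  rw [Finset.prod_one_add]
  have h2 : ∑ n ∈ Icc 1 N, sqfMul g n / n =
      ∑ n ∈ (Icc 1 N).filter Squarefree, ∏ p ∈ n.primeFactors, g p / p := by
    rw [Finset.sum_filter]
    refine Finset.sum_congr rfl fun n hn => ?_
    unfold sqfMul
    split_ifs with h
    · rw [Finset.prod_div_distrib]
      congr 1
      rw [← Nat.cast_prod, Nat.prod_primeFactors_of_squarefree h]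
    · simp
  rw [h2]
  rw [← Finset.sum_image (s := (Icc 1 N).filter Squarefree) (g := Nat.primeFactors)
    (f := fun S => ∏ p ∈ S, g p / p)]
  · refine Finset.sum_le_sum_of_subset_of_nonneg ?_ fun S _ _ =>
      Finset.prod_nonneg fun p _ => by have := hg p; positivity
    intro S hS
    obtain ⟨n, hn, rfl⟩ := Finset.mem_image.1 hS
    rw [Finset.mem_powerset]
    intro p hp
    rw [Finset.mem_filter, Finset.mem_Icc] at hn
    exact Nat.mem_primesLE.2 ⟨(Nat.le_of_mem_primeFactors hp).trans hn.1.2,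
      Nat.prime_of_mem_primeFactors hp⟩
  · intro a ha b hb hab
    have ha := (Finset.mem_filter.1 ha).2
    have hb := (Finset.mem_filter.1 hb).2
    rw [← Nat.prod_primeFactors_of_squarefree ha, ← Nat.prod_primeFactors_of_squarefree hb, hab]

theorem sum_sqfMul_mul_log_le {g : ℕ → ℝ} {B : ℝ} (hg : ∀ p, 0 ≤ g p) (hB : ∀ p, g p ≤ B) (N : ℕ) :
    ∑ n ∈ Icc 1 N, sqfMul g n * Real.log n ≤
      B * Real.log 4 * N * ∑ n ∈ Icc 1 N, sqfMul g n / n := by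
  have hB0 : 0 ≤ B := (hg 0).trans (hB 0)
  have h1 : ∀ n ∈ Icc 1 N, sqfMul g n * Real.log n =
      ∑ p ∈ n.primeFactors, sqfMul g n * Real.log p := by
    intro n hn
    by_cases h : Squarefree n
    · rw [← Finset.mul_sum]
      congr 1
      conv_lhs => rw [← Nat.prod_primeFactors_of_squarefree h]
      push_cast
      rw [Real.log_prod fun p hp => by
        exact_mod_cast (Nat.prime_of_mem_primeFactors hp).ne_zero]
    · simp [sqfMul, h]
  rw [Finset.sum_congr rfl h1, Finset.sum_sigma']
  have h2 : ∀ x ∈ (Icc 1 N).sigma fun n => n.primeFactors, sqfMul g x.1 * Real.log x.2 ≤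
      B * sqfMul g (x.1 / x.2) * Real.log x.2 := by
    rintro ⟨n, p⟩ hx
    rw [Finset.mem_sigma] at hx
    have hl : 0 ≤ Real.log p := Real.log_natCast_nonneg p
    by_cases h : Squarefree n
    · simp only
      rw [sqfMul_eq_mul_div h hx.2]
      have := sqfMul_nonneg hg (n / p)
      have := hB p
      gcongr
    · have := sqfMul_nonneg hg (n / p)
      simp only [sqfMul, h, if_false] at *
      rw [zero_mul]; positivity
  refine (Finset.sum_le_sum h2).trans ?_
  rw [← Finset.sum_image (s := (Icc 1 N).sigma fun n => n.primeFactors)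
    (g := fun x => (⟨x.1 / x.2, x.2⟩ : (_ : ℕ) × ℕ))
    (f := fun x => B * sqfMul g x.1 * Real.log x.2)]
  · calc _ ≤ ∑ x ∈ (Icc 1 N).sigma fun m => Nat.primesLE (N / m),
          B * sqfMul g x.1 * Real.log x.2 := by
          refine Finset.sum_le_sum_of_subset_of_nonneg ?_ fun x _ _ => ?_
          · intro x hx
            obtain ⟨⟨n, p⟩, hn, rfl⟩ := Finset.mem_image.1 hx
            simp only [Finset.mem_sigma, Finset.mem_Icc, Nat.mem_primesLE] at hn ⊢
            have hpp := Nat.prime_of_mem_primeFactors hn.2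
            have hd := Nat.dvd_of_mem_primeFactors hn.2
            have hpos : 0 < n / p := Nat.div_pos (Nat.le_of_dvd hn.1.1 hd) hpp.pos
            refine ⟨⟨hpos, (Nat.div_le_self _ _).trans hn.1.2⟩, ?_, hpp⟩
            rw [Nat.le_div_iff_mul_le hpos, Nat.mul_div_cancel' hd]
            exact hn.1.2
          · have := sqfMul_nonneg hg x.1
            have := Real.log_natCast_nonneg x.2
            positivity
      _ = ∑ m ∈ Icc 1 N, B * sqfMul g m * Chebyshev.theta ((N / m : ℕ) : ℝ) := by
          rw [Finset.sum_sigma]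
          refine Finset.sum_congr rfl fun m _ => ?_
          simp only
          rw [← Finset.mul_sum, Chebyshev.theta_eq_sum_primesLE_log]
      _ ≤ ∑ m ∈ Icc 1 N, B * sqfMul g m * (Real.log 4 * (N / m)) := by
          refine Finset.sum_le_sum fun m _ => ?_
          have := sqfMul_nonneg hg m
          have h4 : 0 ≤ Real.log 4 := Real.log_nonneg (by norm_num)
          refine mul_le_mul_of_nonneg_left ?_ (by positivity)
          refine (Chebyshev.theta_le_log4_mul_x (by positivity)).trans ?_
          exact mul_le_mul_of_nonneg_left Nat.cast_div_le h4
      _ = _ := by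
          rw [Finset.mul_sum]
          refine Finset.sum_congr rfl fun m _ => ?_
          ring
  · rintro ⟨n, p⟩ hn ⟨n', p'⟩ hn' h
    simp only [Finset.mem_coe, Finset.mem_sigma] at hn hn'
    simp only [Sigma.mk.injEq, heq_eq_eq] at h
    obtain ⟨h, rfl⟩ := h
    rw [← Nat.div_mul_cancel (Nat.dvd_of_mem_primeFactors hn.2), h,
      Nat.div_mul_cancel (Nat.dvd_of_mem_primeFactors hn'.2)]

/-- Hall's upper bound for the mean value of a nonnegative multiplicative function. -/
theorem log_mul_sum_sqfMul_le {g : ℕ → ℝ} {B : ℝ} (hg : ∀ p, 0 ≤ g p) (hB : ∀ p, g p ≤ B) (N : ℕ) :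
    Real.log N * ∑ n ∈ Icc 1 N, sqfMul g n ≤
      (2 * B + 1) * N * Real.exp (∑ p ∈ Nat.primesLE N, g p / p) := by
  have hB0 : 0 ≤ B := (hg 0).trans (hB 0)
  have h1 := sum_sqfMul_mul_log_le hg hB N
  have h2 := sum_sqfMul_div_le hg N
  have h3 : Real.log N * ∑ n ∈ Icc 1 N, sqfMul g n ≤
      ∑ n ∈ Icc 1 N, sqfMul g n * Real.log n + N * ∑ n ∈ Icc 1 N, sqfMul g n / n := by
    rw [Finset.mul_sum, Finset.mul_sum, ← Finset.sum_add_distrib]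
    refine Finset.sum_le_sum fun n hn => ?_
    rw [Finset.mem_Icc] at hn
    have hn0 : (0 : ℝ) < n := by exact_mod_cast hn.1
    have hN0 : (0 : ℝ) < N := by exact_mod_cast (by omega : 0 < N)
    have h5 : Real.log N ≤ Real.log n + N / n := by
      have := Real.log_le_sub_one_of_pos (div_pos hN0 hn0)
      rw [Real.log_div hN0.ne' hn0.ne'] at this
      linarith
    have := mul_le_mul_of_nonneg_left h5 (sqfMul_nonneg hg n)
    calc _ = sqfMul g n * Real.log N := mul_comm _ _
      _ ≤ _ := this
      _ = _ := by ring
  have h4 : Real.log 4 ≤ 2 := by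
    rw [Real.log_le_iff_le_exp (by norm_num)]
    have := Real.exp_one_gt_d9
    calc (4 : ℝ) ≤ Real.exp 1 * Real.exp 1 := by nlinarith
      _ = _ := by rw [← Real.exp_add]; norm_num
  have h40 : 0 ≤ Real.log 4 := Real.log_nonneg (by norm_num)
  have hS : 0 ≤ ∑ n ∈ Icc 1 N, sqfMul g n / n :=
    Finset.sum_nonneg fun n _ => div_nonneg (sqfMul_nonneg hg n) (by positivity)
  calc _ ≤ (B * Real.log 4 + 1) * N * ∑ n ∈ Icc 1 N, sqfMul g n / n := by linarith
    _ ≤ (2 * B + 1) * N * ∑ n ∈ Icc 1 N, sqfMul g n / n := by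
        refine mul_le_mul_of_nonneg_right (mul_le_mul_of_nonneg_right ?_ (by positivity)) hS
        nlinarith
    _ ≤ _ := by gcongr

section PeriodicCharacter

variable {θ : ℕ →*₀ ℝ} {Q : ℕ}

theorem sum_range_period_eq_zero (hQ : 0 < Q) (hper : ∀ n, θ (n + Q) = θ n)
    {a : ℕ} (ha : Nat.Coprime a Q) (hθa : θ a = -1) : ∑ n ∈ range Q, θ n = 0 := by
  have : NeZero Q := ⟨hQ.ne'⟩
  have hmod : ∀ n, θ (n % Q) = θ n := by
    have hp : Function.Periodic θ Q := hper
    exact fun n => hp.map_mod_nat n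
  have h1 : ∑ n ∈ range Q, θ n = ∑ x : ZMod Q, θ x.val := by
    rw [← Fin.sum_univ_eq_sum_range (fun n => θ n) Q]
    refine Fintype.sum_bijective (fun i : Fin Q => ((i : ℕ) : ZMod Q)) ?_ _ _ fun i => ?_
    · rw [Fintype.bijective_iff_injective_and_card]
      refine ⟨fun i j h => ?_, by simp [ZMod.card]⟩
      have := congrArg ZMod.val h
      simp only [ZMod.val_natCast, Nat.mod_eq_of_lt i.2, Nat.mod_eq_of_lt j.2] at this
      exact Fin.ext this
    · rw [ZMod.val_natCast, Nat.mod_eq_of_lt i.2]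
  have h2 : ∑ x : ZMod Q, θ x.val = ∑ x : ZMod Q, - θ x.val := by
    refine (Fintype.sum_bijective (fun x : ZMod Q => (ZMod.unitOfCoprime a ha : ZMod Q) * x)
      (Units.mulLeft_bijective _) _ _ fun x => ?_).symm
    rw [ZMod.coe_unitOfCoprime, ZMod.val_mul, hmod, map_mul, ZMod.val_natCast, hmod, hθa]
    ring
  rw [Finset.sum_neg_distrib] at h2
  linarith

theorem abs_sum_range_le_period (hQ : 0 < Q) (hper : ∀ n, θ (n + Q) = θ n)
    (hle : ∀ n, |θ n| ≤ 1) {a : ℕ} (ha : Nat.Coprime a Q) (hθa : θ a = -1) (M : ℕ) :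
    |∑ n ∈ range M, θ n| ≤ Q := by
  induction M using Nat.strong_induction_on with
  | _ M ih =>
    by_cases hM : M ≤ Q
    · calc _ ≤ ∑ n ∈ range M, |θ n| := Finset.abs_sum_le_sum_abs _ _
        _ ≤ ∑ n ∈ range M, (1 : ℝ) := Finset.sum_le_sum fun n _ => hle n
        _ ≤ _ := by simpa using hM
    · obtain ⟨m, rfl⟩ := Nat.exists_eq_add_of_le (not_le.1 hM).le
      rw [Finset.sum_range_add, sum_range_period_eq_zero hQ hper ha hθa, zero_add]
      simp_rw [add_comm Q, hper]
      exact ih m (by omega)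

theorem sum_Ioc_mul_rpow_neg_le (hQ : 0 < Q) (hper : ∀ n, θ (n + Q) = θ n)
    (hle : ∀ n, |θ n| ≤ 1) {a : ℕ} (ha : Nat.Coprime a Q) (hθa : θ a = -1)
    {s : ℝ} (hs : 1 < s) {M : ℕ} (hM : Q ≤ M) :
    ∑ n ∈ Ioc Q M, θ n * (n : ℝ) ^ (-s) ≤ 2 := by
  set S : ℕ → ℝ := fun m => ∑ n ∈ range (m + 1), θ n with hS
  have hSb : ∀ m, |S m| ≤ Q := fun m => abs_sum_range_le_period hQ hper hle ha hθa _
  set f : ℕ → ℝ := fun n => (n : ℝ) ^ (-s) with hf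
  have key : ∀ M, Q ≤ M → ∑ n ∈ Ioc Q M, θ n * f n ≤ S M * f M + (2 * Q * f Q - Q * f M) := by
    intro M hM
    induction M, hM using Nat.le_induction with
    | base =>
      have := (abs_le.1 (hSb Q)).1
      have h0 : 0 ≤ f Q := by positivity
      simp only [Ioc_self, sum_empty]
      nlinarith
    | succ M hM ih =>
      rw [Finset.sum_Ioc_succ_top (by omega)]
      have h1 : S (M + 1) = S M + θ (M + 1) := Finset.sum_range_succ _ _
      have h2 : f (M + 1) ≤ f M :=
        Real.rpow_le_rpow_of_nonpos (by exact_mod_cast (by omega : 0 < M))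
          (by push_cast; linarith) (by linarith)
      have h3 := (abs_le.1 (hSb M)).2
      rw [h1]
      nlinarith
  have h1 := key M hM
  have h2 := (abs_le.1 (hSb M)).2
  have h0 : 0 ≤ f M := by positivity
  have h3 : Q * f Q ≤ 1 := by
    have hQ' : (1 : ℝ) ≤ Q := by exact_mod_cast hQ
    have : f Q ≤ (Q : ℝ) ^ (-1 : ℝ) := Real.rpow_le_rpow_of_exponent_le hQ' (by linarith)
    rw [Real.rpow_neg_one] at this
    calc _ ≤ (Q : ℝ) * (Q : ℝ)⁻¹ := by gcongr
      _ = 1 := mul_inv_cancel₀ (by positivity)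
  nlinarith

theorem tsum_mul_rpow_neg_le (hQ : 0 < Q) (hper : ∀ n, θ (n + Q) = θ n)
    (hle : ∀ n, |θ n| ≤ 1) {a : ℕ} (ha : Nat.Coprime a Q) (hθa : θ a = -1)
    {s : ℝ} (hs : 1 < s) (hsum : Summable fun n : ℕ => θ n * (n : ℝ) ^ (-s)) :
    ∑' n : ℕ, θ n * (n : ℝ) ^ (-s) ≤ Real.log Q + 3 := by
  refine le_of_tendsto hsum.hasSum.tendsto_sum_nat ?_
  filter_upwards [eventually_ge_atTop (Q + 1)] with M hM
  obtain ⟨M, rfl⟩ : ∃ M', M = M' + 1 := ⟨M - 1, by omega⟩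
  have h1 : range (M + 1) = insert 0 (Icc 1 Q ∪ Ioc Q M) := by
    ext x; simp only [mem_range, mem_insert, mem_union, mem_Icc, mem_Ioc]; omega
  rw [h1, Finset.sum_insert (by simp), Finset.sum_union
    (Finset.disjoint_left.2 fun x hx hx' => by simp at hx hx'; omega)]
  have h2 := sum_Ioc_mul_rpow_neg_le hQ hper hle ha hθa hs (M := M) (by omega)
  have h3 : ∑ n ∈ Icc 1 Q, θ n * (n : ℝ) ^ (-s) ≤ 1 + Real.log Q := by
    refine le_trans ?_ (harmonic_le_one_add_log Q)
    rw [harmonic_eq_sum_Icc]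
    push_cast
    refine Finset.sum_le_sum fun n hn => ?_
    have hn' : (1 : ℝ) ≤ n := by exact_mod_cast (Finset.mem_Icc.1 hn).1
    have h4 : (n : ℝ) ^ (-s) ≤ (n : ℝ) ^ (-1 : ℝ) :=
      Real.rpow_le_rpow_of_exponent_le hn' (by linarith)
    rw [Real.rpow_neg_one] at h4
    have h5 : 0 ≤ (n : ℝ) ^ (-s) := by positivity
    have h6 := (abs_le.1 (hle n)).2
    nlinarith
  simp only [map_zero, zero_mul, zero_add]
  linarith

/-- A real character takes the value `1` on primes up to `N` at most marginally more often than
half of the time. -/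
theorem sum_primes_character_div_le (hQ : 0 < Q) (hper : ∀ n, θ (n + Q) = θ n)
    (hle : ∀ n, |θ n| ≤ 1) {a : ℕ} (ha : Nat.Coprime a Q) (hθa : θ a = -1)
    {N : ℕ} (hN : 3 ≤ N) :
    ∑ p ∈ Nat.primesLE N, θ p / p ≤ Real.log (Real.log Q + 3) + 8 := by
  have hl := one_le_log_of_three_le hN
  set s := 1 + 1 / Real.log N with hsdef
  have hs : 1 < s := by
    have : 0 < 1 / Real.log N := by positivity
    linarith
  have hs0 : s ≠ 0 := by linarith
  have hbd : ∀ n : ℕ, ‖(θ * rpowNegHom s hs0) n‖ ≤ ‖rpowNegHom s hs0 n‖ := fun n => by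
    change ‖θ n * rpowNegHom s hs0 n‖ ≤ _
    rw [norm_mul]
    exact mul_le_of_le_one_left (norm_nonneg _) (hle n)
  have hsum : Summable fun n => ‖(θ * rpowNegHom s hs0) n‖ :=
    Summable.of_nonneg_of_le (fun _ => norm_nonneg _) hbd (summable_rpowNegHom hs hs0)
  have hprod := EulerProduct.eulerProduct_completely_multiplicative_hasProd hsum
  have hL : ∑' n, (θ * rpowNegHom s hs0) n ≤ Real.log Q + 3 :=
    tsum_mul_rpow_neg_le hQ hper hle ha hθa hs hsum.of_norm
  have hexp : Real.exp (∑ p ∈ Nat.primesLE N, θ p * (p : ℝ) ^ (-s) - 5) ≤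
      ∑' n, (θ * rpowNegHom s hs0) n := by
    refine ge_of_tendsto hprod ?_
    let F0 : Finset Nat.Primes := (Nat.primesLE N).subtype Nat.Prime
    filter_upwards [eventually_ge_atTop F0] with F hF
    have h1 : Real.exp (∑ p ∈ F, (θ * rpowNegHom s hs0) p) ≤
        ∏ p ∈ F, (1 - (θ * rpowNegHom s hs0) p)⁻¹ := by
      rw [Real.exp_sum]
      refine Finset.prod_le_prod (fun _ _ => (Real.exp_pos _).le) fun p _ => ?_
      apply exp_le_one_sub_inv
      refine (le_abs_self _).trans_lt ((hbd p).trans_lt ?_)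
      rw [rpowNegHom_apply, Real.norm_of_nonneg (by positivity)]
      exact Real.rpow_lt_one_of_one_lt_of_neg (by exact_mod_cast p.2.one_lt) (by linarith)
    refine le_trans (Real.exp_le_exp.2 ?_) h1
    rw [← Finset.sum_sdiff hF]
    have h2 : ∑ p ∈ F0, (θ * rpowNegHom s hs0) p =
        ∑ p ∈ Nat.primesLE N, θ p * (p : ℝ) ^ (-s) := by
      rw [show (Nat.primesLE N) = F0.map (Function.Embedding.subtype _) by
        rw [Finset.subtype_map, Finset.filter_true_of_mem fun p hp =>
          Nat.prime_of_mem_primesLE hp], Finset.sum_map]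
      rfl
    have h3 : -5 ≤ ∑ p ∈ F \ F0, (θ * rpowNegHom s hs0) p := by
      have h4 := sum_primes_tail_le hN ((F \ F0).map (Function.Embedding.subtype _)) (by
        intro p hp
        obtain ⟨q, hq, rfl⟩ := Finset.mem_map.1 hp
        refine ⟨q.2, ?_⟩
        by_contra hlt
        exact (Finset.mem_sdiff.1 hq).2
          (Finset.mem_subtype.2 (Nat.mem_primesLE.2 ⟨not_lt.1 hlt, q.2⟩)))
      replace h4 := (Finset.sum_map (F \ F0) (Function.Embedding.subtype _)
        (fun p : ℕ => (p : ℝ) ^ (-s))).symm.le.trans h4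
      have h5 : |∑ p ∈ F \ F0, (θ * rpowNegHom s hs0) p| ≤ 5 := by
        refine (Finset.abs_sum_le_sum_abs _ _).trans (le_trans (Finset.sum_le_sum fun p _ => ?_) h4)
        refine (hbd p).trans (le_of_eq ?_)
        rw [rpowNegHom_apply, Real.norm_of_nonneg (by positivity)]
        rfl
      exact (abs_le.1 h5).1
    rw [h2]; linarith
  have hlog := (Real.le_log_iff_exp_le ((Real.exp_pos _).trans_le (hexp.trans hL))).2
    (hexp.trans hL)
  have hdiff : ∑ p ∈ Nat.primesLE N, θ p / p - ∑ p ∈ Nat.primesLE N, θ p * (p : ℝ) ^ (-s) ≤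
      ∑ p ∈ Nat.primesLE N, 1 / (p : ℝ) - ∑ p ∈ Nat.primesLE N, (p : ℝ) ^ (-s) := by
    rw [← Finset.sum_sub_distrib, ← Finset.sum_sub_distrib]
    refine Finset.sum_le_sum fun p hp => ?_
    have hp1 : (1 : ℝ) < p := by exact_mod_cast (Nat.prime_of_mem_primesLE hp).one_lt
    have h4 : (p : ℝ) ^ (-s) ≤ (p : ℝ) ^ (-1 : ℝ) :=
      Real.rpow_le_rpow_of_exponent_le hp1.le (by linarith)
    rw [Real.rpow_neg_one, ← one_div] at h4
    have := (abs_le.1 (hle p)).2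
    calc _ = θ p * (1 / p - (p : ℝ) ^ (-s)) := by ring
      _ ≤ 1 * (1 / p - (p : ℝ) ^ (-s)) := by
        refine mul_le_mul_of_nonneg_right this (by linarith)
      _ = _ := one_mul _
  have := sum_inv_prime_sub_le hN
  linarith

end PeriodicCharacter

/-- The integer part of `exp (exp t)`. -/
def tow (t : ℝ) : ℕ := ⌊Real.exp (Real.exp t)⌋₊

theorem two_le_tow {t : ℝ} (ht : 0 ≤ t) : 2 ≤ tow t := by
  refine Nat.le_floor ?_
  have h1 : 1 ≤ Real.exp t := Real.one_le_exp ht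
  have h2 := Real.add_one_le_exp (Real.exp t)
  push_cast; linarith

theorem log_tow_le {t : ℝ} (ht : 0 ≤ t) : Real.log (tow t) ≤ Real.exp t := by
  rw [Real.log_le_iff_le_exp (by have := two_le_tow ht; positivity)]
  exact Nat.floor_le (Real.exp_pos _).le

theorem tow_mono {s t : ℝ} (h : s ≤ t) : tow s ≤ tow t :=
  Nat.floor_le_floor (Real.exp_le_exp.2 (Real.exp_le_exp.2 h))

theorem le_sum_inv_prime_tow {t : ℝ} (ht : 0 ≤ t) :
    t - 2 ≤ ∑ p ∈ Nat.primesLE (tow t), 1 / (p : ℝ) := by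
  have h2 := two_le_tow ht
  have h2' : (2 : ℝ) ≤ tow t := by exact_mod_cast h2
  refine le_trans ?_ (loglog_le_sum_inv_prime h2)
  have hl : 0 < Real.log (tow t) := Real.log_pos (by linarith)
  have h3 : Real.exp (Real.exp t) ≤ (tow t : ℝ) ^ 2 := by
    have := (Nat.lt_floor_add_one (Real.exp (Real.exp t))).le
    change _ ≤ (tow t : ℝ) + 1 at this
    nlinarith
  have h4 : Real.exp t ≤ 2 * Real.log (tow t) := by
    have := Real.log_le_log (Real.exp_pos _) h3
    rwa [Real.log_exp, Real.log_pow] at this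
  have h5 := Real.log_le_log (Real.exp_pos _) h4
  rw [Real.log_exp, Real.log_mul (by norm_num) hl.ne'] at h5
  have := Real.log_two_lt_d9
  linarith

theorem sum_inv_prime_tow_le {t : ℝ} (ht : 0 ≤ t) :
    ∑ p ∈ Nat.primesLE (tow t), 1 / (p : ℝ) ≤ t + 4 := by
  rcases (two_le_tow ht).eq_or_lt with h | h
  · rw [← h, show Nat.primesLE 2 = {2} from by decide]
    simp; norm_num; linarith
  · refine (sum_inv_prime_le_loglog h).trans ?_
    have := one_le_log_of_three_le h
    have := (Real.log_le_iff_le_exp (by linarith)).2 (log_tow_le ht)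
    linarith

/-- The position of `log log p` on the scale from `0` to `log log N`, cut into `K` pieces. -/
def slot (K N p : ℕ) : Fin (K + 1) :=
  ⟨min ⌊K * Real.log (Real.log p) / Real.log (Real.log N)⌋₊ K, by omega⟩

section
variable {K N p : ℕ}

theorem slot_mul_le (hK : 0 < K) (hN : 0 < Real.log (Real.log N)) (h : 1 ≤ (slot K N p : ℕ)) :
    (slot K N p : ℕ) * Real.log (Real.log N) / K ≤ Real.log (Real.log p) := by
  have h1 : (slot K N p : ℕ) ≤ ⌊K * Real.log (Real.log p) / Real.log (Real.log N)⌋₊ :=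
    min_le_left _ _
  have h2 := (Nat.le_floor_iff' (by omega)).1 h1
  rw [le_div_iff₀ hN] at h2
  rw [div_le_iff₀ (by positivity)]
  linarith

theorem log_prime_pos (hp : p.Prime) : 0 < Real.log p :=
  Real.log_pos (by exact_mod_cast hp.one_lt)

theorem exp_exp_slot_le (hK : 0 < K) (hN : 0 < Real.log (Real.log N)) (hp : p.Prime)
    (h : 1 ≤ (slot K N p : ℕ)) :
    Real.exp (Real.exp ((slot K N p : ℕ) * Real.log (Real.log N) / K)) ≤ p := by
  have h1 := slot_mul_le hK hN h
  have hp0 : (0 : ℝ) < p := by exact_mod_cast hp.pos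
  rw [← Real.le_log_iff_exp_le hp0, ← Real.le_log_iff_exp_le (log_prime_pos hp)]
  exact h1

theorem loglog_lt_slot (hK : 0 < K) (hN : 0 < Real.log (Real.log N)) (hp : p.Prime)
    (hpN : p ≤ N) :
    Real.log (Real.log p) < ((slot K N p : ℕ) + 1) * Real.log (Real.log N) / K := by
  have hp0 : (0 : ℝ) < p := by exact_mod_cast hp.pos
  have h1 : Real.log (Real.log p) ≤ Real.log (Real.log N) :=
    Real.log_le_log (log_prime_pos hp) (Real.log_le_log hp0 (by exact_mod_cast hpN))
  have hK' : (0 : ℝ) < K := by exact_mod_cast hK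
  have h2 : K * Real.log (Real.log p) / Real.log (Real.log N) ≤ K := by
    rw [div_le_iff₀ hN]; gcongr
  have h3 : (slot K N p : ℕ) = ⌊K * Real.log (Real.log p) / Real.log (Real.log N)⌋₊ :=
    min_eq_left (Nat.floor_le_of_le h2)
  have h4 := Nat.lt_floor_add_one (K * Real.log (Real.log p) / Real.log (Real.log N))
  rw [← h3, div_lt_iff₀ hN] at h4
  rw [lt_div_iff₀ hK']
  linarith

theorem le_tow_of_slot_eq (hK : 0 < K) (hN : 0 < Real.log (Real.log N)) (hp : p.Prime)
    (hpN : p ≤ N) : p ≤ tow (((slot K N p : ℕ) + 1) * Real.log (Real.log N) / K) := by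
  refine Nat.le_floor ?_
  have hp0 : (0 : ℝ) < p := by exact_mod_cast hp.pos
  rw [← Real.log_le_iff_le_exp hp0, ← Real.log_le_iff_le_exp (log_prime_pos hp)]
  exact (loglog_lt_slot hK hN hp hpN).le

theorem tow_le_of_slot_eq (hK : 0 < K) (hN : 0 < Real.log (Real.log N)) (hp : p.Prime) :
    tow ((slot K N p : ℕ) * Real.log (Real.log N) / K) ≤ p := by
  rcases Nat.eq_zero_or_pos (slot K N p : ℕ) with h | h
  · rw [h]
    refine le_trans (Nat.le_of_lt_succ ((Nat.floor_lt (Real.exp_pos _).le).2 ?_)) hp.two_le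
    have := Real.exp_one_lt_d9
    simp
    linarith
  · exact_mod_cast (Nat.floor_le (Real.exp_pos _).le).trans (exp_exp_slot_le hK hN hp h)

theorem sum_inv_slot_le (hK : 0 < K) (hN : 0 < Real.log (Real.log N)) (j : Fin (K + 1)) :
    ∑ p ∈ (Nat.primesLE N).filter (fun p => slot K N p = j), 1 / (p : ℝ) ≤
      Real.log (Real.log N) / K + 7 := by
  set y := Real.log (Real.log N)
  have hK' : (0 : ℝ) < K := by exact_mod_cast hK
  have ht1 : 0 ≤ (j : ℕ) * y / K := by positivity
  have ht2 : 0 ≤ ((j : ℕ) + 1) * y / K := by positivity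
  have h12 : (j : ℕ) * y / K ≤ ((j : ℕ) + 1) * y / K := by gcongr; linarith
  have hsub : (Nat.primesLE N).filter (fun p => slot K N p = j) ⊆
      insert (tow ((j : ℕ) * y / K)) (Nat.primesLE (tow (((j : ℕ) + 1) * y / K)) \
        Nat.primesLE (tow ((j : ℕ) * y / K))) := by
    intro p hp
    obtain ⟨hp0, rfl⟩ := Finset.mem_filter.1 hp
    obtain ⟨hpN, hp⟩ := Nat.mem_primesLE.1 hp0
    have h1 := le_tow_of_slot_eq hK hN hp hpN
    have h2 := tow_le_of_slot_eq hK hN hp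
    rw [Finset.mem_insert, Finset.mem_sdiff, Nat.mem_primesLE, Nat.mem_primesLE]
    rcases h2.eq_or_lt with h | h
    · exact Or.inl h.symm
    · exact Or.inr ⟨⟨h1, hp⟩, fun h' => absurd h'.1 (not_le.2 h)⟩
  refine (Finset.sum_le_sum_of_subset_of_nonneg hsub fun _ _ _ => by positivity).trans ?_
  have h3 : ∀ (a : ℕ) (s : Finset ℕ), 2 ≤ a →
      ∑ p ∈ insert a s, 1 / (p : ℝ) ≤ 1 + ∑ p ∈ s, 1 / (p : ℝ) := by
    intro a s ha
    by_cases h : a ∈ s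
    · rw [Finset.insert_eq_of_mem h]; linarith
    · rw [Finset.sum_insert h]
      have : (2 : ℝ) ≤ a := by exact_mod_cast ha
      have : 1 / (a : ℝ) ≤ 1 := by rw [div_le_one (by linarith)]; linarith
      linarith
  refine (h3 _ _ (two_le_tow ht1)).trans ?_
  have h4 : Nat.primesLE (tow ((j : ℕ) * y / K)) ⊆ Nat.primesLE (tow (((j : ℕ) + 1) * y / K)) :=
    fun p hp => Nat.mem_primesLE.2 ⟨(Nat.mem_primesLE.1 hp).1.trans (tow_mono h12),
      (Nat.mem_primesLE.1 hp).2⟩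
  have h5 := Finset.sum_sdiff h4 (f := fun p : ℕ => 1 / (p : ℝ))
  have h6 := le_sum_inv_prime_tow ht1
  have h7 := sum_inv_prime_tow_le ht2
  have h8 : ((j : ℕ) + 1) * y / K = (j : ℕ) * y / K + y / K := by ring
  linarith

/-- The product of the prime factors of `n` in slot `j`. -/
def slotProd (K N n : ℕ) (j : Fin (K + 1)) : ℕ :=
  ∏ p ∈ n.primeFactors.filter (fun p => slot K N p = j), p

theorem slotProd_pos (n : ℕ) (j : Fin (K + 1)) : 0 < slotProd K N n j :=
  Finset.prod_pos fun _ hp => (Nat.prime_of_mem_primeFactors (Finset.mem_filter.1 hp).1).pos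

theorem sum_log_slotProd_le (hK : 0 < K) (hN : 0 < Real.log (Real.log N)) (j : Fin (K + 1)) :
    ∑ n ∈ Icc 1 N, Real.log (slotProd K N n j) ≤
      N * (Real.exp (((j : ℕ) + 1) * Real.log (Real.log N) / K) + 2) := by
  set t := ((j : ℕ) + 1) * Real.log (Real.log N) / K with ht
  have ht0 : 0 ≤ t := by positivity
  have h1 : ∀ n ∈ Icc 1 N, Real.log (slotProd K N n j) ≤
      ∑ p ∈ Nat.primesLE (tow t), if p ∣ n then Real.log p else 0 := by
    intro n hn
    rw [Finset.mem_Icc] at hn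
    unfold slotProd
    push_cast
    rw [Real.log_prod fun p hp => by
      exact_mod_cast (Nat.prime_of_mem_primeFactors (Finset.mem_filter.1 hp).1).ne_zero]
    rw [← Finset.sum_filter]
    refine Finset.sum_le_sum_of_subset_of_nonneg ?_ fun p _ _ => Real.log_natCast_nonneg p
    intro p hp
    obtain ⟨hp, hj⟩ := Finset.mem_filter.1 hp
    have hpp := Nat.prime_of_mem_primeFactors hp
    rw [Finset.mem_filter, Nat.mem_primesLE]
    refine ⟨⟨?_, hpp⟩, Nat.dvd_of_mem_primeFactors hp⟩
    have := le_tow_of_slot_eq hK hN hpp ((Nat.le_of_mem_primeFactors hp).trans hn.2)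
    rwa [hj] at this
  refine (Finset.sum_le_sum h1).trans ?_
  rw [Finset.sum_comm]
  have h2 : ∀ p ∈ Nat.primesLE (tow t), (∑ n ∈ Icc 1 N, if p ∣ n then Real.log p else 0) ≤
      N * (Real.log p / p) := by
    intro p hp
    rw [← Finset.sum_filter, Finset.sum_const, nsmul_eq_mul,
      show #{n ∈ Icc 1 N | p ∣ n} = N / p from Nat.Ioc_filter_dvd_card_eq_div N p]
    have := Real.log_natCast_nonneg p
    calc _ ≤ ((N : ℝ) / p) * Real.log p := by gcongr; exact Nat.cast_div_le
      _ = _ := by ring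
  refine (Finset.sum_le_sum h2).trans ?_
  rw [← Finset.mul_sum]
  have h3 := sum_log_div_prime_le (N := tow t) (by have := two_le_tow ht0; omega)
  have h4 := log_tow_le ht0
  have h5 : Real.log 4 ≤ 2 := by
    rw [Real.log_le_iff_le_exp (by norm_num)]
    have := Real.exp_one_gt_d9
    calc (4 : ℝ) ≤ Real.exp 1 * Real.exp 1 := by nlinarith
      _ = _ := by rw [← Real.exp_add]; norm_num
  gcongr
  linarith

/-- Few integers have a large part composed of primes from a given slot. -/
theorem card_large_slotProd_le (hK : 0 < K) (hN : 0 < Real.log (Real.log N)) (j : Fin (K + 1)) :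
    (#{n ∈ Icc 1 N | Real.exp (((j : ℕ) + 2) * Real.log (Real.log N) / K) <
      Real.log (slotProd K N n j)} : ℝ) ≤ 3 * N * Real.exp (-(Real.log (Real.log N) / K)) := by
  set y := Real.log (Real.log N)
  set S := {n ∈ Icc 1 N | Real.exp (((j : ℕ) + 2) * y / K) < Real.log (slotProd K N n j)} with hS
  have h1 := sum_log_slotProd_le hK hN j
  have h2 : (#S : ℝ) * Real.exp (((j : ℕ) + 2) * y / K) ≤
      ∑ n ∈ Icc 1 N, Real.log (slotProd K N n j) := by
    rw [← nsmul_eq_mul]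
    refine (Finset.card_nsmul_le_sum S _ _ fun n hn => ?_).trans
      (Finset.sum_le_sum_of_subset_of_nonneg (Finset.filter_subset _ _) fun n _ _ =>
        Real.log_natCast_nonneg _)
    exact (Finset.mem_filter.1 hn).2.le
  have h3 : 1 ≤ Real.exp (((j : ℕ) + 1) * y / K) := Real.one_le_exp (by positivity)
  have h4 : Real.exp (((j : ℕ) + 1) * y / K) =
      Real.exp (((j : ℕ) + 2) * y / K) * Real.exp (-(y / K)) := by
    rw [← Real.exp_add]; congr 1; ring
  have h5 : 0 < Real.exp (((j : ℕ) + 2) * y / K) := Real.exp_pos _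
  refine le_of_mul_le_mul_right ?_ h5
  calc _ ≤ _ := h2.trans h1
    _ ≤ N * (3 * Real.exp (((j : ℕ) + 1) * y / K)) := by gcongr; linarith
    _ = _ := by rw [h4]; ring

end

theorem exists_jacobiSym_prime_eq_neg_one {p : ℕ} (hp : p.Prime) (hp2 : p ≠ 2) :
    ∃ a : ℕ, jacobiSym a p = -1 := by
  have : Fact p.Prime := ⟨hp⟩
  obtain ⟨x, hx⟩ := FiniteField.exists_nonsquare (F := ZMod p) (by
    rw [ZMod.ringChar_zmod_n]; exact hp2)
  refine ⟨x.val, ?_⟩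
  rw [← jacobiSym.legendreSym.to_jacobiSym, legendreSym.eq_neg_one_iff]
  simpa using hx

theorem exists_coprime_jacobiSym_eq_neg_one {p D : ℕ} (hp : p.Prime) (hp2 : p ≠ 2) (hD : Odd D)
    (hpD : Nat.Coprime p D) :
    ∃ a : ℕ, Nat.Coprime a (4 * (p * D)) ∧ a % 4 = 1 ∧ jacobiSym a (p * D) = -1 := by
  obtain ⟨b, hb⟩ := exists_jacobiSym_prime_eq_neg_one hp hp2
  have hpodd : Odd p := hp.odd_of_ne_two hp2
  have hp4 : Nat.Coprime p (4 * D) :=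
    Nat.Coprime.mul_right (Nat.Coprime.pow_right 2 (Nat.coprime_two_right.2 hpodd)) hpD
  obtain ⟨a, ha1, ha2⟩ := Nat.chineseRemainder hp4 b 1
  have ha4 : a % 4 = 1 := ha2.of_mul_right D
  have haD : a ≡ 1 [MOD D] := Nat.ModEq.of_mul_left 4 ha2
  have e1 : jacobiSym a p = -1 := by
    rw [jacobiSym.mod_left, ← Int.natCast_mod, ha1, Int.natCast_mod, ← jacobiSym.mod_left, hb]
  have e2 : jacobiSym a D = 1 := by
    rw [jacobiSym.mod_left, ← Int.natCast_mod, haD, Int.natCast_mod, ← jacobiSym.mod_left]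
    simp
  have hp0 : NeZero p := ⟨hp.ne_zero⟩
  have hD0 : NeZero D := ⟨by rintro rfl; simp at hD⟩
  refine ⟨a, ?_, ha4, ?_⟩
  · rw [show 4 * (p * D) = p * (4 * D) by ring]
    refine Nat.Coprime.mul_right ?_ ?_
    · by_contra hc
      have : jacobiSym a p = 0 := jacobiSym.eq_zero_iff.2 ⟨hp.ne_zero, by simpa using hc⟩
      omega
    · have := ha2.gcd_eq
      simpa using this
  · rw [jacobiSym.mul_right, e1, e2]; norm_num

/-- The quadratic character `n ↦ (n / D) χ₄(n) ^ s`. -/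
def qchar (D : ℕ) (s : Bool) (h : 1 < D ∨ s = true) : ℕ →*₀ ℝ where
  toFun n := ((jacobiSym n D * (if s then ZMod.χ₄ n else 1) : ℤ) : ℝ)
  map_zero' := by
    rcases h with h | h
    · simp [jacobiSym.zero_left h]
    · simp [h]
  map_one' := by cases s <;> simp
  map_mul' m n := by
    rw [← Int.cast_mul]
    congr 1
    push_cast
    rw [jacobiSym.mul_left]
    split_ifs
    · rw [map_mul]; ring
    · ring

section qchar
variable {D : ℕ} {s : Bool} {h : 1 < D ∨ s = true}

theorem qchar_apply (n : ℕ) : qchar D s h n =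
    ((jacobiSym n D * (if s then ZMod.χ₄ n else 1) : ℤ) : ℝ) := rfl

theorem qchar_add_period (n : ℕ) : qchar D s h (n + 4 * D) = qchar D s h n := by
  rw [qchar_apply, qchar_apply]
  have h1 : jacobiSym ((n + 4 * D : ℕ) : ℤ) D = jacobiSym n D := by
    rw [jacobiSym.mod_left]
    conv_rhs => rw [jacobiSym.mod_left]
    congr 1
    push_cast
    rw [Int.add_mul_emod_self_right]
  have h2 : ((n + 4 * D : ℕ) : ZMod 4) = (n : ZMod 4) := by
    push_cast
    rw [show (4 : ZMod 4) = 0 from rfl]; ring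
  rw [h1, h2]

theorem abs_jacobiSym_le_one (a : ℤ) (b : ℕ) : |((jacobiSym a b : ℤ) : ℝ)| ≤ 1 := by
  rcases jacobiSym.trichotomy a b with h | h | h <;> rw [h] <;> simp

theorem abs_chi4_le_one (a : ZMod 4) : |((ZMod.χ₄ a : ℤ) : ℝ)| ≤ 1 := by
  have : ZMod.χ₄ a = 0 ∨ ZMod.χ₄ a = 1 ∨ ZMod.χ₄ a = -1 := by revert a; decide
  rcases this with h | h | h <;> rw [h] <;> simp

theorem abs_qchar_le_one (n : ℕ) : |qchar D s h n| ≤ 1 := by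
  rw [qchar_apply, Int.cast_mul, abs_mul]
  refine mul_le_one₀ (abs_jacobiSym_le_one _ _) (abs_nonneg _) ?_
  split_ifs
  · exact abs_chi4_le_one _
  · simp

end qchar

theorem exists_prime_dvd_not_dvd {m m' : ℕ} (hm : Squarefree m) (hm' : Squarefree m')
    (h : m ≠ m') : ∃ p, p.Prime ∧ ((p ∣ m ∧ ¬ p ∣ m') ∨ (p ∣ m' ∧ ¬ p ∣ m)) := by
  by_contra! hc
  refine h ?_
  rw [← Nat.prod_primeFactors_of_squarefree hm, ← Nat.prod_primeFactors_of_squarefree hm']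
  congr 1
  ext p
  simp only [Nat.mem_primeFactors, hm.ne_zero, hm'.ne_zero, ne_eq, not_false_eq_true, and_true]
  exact ⟨fun hp => ⟨hp.1, (hc p hp.1).1 hp.2⟩, fun hp => ⟨hp.1, (hc p hp.1).2 hp.2⟩⟩

theorem abs_sum_jacobiSym_mul_le {m m' : ℕ} (hm : Squarefree m) (hm' : Squarefree m')
    (ho : Odd m) (ho' : Odd m') (h : m ≠ m') (R : ℕ) :
    |∑ n ∈ Icc 1 R, ((jacobiSym n m * jacobiSym n m' : ℤ) : ℝ)| ≤ 4 * (m * m') := by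
  wlog hp : ∃ p, p.Prime ∧ (p ∣ m ∧ ¬ p ∣ m') generalizing m m'
  · obtain ⟨p, hp1, hp2⟩ := exists_prime_dvd_not_dvd hm hm' h
    have h2 := this hm' hm ho' ho h.symm ⟨p, hp1, hp2.resolve_left fun h3 => hp ⟨p, hp1, h3⟩⟩
    simp_rw [mul_comm (jacobiSym _ m')] at h2
    rwa [mul_comm (m : ℝ)]
  obtain ⟨p, hp, ⟨q, rfl⟩, hpm'⟩ := hp
  have hpodd : Odd p := (Nat.odd_mul.1 ho).1
  have hqodd : Odd q := (Nat.odd_mul.1 ho).2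
  have hpq : Nat.Coprime p q := Nat.coprime_of_squarefree_mul hm
  have hq0 : NeZero q := ⟨by rintro rfl; simp at hqodd⟩
  have hp0 : NeZero p := ⟨hp.ne_zero⟩
  have hm0 : NeZero m' := ⟨hm'.ne_zero⟩
  obtain ⟨a, ha1, ha4, ha⟩ := exists_coprime_jacobiSym_eq_neg_one hp
    (fun h2 => by rw [h2] at hpodd; exact absurd hpodd (by decide)) (hqodd.mul ho')
    (hpq.mul_right ((hp.coprime_iff_not_dvd).2 hpm'))
  have hD : 1 < p * (q * m') := by
    have h1 := hp.one_lt
    have h2 : 0 < q * m' := Nat.mul_pos (Nat.pos_of_ne_zero hq0.out) (Nat.pos_of_ne_zero hm0.out)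
    nlinarith
  have key := abs_sum_range_le_period (θ := qchar (p * (q * m')) false (Or.inl hD))
    (Q := 4 * (p * (q * m'))) (by omega) qchar_add_period abs_qchar_le_one ha1
    (by rw [qchar_apply, ha]; simp) (R + 1)
  rw [Finset.range_eq_Ico, Finset.sum_eq_sum_Ico_succ_bot (by omega), map_zero, zero_add] at key
  push_cast at key ⊢
  calc _ = _ := by
        congr 1
        refine Finset.sum_congr (by ext; simp) fun n _ => ?_
        rw [qchar_apply, jacobiSym.mul_right, jacobiSym.mul_right, jacobiSym.mul_right]
        simp [mul_assoc]
    _ ≤ _ := key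
    _ = _ := by ring

theorem sum_sq_le_of_bilinear {α : ℕ → ℝ} {M N Y : ℕ} (hα : ∀ m, |α m| ≤ 1)
    (hsupp : ∀ m, α m ≠ 0 → Odd m ∧ Squarefree m ∧ m ≤ M) (hM : M ^ 4 ≤ Y) (hY : Y ≤ N) :
    ∑ n ∈ Icc 1 N, (∑ m ∈ Icc 1 N, if m * n ≤ Y then α m * (jacobiSym n m : ℝ) else 0) ^ 2 ≤
      Y * (5 + Real.log N) := by
  have hMN : M ≤ N := (Nat.le_self_pow (by norm_num) M).trans (hM.trans hY)
  have h1 : ∀ n ∈ Icc 1 N,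
      (∑ m ∈ Icc 1 N, if m * n ≤ Y then α m * (jacobiSym n m : ℝ) else 0) ^ 2 =
      ∑ m ∈ Icc 1 M, ∑ m' ∈ Icc 1 M, α m * α m' *
        (if m * n ≤ Y ∧ m' * n ≤ Y then ((jacobiSym n m * jacobiSym n m' : ℤ) : ℝ) else 0) := by
    intro n _
    rw [← Finset.sum_subset (Finset.Icc_subset_Icc_right hMN)]
    · rw [sq, Finset.sum_mul_sum]
      refine Finset.sum_congr rfl fun m _ => Finset.sum_congr rfl fun m' _ => ?_
      by_cases h1 : m * n ≤ Y <;> by_cases h2 : m' * n ≤ Y <;> simp [h1, h2]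
      ring
    · intro m _ hm
      by_cases h : α m = 0
      · simp [h]
      · exact absurd (Finset.mem_Icc.2 ⟨(hsupp m h).1.pos, (hsupp m h).2.2⟩) hm
  rw [Finset.sum_congr rfl h1, Finset.sum_comm]
  have h2 : ∀ m ∈ Icc 1 M, ∀ m' ∈ Icc 1 M, ∑ n ∈ Icc 1 N, α m * α m' *
        (if m * n ≤ Y ∧ m' * n ≤ Y then ((jacobiSym n m * jacobiSym n m' : ℤ) : ℝ) else 0) ≤
        (if m = m' then (Y : ℝ) / m else 0) + 4 * (M : ℝ) ^ 2 := by
    intro m hm m' hm'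
    rw [Finset.mem_Icc] at hm hm'
    by_cases h0 : α m = 0
    · simp only [h0, zero_mul, Finset.sum_const_zero]; positivity
    by_cases h0' : α m' = 0
    · simp only [h0', mul_zero, zero_mul, Finset.sum_const_zero]; positivity
    have hs := hsupp m h0
    have hs' := hsupp m' h0'
    rw [← Finset.mul_sum, ← Finset.sum_filter]
    have hR : {n ∈ Icc 1 N | m * n ≤ Y ∧ m' * n ≤ Y} = Icc 1 (min (Y / m) (Y / m')) := by
      ext n
      rw [Finset.mem_filter, Finset.mem_Icc, Finset.mem_Icc, le_min_iff,
        Nat.le_div_iff_mul_le hm.1, Nat.le_div_iff_mul_le hm'.1, mul_comm n, mul_comm n]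
      constructor
      · tauto
      · rintro ⟨h3, h4⟩
        have : n ≤ m * n := Nat.le_mul_of_pos_left n hm.1
        exact ⟨⟨h3, by omega⟩, h4⟩
    rw [hR]
    have hα2 : |α m * α m'| ≤ 1 := by
      rw [abs_mul]; exact mul_le_one₀ (hα m) (abs_nonneg _) (hα m')
    have h3 : |∑ n ∈ Icc 1 (min (Y / m) (Y / m')), ((jacobiSym n m * jacobiSym n m' : ℤ) : ℝ)| ≤
        (if m = m' then (Y : ℝ) / m else 0) + 4 * (M : ℝ) ^ 2 := by
      split_ifs with h
      · subst h
        calc _ ≤ ∑ n ∈ Icc 1 (min (Y / m) (Y / m)), (1 : ℝ) := by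
              refine (Finset.abs_sum_le_sum_abs _ _).trans (Finset.sum_le_sum fun n _ => ?_)
              rw [Int.cast_mul, abs_mul]
              exact mul_le_one₀ (abs_jacobiSym_le_one _ _) (abs_nonneg _)
                (abs_jacobiSym_le_one _ _)
          _ = ((Y / m : ℕ) : ℝ) := by simp
          _ ≤ (Y : ℝ) / m := Nat.cast_div_le
          _ ≤ _ := by have : 0 ≤ 4 * (M : ℝ) ^ 2 := by positivity
                      linarith
      · refine (abs_sum_jacobiSym_mul_le hs.2.1 hs'.2.1 hs.1 hs'.1 h _).trans ?_
        have e1 : (m : ℝ) ≤ M := by exact_mod_cast hm.2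
        have e2 : (m' : ℝ) ≤ M := by exact_mod_cast hm'.2
        have e3 : (m : ℝ) * m' ≤ M * M := by gcongr
        rw [sq]; linarith
    refine (le_abs_self _).trans ?_
    rw [abs_mul]
    exact (mul_le_of_le_one_left (abs_nonneg _) hα2).trans h3
  have h3 : ∀ m ∈ Icc 1 M, ∑ n ∈ Icc 1 N, ∑ m' ∈ Icc 1 M, α m * α m' *
        (if m * n ≤ Y ∧ m' * n ≤ Y then ((jacobiSym n m * jacobiSym n m' : ℤ) : ℝ) else 0) ≤
        (Y : ℝ) / m + 4 * (M : ℝ) ^ 3 := by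
    intro m hm
    rw [Finset.sum_comm]
    refine (Finset.sum_le_sum fun m' hm' => h2 m hm m' hm').trans ?_
    rw [Finset.sum_add_distrib, Finset.sum_ite_eq, if_pos hm]
    simp; ring_nf; rfl
  refine (Finset.sum_le_sum h3).trans ?_
  rw [Finset.sum_add_distrib]
  have h4 : ∑ m ∈ Icc 1 M, (Y : ℝ) / m ≤ Y * (1 + Real.log N) := by
    rcases Nat.eq_zero_or_pos M with h | h
    · subst h
      have := Real.log_natCast_nonneg N
      simp; positivity
    have := harmonic_le_one_add_log M
    rw [harmonic_eq_sum_Icc] at this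
    push_cast at this
    have hl : Real.log M ≤ Real.log N := Real.log_le_log (by positivity) (by exact_mod_cast hMN)
    simp_rw [div_eq_mul_inv]
    rw [← Finset.mul_sum]
    gcongr
    linarith
  have h5 : (M : ℝ) ^ 4 ≤ Y := by exact_mod_cast hM
  have h6 : ∑ m ∈ Icc 1 M, 4 * (M : ℝ) ^ 3 = 4 * (M : ℝ) ^ 4 := by simp; ring
  rw [h6]
  linarith

/-- Bilinear sums of Jacobi symbols. -/
theorem abs_bilinear_jacobiSym_le {α β : ℕ → ℝ} {M N Y : ℕ} {L : ℝ} (hL : 0 < L)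
    (hα : ∀ m, |α m| ≤ 1) (hβ : ∀ n, |β n| ≤ 1)
    (hsupp : ∀ m, α m ≠ 0 → Odd m ∧ Squarefree m ∧ m ≤ M ∧ L ≤ m)
    (hsuppβ : ∀ n, β n ≠ 0 → M ^ 4 ≤ n) (hY : Y ≤ N) :
    |∑ m ∈ Icc 1 N, ∑ n ∈ Icc 1 N,
      if m * n ≤ Y then α m * β n * (jacobiSym n m : ℝ) else 0| ≤
      Y * Real.sqrt ((5 + Real.log N) / L) := by
  have hlN := Real.log_natCast_nonneg N
  by_cases hM : M ^ 4 ≤ Y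
  swap
  · rw [Finset.sum_eq_zero]
    · simp; positivity
    intro m hm
    refine Finset.sum_eq_zero fun n hn => ?_
    by_cases h : β n = 0
    · simp [h]
    rw [if_neg]
    intro h1
    have := hsuppβ n h
    have : n ≤ m * n := Nat.le_mul_of_pos_left n (Finset.mem_Icc.1 hm).1
    omega
  have h1 : ∑ m ∈ Icc 1 N, ∑ n ∈ Icc 1 N,
      (if m * n ≤ Y then α m * β n * (jacobiSym n m : ℝ) else 0) =
      ∑ n ∈ (Icc 1 N).filter (fun n : ℕ => (n : ℝ) ≤ Y / L), β n *
        ∑ m ∈ Icc 1 N, if m * n ≤ Y then α m * (jacobiSym n m : ℝ) else 0 := by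
    rw [Finset.sum_comm, Finset.sum_filter]
    refine Finset.sum_congr rfl fun n hn => ?_
    split_ifs with h
    · rw [Finset.mul_sum]
      refine Finset.sum_congr rfl fun m _ => ?_
      split_ifs <;> ring
    · refine Finset.sum_eq_zero fun m hm => ?_
      by_cases h2 : α m = 0
      · simp [h2]
      rw [if_neg]
      intro h3
      apply h
      rw [le_div_iff₀ hL]
      have h4 : ((m * n : ℕ) : ℝ) ≤ Y := by exact_mod_cast h3
      push_cast at h4
      have := (hsupp m h2).2.2.2
      have : (n : ℝ) * L ≤ n * m := by gcongr
      linarith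
  rw [h1]
  set T : ℕ → ℝ := fun n => ∑ m ∈ Icc 1 N, if m * n ≤ Y then α m * (jacobiSym n m : ℝ) else 0
  have h2 : ∑ n ∈ Icc 1 N, T n ^ 2 ≤ Y * (5 + Real.log N) :=
    sum_sq_le_of_bilinear hα (fun m hm => ⟨(hsupp m hm).1, (hsupp m hm).2.1, (hsupp m hm).2.2.1⟩)
      hM hY
  set B := (Icc 1 N).filter (fun n : ℕ => (n : ℝ) ≤ Y / L)
  have hYL : (0 : ℝ) ≤ Y / L := by positivity
  have hcard : (#B : ℝ) ≤ Y / L := by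
    have : B ⊆ Icc 1 ⌊(Y : ℝ) / L⌋₊ := fun n hn => by
      have := Finset.mem_filter.1 hn
      exact Finset.mem_Icc.2 ⟨(Finset.mem_Icc.1 this.1).1, Nat.le_floor this.2⟩
    have := Finset.card_le_card this
    rw [Nat.card_Icc, Nat.add_sub_cancel] at this
    exact (by exact_mod_cast this : (#B : ℝ) ≤ (⌊(Y : ℝ) / L⌋₊ : ℝ)).trans (Nat.floor_le hYL)
  have h3 := Finset.sum_mul_sq_le_sq_mul_sq B β T
  have h4 : ∑ n ∈ B, β n ^ 2 ≤ Y / L := by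
    calc _ ≤ ∑ n ∈ B, (1 : ℝ) :=
          Finset.sum_le_sum fun n _ => (sq_le_one_iff_abs_le_one _).2 (hβ n)
      _ ≤ _ := by simpa using hcard
  have h5 : ∑ n ∈ B, T n ^ 2 ≤ Y * (5 + Real.log N) :=
    (Finset.sum_le_sum_of_subset_of_nonneg (Finset.filter_subset _ _)
      fun _ _ _ => sq_nonneg _).trans h2
  have h6 : (∑ n ∈ B, β n * T n) ^ 2 ≤ (Y * Real.sqrt ((5 + Real.log N) / L)) ^ 2 := by
    rw [mul_pow, Real.sq_sqrt (by positivity)]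
    calc _ ≤ _ := h3
      _ ≤ (Y / L) * (Y * (5 + Real.log N)) := by
        refine mul_le_mul h4 h5 (Finset.sum_nonneg fun _ _ => sq_nonneg _) hYL
      _ = _ := by ring
  exact abs_le_of_sq_le_sq h6 (by positivity)

/-- Bilinear sums of Jacobi symbols, with the roles of the variables interchanged. -/
theorem abs_bilinear_jacobiSym_swap_le {α β : ℕ → ℝ} {M N Y : ℕ} {L : ℝ} (hL : 0 < L)
    (hα : ∀ m, |α m| ≤ 1) (hβ : ∀ n, |β n| ≤ 1)
    (hsupp : ∀ m, α m ≠ 0 → Odd m ∧ Squarefree m ∧ m ≤ M ∧ L ≤ m)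
    (hsuppβ : ∀ n, β n ≠ 0 → Odd n ∧ M ^ 4 ≤ n) (hY : Y ≤ N) :
    |∑ m ∈ Icc 1 N, ∑ n ∈ Icc 1 N,
      if m * n ≤ Y then α m * β n * (jacobiSym m n : ℝ) else 0| ≤
      2 * (Y * Real.sqrt ((5 + Real.log N) / L)) := by
  have h1 := abs_bilinear_jacobiSym_le (α := fun m => if m % 4 = 1 then α m else 0) (β := β)
    (N := N) (Y := Y) hL (fun m => by split_ifs; exacts [hα m, by simp]) hβ
    (fun m hm => hsupp m (by intro h; simp [h] at hm)) (fun n hn => (hsuppβ n hn).2) hY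
  have h3 := abs_bilinear_jacobiSym_le (α := fun m => if m % 4 = 1 then 0 else α m)
    (β := fun n => β n * ZMod.χ₄ n)
    (N := N) (Y := Y) hL (fun m => by split_ifs; exacts [by simp, hα m])
    (fun n => by rw [abs_mul]; exact mul_le_one₀ (hβ n) (abs_nonneg _) (abs_chi4_le_one _))
    (fun m hm => hsupp m (by intro h; simp [h] at hm))
    (fun n hn => (hsuppβ n (left_ne_zero_of_mul hn)).2) hY
  have key : ∑ m ∈ Icc 1 N, ∑ n ∈ Icc 1 N,
      (if m * n ≤ Y then α m * β n * (jacobiSym m n : ℝ) else 0) =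
      (∑ m ∈ Icc 1 N, ∑ n ∈ Icc 1 N, if m * n ≤ Y then
        (if m % 4 = 1 then α m else 0) * β n * (jacobiSym n m : ℝ) else 0) +
      (∑ m ∈ Icc 1 N, ∑ n ∈ Icc 1 N, if m * n ≤ Y then
        (if m % 4 = 1 then 0 else α m) * (β n * ZMod.χ₄ n) * (jacobiSym n m : ℝ) else 0) := by
    rw [← Finset.sum_add_distrib]
    refine Finset.sum_congr rfl fun m _ => ?_
    rw [← Finset.sum_add_distrib]
    refine Finset.sum_congr rfl fun n _ => ?_
    by_cases h : m * n ≤ Y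
    swap
    · simp [h]
    simp only [h, if_true]
    by_cases hm : α m = 0
    · simp [hm]
    by_cases hn : β n = 0
    · simp [hn]
    have hmo := (hsupp m hm).1
    have hno := (hsuppβ n hn).1
    by_cases h4 : m % 4 = 1
    · simp only [h4, if_true]
      rw [jacobiSym.quadratic_reciprocity_one_mod_four h4 hno]
      ring
    · have hm3 : m % 4 = 3 := by
        have := Nat.odd_iff.1 hmo; omega
      simp only [h4, if_false]
      have : n % 4 = 1 ∨ n % 4 = 3 := by
        have := Nat.odd_iff.1 hno; omega
      rcases this with hn1 | hn3
      · rw [jacobiSym.quadratic_reciprocity_one_mod_four' hmo hn1, ZMod.χ₄_nat_one_mod_four hn1]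
        push_cast; ring
      · rw [jacobiSym.quadratic_reciprocity_three_mod_four hm3 hn3, ZMod.χ₄_nat_three_mod_four hn3]
        push_cast; ring
  rw [key]
  refine (abs_add_le _ _).trans ?_
  linarith

/-- Labels of primes in the expansion of `f̃`: the index of the factor containing the prime, and
whether the corresponding symbol is selected. -/
abbrev Label := Fin 3 × Bool

/-- The symbols attached to two labels do not cancel by quadratic reciprocity. -/
def linked6 (u v : Label) : Bool := u.1 != v.1 && xor u.2 v.2

/-- Linkedness of pairs of labels. -/
def linked36 (u v : Label × Label) : Bool := xor (linked6 u.1 v.1) (linked6 u.2 v.2)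

/-- Translation of labels. -/
def labelShift (a u : Label) : Label := (u.1 - a.1, xor u.2 a.2)

theorem linked6_shift (a u v : Label) : linked6 (labelShift a u) (labelShift a v) = linked6 u v := by
  revert a u v; decide

theorem labelShift_injective (a : Label) : Function.Injective (labelShift a) := by
  revert a; unfold Function.Injective; decide

theorem labelShift_self (a : Label) : labelShift a a = (0, false) := by
  revert a; decide

theorem labelShift_fst {a b : Label} (h : a.1 = b.1) : (labelShift a b).1 = 0 := by
  simp [labelShift, h]

/-- A colouring whose classes consist of pairwise linked labels. -/
def labelColor (w : Label × Label) : Fin 8 :=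
  if w.1.1 = 0 then
    if w.2.1 = 0 then bif w.1.2 then bif w.2.2 then 3 else 2 else bif w.2.2 then 1 else 0
    else if w.2.1 = 1 then bif w.1.2 then 7 else 6 else bif w.1.2 then 5 else 4
  else if w.2.1 = 0 then
    if w.1.1 = 1 then bif w.2.2 then 7 else 6 else bif w.2.2 then 5 else 4
  else if w.1.1 = 1 then bif xor w.1.2 (w.2.1 == 1) then 7 else 6
  else bif xor w.1.2 (w.2.1 == 1) then 5 else 4

set_option maxRecDepth 100000 in
theorem labelColor_linked : ∀ b b' : Bool, (b, b') ≠ (false, false) → ∀ w w' : Label × Label,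
    linked36 ((0, false), (0, false)) w = false → linked36 ((0, false), (0, false)) w' = false →
    linked36 ((0, b), (0, b')) w = false → linked36 ((0, b), (0, b')) w' = false →
    labelColor w = labelColor w' → w = w' ∨ linked36 w w' = true := by
  decide

theorem card_le_eight_of_same_cell {W : Finset (Label × Label)}
    (hW : ∀ w ∈ W, ∀ w' ∈ W, linked36 w w' = false) {a b : Label × Label} (ha : a ∈ W) (hb : b ∈ W)
    (hab : a ≠ b) (h1 : a.1.1 = b.1.1) (h2 : a.2.1 = b.2.1) : #W ≤ 8 := by
  let τ : Label × Label → Label × Label := fun w => (labelShift a.1 w.1, labelShift a.2 w.2)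
  have hτ : Function.Injective τ := fun u v h => by
    simp only [τ, Prod.mk.injEq] at h
    exact Prod.ext (labelShift_injective _ h.1) (labelShift_injective _ h.2)
  have hlink : ∀ u v, linked36 (τ u) (τ v) = linked36 u v := fun u v => by
    simp only [linked36, τ, linked6_shift]
  have ha0 : τ a = ((0, false), (0, false)) := by simp only [τ, labelShift_self]
  obtain ⟨c, c', hb0⟩ : ∃ c c', τ b = ((0, c), (0, c')) :=
    ⟨(τ b).1.2, (τ b).2.2, Prod.ext (Prod.ext (labelShift_fst h1) rfl)
      (Prod.ext (labelShift_fst h2) rfl)⟩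
  have hcc : (c, c') ≠ (false, false) := by
    intro h
    simp only [Prod.mk.injEq] at h
    exact hab (hτ (by rw [ha0, hb0, h.1, h.2]))
  have : #W ≤ #(univ : Finset (Fin 8)) := by
    refine Finset.card_le_card_of_injOn (fun w => labelColor (τ w)) (fun _ _ => by simp) ?_
    intro w hw w' hw' hc
    rcases labelColor_linked c c' hcc (τ w) (τ w') (by rw [← ha0, hlink]; exact hW _ ha _ hw)
      (by rw [← ha0, hlink]; exact hW _ ha _ hw') (by rw [← hb0, hlink]; exact hW _ hb _ hw)
      (by rw [← hb0, hlink]; exact hW _ hb _ hw') hc with h | h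
    · exact hτ h
    · rw [hlink, hW w hw w' hw'] at h
      exact absurd h (by decide)
  simpa using this

theorem const_of_pairs : ∀ e d : Fin 3 → Bool,
    (∀ i i' j j', i ≠ i' → j ≠ j' → (e j ≠ e j' ↔ d i ≠ d i')) →
    (∀ j, e j = e 0) ∧ ∀ i, d i = d 0 := by
  decide

/-- A set of pairwise unlinked labels has at most nine elements, and the selection bits are constant
if it has exactly nine. -/
theorem card_unlinked {W : Finset (Label × Label)}
    (hW : ∀ w ∈ W, ∀ w' ∈ W, linked36 w w' = false) :
    #W ≤ 8 ∨ ∃ b b' : Bool, ∀ w ∈ W, w.1.2 = b ∧ w.2.2 = b' := by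
  by_contra! hcon
  obtain ⟨h8, hcon⟩ := hcon
  let cell : Label × Label → Fin 3 × Fin 3 := fun w => (w.1.1, w.2.1)
  have hinj : Set.InjOn cell W := by
    intro a ha b hb h
    by_contra hab
    simp only [cell, Prod.mk.injEq] at h
    exact absurd (card_le_eight_of_same_cell hW ha hb hab h.1 h.2) (by omega)
  have himg : W.image cell = univ := by
    refine Finset.eq_univ_of_card _ (le_antisymm (Finset.card_le_univ _) ?_)
    rw [Finset.card_image_of_injOn hinj]
    simp; omega
  have hex : ∀ i j, ∃ w ∈ W, w.1.1 = i ∧ w.2.1 = j := fun i j => by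
    have : (i, j) ∈ W.image cell := by rw [himg]; simp
    obtain ⟨w, hw, h⟩ := Finset.mem_image.1 this
    simp only [cell, Prod.mk.injEq] at h
    exact ⟨w, hw, h⟩
  choose f hfW hf1 hf2 using hex
  have he : ∀ i i' j, (f i j).1.2 = (f i' j).1.2 := by
    intro i i' j
    by_cases h : i = i'
    · rw [h]
    have := hW _ (hfW i j) _ (hfW i' j)
    simpa [linked36, linked6, hf1, hf2, h] using this
  have hd : ∀ i j j', (f i j).2.2 = (f i j').2.2 := by
    intro i j j'
    by_cases h : j = j'
    · rw [h]
    have := hW _ (hfW i j) _ (hfW i j')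
    simpa [linked36, linked6, hf1, hf2, h] using this
  obtain ⟨h1, h2⟩ := const_of_pairs (fun j => (f 0 j).1.2) (fun i => (f i 0).2.2) (by
    intro i i' j j' hi hj
    have := hW _ (hfW i j) _ (hfW i' j')
    simp only [linked36, linked6, hf1, hf2] at this
    rw [he i 0 j, he i' 0 j', hd i j 0, hd i' j' 0] at this
    revert this
    generalize (f 0 j).1.2 = x1
    generalize (f 0 j').1.2 = x2
    generalize (f i 0).2.2 = x3
    generalize (f i' 0).2.2 = x4
    have hi' : (i != i') = true := by simpa using hi
    have hj' : (j != j') = true := by simpa using hj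
    rw [hi', hj']
    revert x1 x2 x3 x4
    decide)
  obtain ⟨w, hw, hw'⟩ := hcon (f 0 0).1.2 (f 0 0).2.2
  have hwf : w = f w.1.1 w.2.1 := hinj hw (hfW _ _) (by simp [cell, hf1, hf2])
  refine hw' ?_ ?_
  · rw [hwf, he _ 0]; exact h1 _
  · rw [hwf, hd _ _ 0]; exact h2 _

/-- The product of the primes of a given colour. -/
def colorProd {A : Type*} [DecidableEq A] (n : ℕ) (c : n.primeFactors → A) (a : A) : ℕ :=
  ∏ p with c p = a, (p : ℕ)

theorem prime_dvd_colorProd {A : Type*} [DecidableEq A] {n : ℕ} (c : n.primeFactors → A) (a : A)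
    (p : n.primeFactors) : (p : ℕ) ∣ colorProd n c a ↔ c p = a := by
  have hp := Nat.prime_of_mem_primeFactors p.2
  constructor
  · intro h
    obtain ⟨q, hq, hpq⟩ := (Prime.dvd_finsetProd_iff hp.prime _).1 h
    have := (Nat.prime_dvd_prime_iff_eq hp (Nat.prime_of_mem_primeFactors q.2)).1 hpq
    rw [Subtype.ext this]
    simpa using hq
  · intro h
    exact Finset.dvd_prod_of_mem (fun q : n.primeFactors => (q : ℕ)) (by simp [h])

theorem prod_colorProd {A : Type*} [Fintype A] [DecidableEq A] {n : ℕ} (hn : Squarefree n)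
    (c : n.primeFactors → A) : ∏ a, colorProd n c a = n := by
  unfold colorProd
  rw [Finset.prod_fiberwise]
  rw [Finset.prod_coe_sort n.primeFactors (fun p => p)]
  exact Nat.prod_primeFactors_of_squarefree hn

theorem prod_primeFactors_colorProd {A : Type*} [DecidableEq A] {n : ℕ} (c : n.primeFactors → A)
    (a : A) (f : ℕ → ℝ) :
    ∏ p ∈ (colorProd n c a).primeFactors, f p = ∏ p with c p = a, f (p : ℕ) := by
  have : (colorProd n c a).primeFactors = (univ.filter fun p => c p = a).image Subtype.val := by
    ext p
    simp only [Nat.mem_primeFactors, mem_image, mem_filter, mem_univ, true_and]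
    constructor
    · rintro ⟨hp, hd, h0⟩
      obtain ⟨q, hq, hpq⟩ := (Prime.dvd_finsetProd_iff hp.prime _).1 hd
      refine ⟨q, by simpa using hq, ?_⟩
      exact ((Nat.prime_dvd_prime_iff_eq hp (Nat.prime_of_mem_primeFactors q.2)).1 hpq).symm
    · rintro ⟨q, hq, rfl⟩
      refine ⟨Nat.prime_of_mem_primeFactors q.2, (prime_dvd_colorProd c a q).2 hq, ?_⟩
      exact Finset.prod_ne_zero_iff.2 fun r _ => (Nat.prime_of_mem_primeFactors r.2).ne_zero
  rw [this, Finset.prod_image (fun x _ y _ h => Subtype.ext h)]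

theorem sum_colorings_eq {A : Type*} [Fintype A] [DecidableEq A] {n : ℕ} (hn : Squarefree n)
    (Φ : (A → ℕ) → ℝ) :
    ∑ c : n.primeFactors → A, Φ (colorProd n c) =
      ∑ x ∈ (Fintype.piFinset fun _ : A => n.divisors).filter (fun x => ∏ a, x a = n), Φ x := by
  have hn0 : n ≠ 0 := hn.ne_zero
  refine Finset.sum_bij (fun c _ => colorProd n c) ?_ ?_ ?_ (fun _ _ => rfl)
  · intro c _
    refine Finset.mem_filter.2 ⟨Fintype.mem_piFinset.2 fun a => ?_, prod_colorProd hn c⟩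
    refine Nat.mem_divisors.2 ⟨?_, hn0⟩
    conv_rhs => rw [← prod_colorProd hn c]
    exact Finset.dvd_prod_of_mem _ (mem_univ a)
  · intro c _ c' _ h
    funext p
    have := (prime_dvd_colorProd c (c p) p).2 rfl
    rw [congrFun h] at this
    exact ((prime_dvd_colorProd c' (c p) p).1 this).symm
  · intro x hx
    obtain ⟨-, hx⟩ := Finset.mem_filter.1 hx
    have hex : ∀ p : n.primeFactors, ∃ a, (p : ℕ) ∣ x a := fun p => by
      have hd : (p : ℕ) ∣ ∏ a, x a := hx.symm ▸ Nat.dvd_of_mem_primeFactors p.2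
      obtain ⟨a, -, ha⟩ := (Prime.dvd_finsetProd_iff
        (Nat.prime_of_mem_primeFactors p.2).prime _).1 hd
      exact ⟨a, ha⟩
    choose c hc using hex
    refine ⟨c, mem_univ _, ?_⟩
    have hdvd : ∀ a ∈ (univ : Finset A), colorProd n c a ∣ x a := fun a _ => by
      refine Finset.prod_dvd_of_isRelPrime ?_ ?_
      · intro p _ q _ hpq
        refine Nat.coprime_iff_isRelPrime.1 ?_
        exact (Nat.coprime_primes (Nat.prime_of_mem_primeFactors p.2)
          (Nat.prime_of_mem_primeFactors q.2)).2 fun h => hpq (Subtype.ext h)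
      · intro p hp
        rw [← (Finset.mem_filter.1 hp).2]
        exact hc p
    have hpos : ∀ a, 0 < x a := fun a => Nat.pos_of_ne_zero fun h =>
      hn0 (by rw [← hx]; exact Finset.prod_eq_zero (mem_univ a) h)
    funext a
    by_contra hne
    have hlt : ∏ a, colorProd n c a < ∏ a, x a := by
      refine Finset.prod_lt_prod (fun a _ => ?_) (fun a ha => Nat.le_of_dvd (hpos a) (hdvd a ha))
        ⟨a, mem_univ a, lt_of_le_of_ne (Nat.le_of_dvd (hpos a) (hdvd a (mem_univ a))) hne⟩
      exact Nat.pos_of_dvd_of_pos (hdvd a (mem_univ a)) (hpos a)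
    rw [prod_colorProd hn, hx] at hlt
    exact lt_irrefl _ hlt

theorem prod_update_update {A : Type*} [Fintype A] [DecidableEq A] {a b : A} (hab : a ≠ b)
    {M : Type*} [CommMonoid M] (f : A → ℕ → M) (x : A → ℕ) (m n : ℕ) :
    ∏ c, f c (Function.update (Function.update x a m) b n c) =
      f a m * f b n * ∏ c ∈ univ \ {a, b}, f c (x c) := by
  rw [← Finset.prod_sdiff (Finset.subset_univ {a, b}), Finset.prod_pair hab,
    mul_comm (f a m * f b n)]
  refine congrArg₂ _ (Finset.prod_congr rfl fun c hc => ?_) (by simp [hab])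
  have hc' : c ≠ a ∧ c ≠ b := by simpa using hc
  simp [hc'.1, hc'.2]

theorem abs_sum_tuples_le {A : Type*} [Fintype A] [DecidableEq A] {N : ℕ} {ε : ℝ}
    (hε : 0 ≤ ε) {a b : A} (hab : a ≠ b) (F : (A → ℕ) → ℝ)
    (hF : ∀ x : A → ℕ, (∀ c, 1 ≤ x c) → ∀ Y ≤ N,
      |∑ m ∈ Icc 1 N, ∑ n ∈ Icc 1 N, if m * n ≤ Y then
        F (Function.update (Function.update x a m) b n) else 0| ≤ Y * ε) :
    |∑ x ∈ (Fintype.piFinset fun _ : A => Icc 1 N).filter (fun x => ∏ c, x c ≤ N), F x| ≤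
      N * ε * (1 + Real.log N) ^ Fintype.card A := by
  set P := Fintype.piFinset fun _ : A => Icc 1 N with hP
  have hmem : ∀ x, x ∈ P ↔ ∀ c, 1 ≤ x c ∧ x c ≤ N := fun x => by simp [hP, Fintype.mem_piFinset]
  have hprod : ∀ (x : A → ℕ) m n, x a = 1 → x b = 1 →
      ∏ c, Function.update (Function.update x a m) b n c = m * n * ∏ c, x c := by
    intro x m n h1 h2
    rw [prod_update_update hab (fun _ k => k)]
    congr 1
    rw [← Finset.prod_sdiff (Finset.subset_univ {a, b}), Finset.prod_pair hab, h1, h2]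
    simp
  have key : ∑ x ∈ P.filter (fun x => ∏ c, x c ≤ N), F x =
      ∑ x ∈ P.filter (fun x => x a = 1 ∧ x b = 1), ∑ m ∈ Icc 1 N, ∑ n ∈ Icc 1 N,
        if m * n ≤ N / ∏ c, x c then F (Function.update (Function.update x a m) b n) else 0 := by
    rw [Finset.sum_filter]
    simp_rw [← Finset.sum_product']
    symm
    refine Finset.sum_nbij' (fun t => Function.update (Function.update t.1 a t.2.1) b t.2.2)
      (fun x => (Function.update (Function.update x a 1) b 1, x a, x b)) ?_ ?_ ?_ ?_ ?_
    · rintro ⟨x, m, n⟩ h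
      simp only [mem_product, mem_filter, hmem, mem_Icc] at h ⊢
      intro c
      by_cases hcb : c = b
      · subst hcb; simpa using h.2.2
      by_cases hca : c = a
      · subst hca; simpa [hcb] using h.2.1
      simpa [hcb, hca] using h.1.1 c
    · intro x h
      rw [hmem] at h
      have hN : 1 ≤ N := (h a).1.trans (h a).2
      simp only [mem_product, mem_filter, hmem, mem_Icc]
      refine ⟨⟨fun c => ?_, by simp [hab], by simp⟩, h a, h b⟩
      by_cases hcb : c = b
      · subst hcb; simpa using hN
      by_cases hca : c = a
      · subst hca; simpa [hcb] using hN
      simpa [hcb, hca] using h c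
    · rintro ⟨x, m, n⟩ h
      simp only [mem_product, mem_filter] at h
      refine Prod.ext ?_ (Prod.ext ?_ ?_)
      · funext c
        by_cases hcb : c = b
        · subst hcb; simpa using h.1.2.2.symm
        by_cases hca : c = a
        · subst hca; simpa [hcb] using h.1.2.1.symm
        simp [hcb, hca]
      · simp [hab]
      · simp
    · intro x h
      funext c
      by_cases hcb : c = b
      · subst hcb; simp
      by_cases hca : c = a
      · subst hca; simp [hcb]
      simp [hcb, hca]
    · rintro ⟨x, m, n⟩ h
      simp only [mem_product, mem_filter, hmem] at h
      dsimp only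
      rw [hprod x m n h.1.2.1 h.1.2.2]
      have : 0 < ∏ c, x c := Finset.prod_pos fun c _ => (h.1.1 c).1
      simp only [Nat.le_div_iff_mul_le this]
  rw [key]
  refine (Finset.abs_sum_le_sum_abs _ _).trans ?_
  calc _ ≤ ∑ x ∈ P.filter (fun x => x a = 1 ∧ x b = 1), (N * ε) * ∏ c, ((x c : ℕ) : ℝ)⁻¹ := by
        refine Finset.sum_le_sum fun x hx => ?_
        simp only [mem_filter, hmem] at hx
        refine (hF x (fun c => (hx.1 c).1) _ (Nat.div_le_self _ _)).trans ?_
        have : ((N / ∏ c, x c : ℕ) : ℝ) ≤ N * ∏ c, ((x c : ℕ) : ℝ)⁻¹ := by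
          refine Nat.cast_div_le.trans ?_
          rw [Nat.cast_prod, Finset.prod_inv_distrib, div_eq_mul_inv]
        calc _ ≤ _ := mul_le_mul_of_nonneg_right this hε
          _ = _ := by ring
    _ ≤ ∑ x ∈ P, (N * ε) * ∏ c, ((x c : ℕ) : ℝ)⁻¹ :=
        Finset.sum_le_sum_of_subset_of_nonneg (Finset.filter_subset _ _)
          fun _ _ _ => by positivity
    _ = N * ε * (∑ m ∈ Icc 1 N, ((m : ℕ) : ℝ)⁻¹) ^ Fintype.card A := by
        rw [← Finset.mul_sum, hP, ← Finset.prod_univ_sum (fun _ : A => Icc 1 N)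
          (fun _ m => ((m : ℕ) : ℝ)⁻¹)]
        simp
    _ ≤ _ := by
        refine mul_le_mul_of_nonneg_left ?_ (by positivity)
        refine pow_le_pow_left₀ (Finset.sum_nonneg fun _ _ => by positivity) ?_ _
        have := harmonic_le_one_add_log N
        rw [harmonic_eq_sum_Icc] at this
        push_cast at this
        exact this

/-- The coupling between primes `p`, `q` with labels `u`, `v`. -/
def couple (u v : Label) (p q : ℕ) : ℝ :=
  if u.2 = true ∧ u.1 ≠ v.1 then (jacobiSym p q : ℝ) else 1

theorem jacobiSym_cube (a : ℤ) (b : ℕ) : (jacobiSym a b : ℝ) * jacobiSym a b * jacobiSym a b =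
    jacobiSym a b := by
  rcases jacobiSym.trichotomy a b with h | h | h <;> simp [h]

theorem jacobiSym_mul_self {a b : ℕ} (h : a.Coprime b) :
    (jacobiSym a b : ℝ) * jacobiSym a b = 1 := by
  have := jacobiSym.sq_one (a := (a : ℤ)) (b := b) (by simpa using h)
  rw [sq] at this
  exact_mod_cast this

theorem couple_cube (u v : Label) (p q : ℕ) :
    couple u v p q * couple u v p q * couple u v p q = couple u v p q := by
  unfold couple
  split_ifs
  · exact jacobiSym_cube _ _
  · simp

theorem couple_one_left (u v : Label) (q : ℕ) : couple u v 1 q = 1 := by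
  simp [couple, jacobiSym.one_left]

theorem couple_one_right (u v : Label) (p : ℕ) : couple u v p 1 = 1 := by
  simp [couple, jacobiSym.one_right]

/-- Slots refined by pairs of labels. -/
abbrev Cell (K : ℕ) := Fin (K + 1) × (Label × Label)

/-- The coupling between the entries of a tuple. -/
def cellCouple {K : ℕ} (a b : Cell K) (m n : ℕ) : ℝ :=
  if a = b then 1 else if m.Coprime n then couple a.2.1 b.2.1 m n * couple a.2.2 b.2.2 m n else 0

theorem cellCouple_cube {K : ℕ} (a b : Cell K) (m n : ℕ) :
    cellCouple a b m n * cellCouple a b m n * cellCouple a b m n = cellCouple a b m n := by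
  unfold cellCouple
  split_ifs
  · simp
  · calc _ = (couple a.2.1 b.2.1 m n * couple a.2.1 b.2.1 m n * couple a.2.1 b.2.1 m n) *
        (couple a.2.2 b.2.2 m n * couple a.2.2 b.2.2 m n * couple a.2.2 b.2.2 m n) := by ring
      _ = _ := by rw [couple_cube, couple_cube]
  · simp

theorem cellCouple_one_left {K : ℕ} (a b : Cell K) (n : ℕ) : cellCouple a b 1 n = 1 := by
  simp [cellCouple, couple_one_left]

theorem cellCouple_one_right {K : ℕ} (a b : Cell K) (m : ℕ) : cellCouple a b m 1 = 1 := by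
  simp [cellCouple, couple_one_right]

theorem cellCouple_self {K : ℕ} (a : Cell K) (m n : ℕ) : cellCouple a a m n = 1 := by
  simp [cellCouple]

theorem abs_le_one_of_cube {x : ℝ} (h : x * x * x = x) : |x| ≤ 1 := by
  have : x * (x - 1) * (x + 1) = 0 := by linear_combination h
  rcases mul_eq_zero.1 this with h | h
  · rcases mul_eq_zero.1 h with h | h
    · simp [h]
    · rw [show x = 1 by linarith]; simp
  · rw [show x = -1 by linarith]; simp

theorem couple_of_linked {u v : Label} (h : linked6 u v = true) :
    (∀ m n : ℕ, couple u v m n * couple v u n m = jacobiSym m n) ∨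
      ∀ m n : ℕ, couple u v m n * couple v u n m = jacobiSym n m := by
  obtain ⟨i, b⟩ := u
  obtain ⟨j, d⟩ := v
  simp only [linked6, Bool.and_eq_true, bne_iff_ne, ne_eq] at h
  cases b <;> cases d <;> simp_all [couple, eq_comm]

theorem couple_of_not_linked {u v : Label} (h : linked6 u v = false) :
    (∀ m n : ℕ, couple u v m n * couple v u n m = 1) ∨
      ∀ m n : ℕ, couple u v m n * couple v u n m = (jacobiSym m n : ℝ) * jacobiSym n m := by
  obtain ⟨i, b⟩ := u
  obtain ⟨j, d⟩ := v
  by_cases hij : i = j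
  · left; simp [couple, hij]
  have hij' : ¬ j = i := fun h => hij h.symm
  cases b <;> cases d <;> simp_all [couple, linked6]

theorem cellCouple_linked {K : ℕ} {a b : Cell K} (hab : a ≠ b) (hl : linked36 a.2 b.2 = true) :
    (∀ m n : ℕ, m ≠ 0 → cellCouple a b m n * cellCouple b a n m = jacobiSym n m) ∨
      ∀ m n : ℕ, n ≠ 0 → cellCouple a b m n * cellCouple b a n m = jacobiSym m n := by
  have key : ∀ (m n : ℕ), cellCouple a b m n * cellCouple b a n m =
      if m.Coprime n then (couple a.2.1 b.2.1 m n * couple a.2.2 b.2.2 m n) *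
        (couple b.2.1 a.2.1 n m * couple b.2.2 a.2.2 n m) else 0 := by
    intro m n
    unfold cellCouple
    rw [if_neg hab, if_neg hab.symm]
    by_cases h : m.Coprime n
    · simp [h.symm]
    · simp [h]
  have hz : ∀ {m n : ℕ}, m ≠ 0 → ¬ m.Coprime n → ((jacobiSym n m : ℤ) : ℝ) = 0 := by
    intro m n hm h
    have := NeZero.mk hm
    rw [jacobiSym.eq_zero_iff_not_coprime.2 (by simpa [Nat.coprime_comm] using h)]
    simp
  have hsplit : (∀ (m n : ℕ), m.Coprime n → (couple a.2.1 b.2.1 m n * couple a.2.2 b.2.2 m n) *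
        (couple b.2.1 a.2.1 n m * couple b.2.2 a.2.2 n m) = jacobiSym n m) ∨
      (∀ (m n : ℕ), m.Coprime n → (couple a.2.1 b.2.1 m n * couple a.2.2 b.2.2 m n) *
        (couple b.2.1 a.2.1 n m * couple b.2.2 a.2.2 n m) = jacobiSym m n) := by
    have hre : ∀ m n : ℕ, (couple a.2.1 b.2.1 m n * couple a.2.2 b.2.2 m n) *
        (couple b.2.1 a.2.1 n m * couple b.2.2 a.2.2 n m) =
        (couple a.2.1 b.2.1 m n * couple b.2.1 a.2.1 n m) *
        (couple a.2.2 b.2.2 m n * couple b.2.2 a.2.2 n m) := fun m n => by ring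
    simp only [hre]
    have hsq : ∀ m n : ℕ, m.Coprime n → (jacobiSym m n : ℝ) * jacobiSym m n = 1 ∧
        (jacobiSym n m : ℝ) * jacobiSym n m = 1 := fun m n h =>
      ⟨jacobiSym_mul_self h, jacobiSym_mul_self h.symm⟩
    have hl' : (linked6 a.2.1 b.2.1 = true ∧ linked6 a.2.2 b.2.2 = false) ∨
        (linked6 a.2.1 b.2.1 = false ∧ linked6 a.2.2 b.2.2 = true) := by
      simp only [linked36] at hl
      cases h1 : linked6 a.2.1 b.2.1 <;> cases h2 : linked6 a.2.2 b.2.2 <;> simp_all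
    rcases hl' with ⟨h1, h2⟩ | ⟨h1, h2⟩
    · rcases couple_of_linked h1 with h1 | h1 <;> rcases couple_of_not_linked h2 with h2 | h2 <;>
        simp only [h1, h2]
      · right; intro m n _; ring
      · left; intro m n h; linear_combination (jacobiSym n m : ℝ) * (hsq m n h).1
      · left; intro m n _; ring
      · right; intro m n h; linear_combination (jacobiSym m n : ℝ) * (hsq m n h).2
    · rcases couple_of_linked h2 with h2 | h2 <;> rcases couple_of_not_linked h1 with h1 | h1 <;>
        simp only [h1, h2]
      · right; intro m n _; ring
      · left; intro m n h; linear_combination (jacobiSym n m : ℝ) * (hsq m n h).1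
      · left; intro m n _; ring
      · right; intro m n h; linear_combination (jacobiSym m n : ℝ) * (hsq m n h).2
  rcases hsplit with h | h
  · left
    intro m n hm
    rw [key]
    split_ifs with hc
    · exact h m n hc
    · exact (hz hm hc).symm
  · right
    intro m n hn
    rw [key]
    split_ifs with hc
    · exact h m n hc
    · exact (hz hn (by rwa [Nat.coprime_comm])).symm

/-- Condition on the entry of a tuple at a cell. -/
def CellOK (K N : ℕ) (S : Finset (Cell K)) (a : Cell K) (m : ℕ) : Prop :=
  Squarefree m ∧ Odd m ∧ (∀ p ∈ m.primeFactors, slot K N p = a.1) ∧ (m ≠ 1 ↔ a ∈ S)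

/-- The size of the part of a tuple in each slot is bounded. -/
def SlotsOK (K N : ℕ) (x : Cell K → ℕ) : Prop :=
  ∀ j : Fin (K + 1), Real.log (∏ a with a.1 = j, x a : ℕ) ≤
    Real.exp (((j : ℕ) + 2) * Real.log (Real.log N) / K)

/-- The local weight of a tuple at a cell. -/
def cellWeight (K N : ℕ) (S : Finset (Cell K)) (a : Cell K) (m : ℕ) : ℝ :=
  if CellOK K N S a m then (1 / 9) ^ #m.primeFactors else 0

/-- The signed weight of a tuple. -/
def tupleWeight (K N : ℕ) (S : Finset (Cell K)) (x : Cell K → ℕ) : ℝ :=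
  (∏ a, cellWeight K N S a (x a)) * (if SlotsOK K N x then 1 else 0) *
    ∏ a, ∏ b, cellCouple a b (x a) (x b)

theorem abs_cellWeight_le_one {K N : ℕ} (S : Finset (Cell K)) (a : Cell K) (m : ℕ) :
    |cellWeight K N S a m| ≤ 1 := by
  unfold cellWeight
  split_ifs
  · rw [abs_of_nonneg (by positivity)]
    exact pow_le_one₀ (by norm_num) (by norm_num)
  · simp

section
variable {K N : ℕ} {S : Finset (Cell K)} {a b : Cell K} {x : Cell K → ℕ}

theorem prod_cellCouple_update (hab : a ≠ b) (m n : ℕ) :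
    let X : ℕ → ℕ → Cell K → ℕ := fun m n => Function.update (Function.update x a m) b n
    ∏ c, ∏ d, cellCouple c d (X m n c) (X m n d) =
      (∏ c, ∏ d, cellCouple c d (X 1 1 c) (X 1 1 d)) *
      (∏ c, ∏ d, cellCouple c d (X m 1 c) (X m 1 d)) *
      (∏ c, ∏ d, cellCouple c d (X 1 n c) (X 1 n d)) *
      (cellCouple a b m n * cellCouple b a n m) := by
  intro X
  have hone : cellCouple a b m n * cellCouple b a n m =
      ∏ c, ∏ d, (if c = a ∧ d = b then cellCouple a b m n else 1) *
        (if c = b ∧ d = a then cellCouple b a n m else 1) := by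
    simp only [Finset.prod_mul_distrib, ite_and]
    simp
  rw [hone]
  simp only [← Finset.prod_mul_distrib]
  have hXa : ∀ m n, X m n a = m := fun m n => by simp [X, hab]
  have hXb : ∀ m n, X m n b = n := fun m n => by simp [X]
  have hX : ∀ m n c, c ≠ a → c ≠ b → X m n c = x c := fun m n c h1 h2 => by simp [X, h1, h2]
  refine Finset.prod_congr rfl fun c _ => Finset.prod_congr rfl fun d _ => ?_
  by_cases hca : c = a
  · subst hca
    by_cases hda : d = c
    · subst hda; simp [cellCouple_self, hab]
    by_cases hdb : d = b
    · subst hdb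
      simp [hXa, hXb, hab, cellCouple_one_left, cellCouple_one_right]
    simp [hXa, hX, hda, hdb, hab, cellCouple_one_left]
  by_cases hcb : c = b
  · subst hcb
    by_cases hda : d = a
    · subst hda
      simp [hXa, hXb, hca, cellCouple_one_left, cellCouple_one_right]
    by_cases hdb : d = c
    · subst hdb; simp [cellCouple_self, hca]
    simp [hXb, hX, hda, hdb, hca, cellCouple_one_left]
  by_cases hda : d = a
  · subst hda
    simp [hXa, hX, hca, hcb, hab, cellCouple_one_right]
  by_cases hdb : d = b
  · subst hdb
    simp [hXb, hX, hca, hcb, cellCouple_one_right]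
  simp [hX, hca, hcb, hda, hdb, cellCouple_cube]

theorem slotsOK_update (hab : a.1 ≠ b.1) (hx : ∀ c, 1 ≤ x c) {m n : ℕ} (hm : 1 ≤ m) (hn : 1 ≤ n) :
    SlotsOK K N (Function.update (Function.update x a m) b n) ↔
      SlotsOK K N (Function.update (Function.update x a m) b 1) ∧
      SlotsOK K N (Function.update (Function.update x a 1) b n) := by
  have hab' : a ≠ b := fun h => hab (by rw [h])
  have hpos : ∀ m n, 1 ≤ m → 1 ≤ n → ∀ c,
      0 < Function.update (Function.update x a m) b n c := by
    intro m n hm hn c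
    by_cases h1 : c = b
    · subst h1; simpa using Nat.lt_of_succ_le hn
    by_cases h2 : c = a
    · subst h2; simpa [h1] using Nat.lt_of_succ_le hm
    simpa [h1, h2] using Nat.lt_of_succ_le (hx c)
  have mono : ∀ m n m' n', 1 ≤ m → 1 ≤ n → m ≤ m' → n ≤ n' →
      SlotsOK K N (Function.update (Function.update x a m') b n') →
      SlotsOK K N (Function.update (Function.update x a m) b n) := by
    intro m n m' n' hm hn hmm hnn h j
    refine le_trans (Real.log_le_log ?_ ?_) (h j)
    · exact_mod_cast Finset.prod_pos fun c _ => hpos m n hm hn c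
    · refine Nat.cast_le.2 (Finset.prod_le_prod' fun c _ => ?_)
      by_cases h1 : c = b
      · subst h1; simpa using hnn
      by_cases h2 : c = a
      · subst h2; simpa [h1] using hmm
      simp [h1, h2]
  refine ⟨fun h => ⟨mono _ _ _ _ hm le_rfl le_rfl hn h, mono _ _ _ _ le_rfl hn hm le_rfl h⟩, ?_⟩
  rintro ⟨h1, h2⟩ j
  by_cases hj : b.1 = j
  · convert h2 j using 3
    refine Finset.prod_congr rfl fun c hc => ?_
    have : c ≠ a := fun h => hab (by rw [← h, hj]; simpa using hc)
    by_cases hcb : c = b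
    · subst hcb; simp
    simp [this, hcb]
  · convert h1 j using 3
    refine Finset.prod_congr rfl fun c hc => ?_
    have : c ≠ b := fun h => hj (by rw [← h]; simpa using hc)
    simp [this]

theorem le_of_slotsOK (hx : ∀ c, 1 ≤ x c) (h : SlotsOK K N x) (a : Cell K) :
    x a ≤ ⌊Real.exp (Real.exp (((a.1 : ℕ) + 2) * Real.log (Real.log N) / K))⌋₊ := by
  refine Nat.le_floor ?_
  rw [← Real.log_le_iff_le_exp (by exact_mod_cast hx a)]
  refine le_trans (Real.log_le_log (by exact_mod_cast hx a) ?_) (h a.1)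
  refine Nat.cast_le.2 (Nat.le_of_dvd (Finset.prod_pos fun c _ => hx c) ?_)
  exact Finset.dvd_prod_of_mem _ (by simp)

theorem exp_exp_le_of_cellOK (hK : 0 < K) (hN : 0 < Real.log (Real.log N)) {m : ℕ}
    (h : CellOK K N S a m) (ha : a ∈ S) (ha1 : 1 ≤ (a.1 : ℕ)) :
    Real.exp (Real.exp ((a.1 : ℕ) * Real.log (Real.log N) / K)) ≤ m := by
  obtain ⟨hsq, -, hslot, h1⟩ := h
  obtain ⟨p, hp, hpm⟩ := Nat.exists_prime_and_dvd (h1.2 ha)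
  have hs := hslot p (Nat.mem_primeFactors.2 ⟨hp, hpm, hsq.ne_zero⟩)
  have := exp_exp_slot_le hK hN hp (by rw [hs]; exact ha1)
  rw [hs] at this
  exact this.trans (by exact_mod_cast Nat.le_of_dvd (Nat.pos_of_ne_zero hsq.ne_zero) hpm)

theorem abs_sum_tupleWeight_update_le (hK : 0 < K) (hN : 0 < Real.log (Real.log N))
    (h4 : 4 ≤ Real.exp (Real.log (Real.log N) / K))
    (hl : linked36 a.2 b.2 = true) (ha : 1 ≤ (a.1 : ℕ)) (hb : (a.1 : ℕ) + 3 ≤ b.1)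
    (haS : a ∈ S) (hbS : b ∈ S) (hx : ∀ c, 1 ≤ x c) {Y : ℕ} (hY : Y ≤ N) :
    |∑ m ∈ Icc 1 N, ∑ n ∈ Icc 1 N, if m * n ≤ Y then
        tupleWeight K N S (Function.update (Function.update x a m) b n) else 0| ≤
      Y * (2 * Real.sqrt ((5 + Real.log N) /
        Real.exp (Real.exp (Real.log (Real.log N) / K)))) := by
  set y := Real.log (Real.log N) with hy
  have hab1 : a.1 ≠ b.1 := fun h => by rw [h] at hb; omega
  have hab : a ≠ b := fun h => hab1 (by rw [h])
  let X : ℕ → ℕ → Cell K → ℕ := fun m n => Function.update (Function.update x a m) b n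
  have hXa : ∀ m n, X m n a = m := fun m n => by simp [X, hab]
  have hXb : ∀ m n, X m n b = n := fun m n => by simp [X]
  have hXpos : ∀ m n, 1 ≤ m → 1 ≤ n → ∀ c, 1 ≤ X m n c := by
    intro m n hm hn c
    by_cases h1 : c = b
    · subst h1; simpa [X] using hn
    by_cases h2 : c = a
    · subst h2; simpa [X, h1] using hm
    simpa [X, h1, h2] using hx c
  let Q : ℕ → ℕ → ℝ := fun m n => ∏ c, ∏ d, cellCouple c d (X m n c) (X m n d)
  have hQ : ∀ m n, |Q m n| ≤ 1 := fun m n => by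
    simp only [Q, Finset.abs_prod]
    exact Finset.prod_le_one (fun _ _ => Finset.prod_nonneg fun _ _ => abs_nonneg _) fun c _ =>
      Finset.prod_le_one (fun _ _ => abs_nonneg _) fun d _ =>
        abs_le_one_of_cube (cellCouple_cube _ _ _ _)
  let α : ℕ → ℝ := fun m => cellWeight K N S a m * (if SlotsOK K N (X m 1) then 1 else 0) * Q m 1
  let β : ℕ → ℝ := fun n => cellWeight K N S b n * (if SlotsOK K N (X 1 n) then 1 else 0) * Q 1 n
  let γ : ℝ := (∏ c ∈ univ \ {a, b}, cellWeight K N S c (x c)) * Q 1 1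
  have hite : ∀ P : Prop, |(if P then (1 : ℝ) else 0)| ≤ 1 := fun P => by split_ifs <;> simp
  have hmul : ∀ u v : ℝ, |u| ≤ 1 → |v| ≤ 1 → |u * v| ≤ 1 := fun u v hu hv => by
    rw [abs_mul]; exact mul_le_one₀ hu (abs_nonneg _) hv
  have hα : ∀ m, |α m| ≤ 1 := fun m =>
    hmul _ _ (hmul _ _ (abs_cellWeight_le_one _ _ _) (hite _)) (hQ _ _)
  have hβ : ∀ m, |β m| ≤ 1 := fun m =>
    hmul _ _ (hmul _ _ (abs_cellWeight_le_one _ _ _) (hite _)) (hQ _ _)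
  have hγ : |γ| ≤ 1 := by
    refine hmul _ _ ?_ (hQ _ _)
    rw [Finset.abs_prod]
    exact Finset.prod_le_one (fun _ _ => abs_nonneg _) fun _ _ => abs_cellWeight_le_one _ _ _
  have hF : ∀ m n, 1 ≤ m → 1 ≤ n → tupleWeight K N S (X m n) =
      γ * (α m * β n * (cellCouple a b m n * cellCouple b a n m)) := by
    intro m n hm hn
    have h1 := prod_update_update hab (fun c => cellWeight K N S c) x m n
    have h2 := prod_cellCouple_update (x := x) hab m n
    have h3 := slotsOK_update (K := K) (N := N) hab1 hx hm hn
    have h3' : (if SlotsOK K N (X m n) then (1 : ℝ) else 0) =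
        (if SlotsOK K N (X m 1) then 1 else 0) * (if SlotsOK K N (X 1 n) then 1 else 0) := by
      by_cases hA : SlotsOK K N (X m 1) <;> by_cases hB : SlotsOK K N (X 1 n) <;>
        simp [X, h3] at * <;> simp [hA, hB]
    unfold tupleWeight
    rw [h3', show (∏ c, cellWeight K N S c (X m n c)) = _ from h1,
      show (∏ c, ∏ d, cellCouple c d (X m n c) (X m n d)) = _ from h2]
    simp only [γ, α, β, Q, X]
    ring
  set L := Real.exp (Real.exp (y / K)) with hL
  have hL0 : 0 < L := Real.exp_pos _
  set M := ⌊Real.exp (Real.exp (((a.1 : ℕ) + 2) * y / K))⌋₊ with hM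
  have hK' : (0 : ℝ) < K := by exact_mod_cast hK
  have hsupp : ∀ m, α m ≠ 0 → Odd m ∧ Squarefree m ∧ m ≤ M ∧ L ≤ m := by
    intro m hm
    have hc : CellOK K N S a m := by
      by_contra h
      simp [α, cellWeight, h] at hm
    have hs : SlotsOK K N (X m 1) := by
      by_contra h
      simp [α, h] at hm
    have hm1 : 1 ≤ m := Nat.pos_of_ne_zero hc.1.ne_zero
    refine ⟨hc.2.1, hc.1, ?_, ?_⟩
    · have := le_of_slotsOK (hXpos m 1 hm1 le_rfl) hs a
      rwa [hXa] at this
    · refine le_trans ?_ (exp_exp_le_of_cellOK hK hN hc haS ha)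
      rw [hL, Real.exp_le_exp, Real.exp_le_exp]
      refine div_le_div_of_nonneg_right ?_ hK'.le
      exact le_mul_of_one_le_left hN.le (by exact_mod_cast ha)
  have hsuppβ : ∀ n, β n ≠ 0 → Odd n ∧ M ^ 4 ≤ n := by
    intro n hn
    have hc : CellOK K N S b n := by
      by_contra h
      simp [β, cellWeight, h] at hn
    refine ⟨hc.2.1, ?_⟩
    have h1 := exp_exp_le_of_cellOK hK hN hc hbS (by omega)
    have h2 : ((M ^ 4 : ℕ) : ℝ) ≤ Real.exp (Real.exp (((b.1 : ℕ) : ℝ) * y / K)) := by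
      push_cast
      calc (M : ℝ) ^ 4 ≤ (Real.exp (Real.exp (((a.1 : ℕ) + 2) * y / K))) ^ 4 :=
            pow_le_pow_left₀ (by positivity) (Nat.floor_le (Real.exp_pos _).le) 4
        _ = Real.exp (4 * Real.exp (((a.1 : ℕ) + 2) * y / K)) := by
            rw [← Real.exp_nat_mul]; norm_num
        _ ≤ Real.exp (Real.exp (y / K) * Real.exp (((a.1 : ℕ) + 2) * y / K)) :=
            Real.exp_le_exp.2 (mul_le_mul_of_nonneg_right h4 (Real.exp_pos _).le)
        _ ≤ _ := by
            rw [← Real.exp_add, Real.exp_le_exp, Real.exp_le_exp, ← add_div]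
            refine div_le_div_of_nonneg_right ?_ hK'.le
            have : ((a.1 : ℕ) : ℝ) + 3 ≤ (b.1 : ℕ) := by exact_mod_cast hb
            nlinarith
    exact_mod_cast h2.trans h1
  have hsum : (∑ m ∈ Icc 1 N, ∑ n ∈ Icc 1 N, if m * n ≤ Y then
        tupleWeight K N S (X m n) else 0) =
      γ * ∑ m ∈ Icc 1 N, ∑ n ∈ Icc 1 N, if m * n ≤ Y then
        α m * β n * (cellCouple a b m n * cellCouple b a n m) else 0 := by
    rw [Finset.mul_sum]
    refine Finset.sum_congr rfl fun m hm => ?_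
    rw [Finset.mul_sum]
    refine Finset.sum_congr rfl fun n hn => ?_
    rw [mul_ite, mul_zero, ← hF m n (Finset.mem_Icc.1 hm).1 (Finset.mem_Icc.1 hn).1]
  rw [show (∑ m ∈ Icc 1 N, ∑ n ∈ Icc 1 N, if m * n ≤ Y then
        tupleWeight K N S (Function.update (Function.update x a m) b n) else 0) = _ from hsum,
    abs_mul]
  refine (mul_le_of_le_one_left (abs_nonneg _) hγ).trans ?_
  have hpos : 0 ≤ Y * Real.sqrt ((5 + Real.log N) / L) := by positivity
  rcases cellCouple_linked hab hl with h | h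
  · have := abs_bilinear_jacobiSym_le (N := N) hL0 hα hβ hsupp (fun n hn => (hsuppβ n hn).2) hY
    have e : (∑ m ∈ Icc 1 N, ∑ n ∈ Icc 1 N, if m * n ≤ Y then
        α m * β n * (cellCouple a b m n * cellCouple b a n m) else 0) =
        ∑ m ∈ Icc 1 N, ∑ n ∈ Icc 1 N, if m * n ≤ Y then α m * β n * (jacobiSym n m : ℝ) else 0 :=
      Finset.sum_congr rfl fun m hm => Finset.sum_congr rfl fun n _ => by
        rw [h m n (by have := (Finset.mem_Icc.1 hm).1; omega)]
    rw [e]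
    linarith
  · have := abs_bilinear_jacobiSym_swap_le (N := N) hL0 hα hβ hsupp hsuppβ hY
    have e : (∑ m ∈ Icc 1 N, ∑ n ∈ Icc 1 N, if m * n ≤ Y then
        α m * β n * (cellCouple a b m n * cellCouple b a n m) else 0) =
        ∑ m ∈ Icc 1 N, ∑ n ∈ Icc 1 N, if m * n ≤ Y then α m * β n * (jacobiSym m n : ℝ) else 0 :=
      Finset.sum_congr rfl fun m _ => Finset.sum_congr rfl fun n hn => by
        rw [h m n (by have := (Finset.mem_Icc.1 hn).1; omega)]
    rw [e]
    linarith

theorem abs_sum_tupleWeight_le (hK : 0 < K) (hN : 0 < Real.log (Real.log N))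
    (h4 : 4 ≤ Real.exp (Real.log (Real.log N) / K))
    (hl : linked36 a.2 b.2 = true) (ha : 1 ≤ (a.1 : ℕ)) (hb : (a.1 : ℕ) + 3 ≤ b.1)
    (haS : a ∈ S) (hbS : b ∈ S) :
    |∑ x ∈ (Fintype.piFinset fun _ : Cell K => Icc 1 N).filter (fun x => ∏ c, x c ≤ N),
        tupleWeight K N S x| ≤
      N * (2 * Real.sqrt ((5 + Real.log N) /
        Real.exp (Real.exp (Real.log (Real.log N) / K)))) *
        (1 + Real.log N) ^ Fintype.card (Cell K) := by
  refine abs_sum_tuples_le (by positivity) (a := a) (b := b) ?_ _ fun x hx Y hY =>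
    abs_sum_tupleWeight_update_le hK hN h4 hl ha hb haS hbS hx hY
  intro h
  rw [h] at hb
  omega

end

/-- The sign attached to a labelling of the primes dividing `n`. -/
def labelSign (n : ℕ) (l : n.primeFactors → Label) : ℝ :=
  ∏ p : n.primeFactors, ∏ q : n.primeFactors, couple (l p) (l q) p q

/-- `n` is a good integer: each slot contributes a factor of controlled size. -/
def Good (K N n : ℕ) : Prop :=
  ∀ j : Fin (K + 1), Real.log (slotProd K N n j) ≤
    Real.exp (((j : ℕ) + 2) * Real.log (Real.log N) / K)

/-- The set of pairs (slot, label) which occur in a labelling. -/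
def pattern (K N n : ℕ) (l : n.primeFactors → Label × Label) : Finset (Cell K) :=
  univ.image fun p : n.primeFactors => (slot K N p, l p)

theorem jacobiSym_prod_left (s : Finset ℕ) (n : ℕ) :
    jacobiSym (∏ p ∈ s, p : ℕ) n = ∏ p ∈ s, jacobiSym (p : ℕ) n := by
  induction s using Finset.induction_on with
  | empty => simp [jacobiSym.one_left]
  | insert a s ha ih => rw [Finset.prod_insert ha, Finset.prod_insert ha, ← ih]; push_cast
                        rw [jacobiSym.mul_left]

theorem jacobiSym_prod_right (m : ℤ) (s : Finset ℕ) (hs : ∀ p ∈ s, p ≠ 0) :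
    jacobiSym m (∏ p ∈ s, p : ℕ) = ∏ p ∈ s, jacobiSym m p := by
  induction s using Finset.induction_on with
  | empty => simp [jacobiSym.one_right]
  | insert a s ha ih =>
    rw [Finset.prod_insert ha, Finset.prod_insert ha, ← ih fun p hp => hs p (by simp [hp])]
    have : NeZero a := ⟨hs a (by simp)⟩
    have : NeZero (∏ p ∈ s, p) := ⟨Finset.prod_ne_zero_iff.2 fun p hp => hs p (by simp [hp])⟩
    rw [jacobiSym.mul_right]

theorem couple_eq_prod (u v : Label) {m n : ℕ} (hm : Squarefree m) (hn : Squarefree n) :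
    couple u v m n = ∏ p ∈ m.primeFactors, ∏ q ∈ n.primeFactors, couple u v p q := by
  unfold couple
  split_ifs
  · rw [← Nat.prod_primeFactors_of_squarefree hm]
    rw [jacobiSym_prod_left, Nat.prod_primeFactors_of_squarefree hm]
    push_cast
    refine Finset.prod_congr rfl fun p _ => ?_
    conv_lhs => rw [← Nat.prod_primeFactors_of_squarefree hn]
    rw [jacobiSym_prod_right _ _ fun q hq => (Nat.prime_of_mem_primeFactors hq).ne_zero]
    push_cast
    rfl
  · simp

section
variable {K N n : ℕ} {S : Finset (Cell K)}

theorem squarefree_colorProd {A : Type*} [DecidableEq A] (hn : Squarefree n)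
    (c : n.primeFactors → A) (a : A) : Squarefree (colorProd n c a) := by
  refine hn.squarefree_of_dvd ?_
  conv_rhs => rw [← Nat.prod_primeFactors_of_squarefree hn,
    ← Finset.prod_coe_sort n.primeFactors (fun p => p)]
  exact Finset.prod_dvd_prod_of_subset _ _ _ (Finset.subset_univ _)

theorem coprime_colorProd {A : Type*} [DecidableEq A] (c : n.primeFactors → A) {a b : A}
    (hab : a ≠ b) : (colorProd n c a).Coprime (colorProd n c b) := by
  refine Nat.Coprime.prod_left fun p hp => Nat.Coprime.prod_right fun q hq => ?_
  refine (Nat.coprime_primes (Nat.prime_of_mem_primeFactors p.2)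
    (Nat.prime_of_mem_primeFactors q.2)).2 fun h => hab ?_
  rw [← (Finset.mem_filter.1 hp).2, ← (Finset.mem_filter.1 hq).2, Subtype.ext h]

theorem colorProd_ne_one {A : Type*} [DecidableEq A] (c : n.primeFactors → A) (a : A) :
    colorProd n c a ≠ 1 ↔ ∃ p, c p = a := by
  constructor
  · intro h
    by_contra! hc
    exact h (by simp [colorProd, hc])
  · rintro ⟨p, hp⟩ h
    have := (prime_dvd_colorProd c a p).2 hp
    rw [h] at this
    exact (Nat.prime_of_mem_primeFactors p.2).one_lt.ne' (Nat.dvd_one.1 this)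

theorem prod_cellCouple_colorProd (hn : Squarefree n) (l : n.primeFactors → Label × Label) :
    ∏ a : Cell K, ∏ b : Cell K, cellCouple a b (colorProd n (fun p => (slot K N p, l p)) a)
      (colorProd n (fun p => (slot K N p, l p)) b) =
    labelSign n (fun p => (l p).1) * labelSign n (fun p => (l p).2) := by
  set c : n.primeFactors → Cell K := fun p => (slot K N p, l p) with hc
  have h1 : ∀ a b : Cell K, cellCouple a b (colorProd n c a) (colorProd n c b) =
      ∏ p with c p = a, ∏ q with c q = b,
        (couple (c p).2.1 (c q).2.1 p q * couple (c p).2.2 (c q).2.2 p q) := by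
    intro a b
    have e : cellCouple a b (colorProd n c a) (colorProd n c b) =
        couple a.2.1 b.2.1 (colorProd n c a) (colorProd n c b) *
          couple a.2.2 b.2.2 (colorProd n c a) (colorProd n c b) := by
      unfold cellCouple
      by_cases hab : a = b
      · subst hab; simp [couple]
      · rw [if_neg hab, if_pos (coprime_colorProd c hab)]
    rw [e, couple_eq_prod _ _ (squarefree_colorProd hn c a) (squarefree_colorProd hn c b),
      couple_eq_prod _ _ (squarefree_colorProd hn c a) (squarefree_colorProd hn c b),
      ← Finset.prod_mul_distrib, prod_primeFactors_colorProd c a (fun p =>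
        (∏ q ∈ (colorProd n c b).primeFactors, couple a.2.1 b.2.1 p q) *
        ∏ q ∈ (colorProd n c b).primeFactors, couple a.2.2 b.2.2 p q)]
    refine Finset.prod_congr rfl fun p hp => ?_
    rw [← Finset.prod_mul_distrib, prod_primeFactors_colorProd c b (fun q =>
        couple a.2.1 b.2.1 p q * couple a.2.2 b.2.2 p q)]
    refine Finset.prod_congr rfl fun q hq => ?_
    rw [(Finset.mem_filter.1 hp).2, (Finset.mem_filter.1 hq).2]
  simp only [h1]
  unfold labelSign
  rw [← Finset.prod_mul_distrib]
  simp only [← Finset.prod_mul_distrib]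
  rw [← Finset.prod_fiberwise univ c]
  refine Finset.prod_congr rfl fun a _ => ?_
  rw [Finset.prod_comm]
  refine Finset.prod_congr rfl fun p _ => ?_
  rw [← Finset.prod_fiberwise univ c]

theorem tupleWeight_colorProd (hn : Squarefree n) (ho : Odd n)
    (l : n.primeFactors → Label × Label) :
    tupleWeight K N S (colorProd n fun p => (slot K N p, l p)) =
      if pattern K N n l = S ∧ Good K N n then
        (1 / 9) ^ #n.primeFactors * (labelSign n (fun p => (l p).1) *
          labelSign n (fun p => (l p).2)) else 0 := by
  unfold tupleWeight
  rw [prod_cellCouple_colorProd hn l]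
  set c : n.primeFactors → Cell K := fun p => (slot K N p, l p) with hc
  have hS : SlotsOK K N (colorProd n c) ↔ Good K N n := by
    unfold SlotsOK Good
    refine forall_congr' fun j => ?_
    have : ∏ a with a.1 = j, colorProd n c a = slotProd K N n j := by
      have e1 : slotProd K N n j = ∏ p ∈ univ.filter (fun p : n.primeFactors => slot K N p = j), (p : ℕ) := by
        unfold slotProd
        rw [Finset.prod_filter, ← Finset.prod_coe_sort n.primeFactors, Finset.prod_filter]
      rw [e1, ← Finset.prod_fiberwise_of_maps_to (g := c) (t := univ.filter fun a => a.1 = j)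
        (s := univ.filter (fun p : n.primeFactors => slot K N p = j)) (fun p hp => by simpa [hc] using hp)]
      refine Finset.prod_congr rfl fun a ha => ?_
      unfold colorProd
      refine Finset.prod_congr ?_ fun _ _ => rfl
      ext p
      simp only [mem_filter, mem_univ, true_and] at ha ⊢
      refine ⟨fun h => ⟨?_, h⟩, fun h => h.2⟩
      rw [← ha, ← h]
    rw [this]
  have hw : ∏ a, cellWeight K N S a (colorProd n c a) =
      if pattern K N n l = S then (1 / 9) ^ #n.primeFactors else 0 := by
    have hmem : ∀ a, a ∈ pattern K N n l ↔ colorProd n c a ≠ 1 := fun a => by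
      rw [colorProd_ne_one]
      simp [pattern, hc]
    split_ifs with hp
    · have hOK : ∀ a, CellOK K N S a (colorProd n c a) := by
        intro a
        refine ⟨squarefree_colorProd hn c a, ?_, ?_, ?_⟩
        · refine Odd.of_dvd_nat ho ?_
          conv_rhs => rw [← prod_colorProd hn c]
          exact Finset.dvd_prod_of_mem _ (mem_univ a)
        · intro p hpp
          have hpn : p ∈ n.primeFactors := by
            refine Nat.primeFactors_mono ?_ hn.ne_zero hpp
            conv_rhs => rw [← prod_colorProd hn c]
            exact Finset.dvd_prod_of_mem _ (mem_univ a)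
          have := (prime_dvd_colorProd c a ⟨p, hpn⟩).1 (Nat.dvd_of_mem_primeFactors hpp)
          rw [← this]
        · rw [← hp, hmem]
      have : ∀ a, cellWeight K N S a (colorProd n c a) = ∏ p with c p = a, (1 / 9 : ℝ) := fun a => by
        rw [cellWeight, if_pos (hOK a), ← Finset.prod_const,
          prod_primeFactors_colorProd c a (fun _ => (1 / 9 : ℝ))]
      simp only [this]
      rw [Finset.prod_fiberwise univ c]
      simp
    · have : ∃ a, ¬ (a ∈ pattern K N n l ↔ a ∈ S) := by
        by_contra! h
        exact hp (Finset.ext h)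
      obtain ⟨a, ha⟩ := this
      refine Finset.prod_eq_zero (mem_univ a) ?_
      rw [cellWeight, if_neg]
      intro h
      exact ha ((hmem a).trans h.2.2.2)
  rw [hw]
  simp only [hS]
  by_cases h1 : pattern K N n l = S <;> by_cases h2 : Good K N n <;> simp [h1, h2]

theorem cellOK_of_tupleWeight_ne_zero {x : Cell K → ℕ} (h : tupleWeight K N S x ≠ 0) :
    (∀ a, CellOK K N S a (x a)) ∧ Pairwise fun a b => (x a).Coprime (x b) := by
  unfold tupleWeight at h
  constructor
  · intro a
    by_contra ha
    have h0 : cellWeight K N S a (x a) = 0 := by rw [cellWeight, if_neg ha]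
    exact h (by rw [Finset.prod_eq_zero (mem_univ a) h0, zero_mul, zero_mul])
  · intro a b hab
    by_contra hc
    have h0 : cellCouple a b (x a) (x b) = 0 := by rw [cellCouple, if_neg hab, if_neg hc]
    refine h ?_
    exact mul_eq_zero_of_right _
      (Finset.prod_eq_zero (mem_univ a) (Finset.prod_eq_zero (mem_univ b) h0))

theorem squarefree_of_tupleWeight_ne_zero {x : Cell K → ℕ} (h : tupleWeight K N S x ≠ 0) :
    Squarefree (∏ a, x a) ∧ Odd (∏ a, x a) := by
  obtain ⟨h1, h2⟩ := cellOK_of_tupleWeight_ne_zero h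
  constructor
  · refine Finset.squarefree_prod_of_pairwise_isCoprime ?_ fun a _ => (h1 a).1
    intro a _ b _ hab
    exact Nat.coprime_iff_isRelPrime.1 (h2 hab)
  · exact Finset.prod_induction _ Odd (fun _ _ => Odd.mul) odd_one fun a _ => (h1 a).2.1

theorem sum_pattern_eq (hn : Squarefree n) (ho : Odd n) :
    ∑ l : n.primeFactors → Label × Label, (if pattern K N n l = S ∧ Good K N n then
        (1 / 9) ^ #n.primeFactors * (labelSign n (fun p => (l p).1) *
          labelSign n (fun p => (l p).2)) else 0) =
      ∑ x ∈ (Fintype.piFinset fun _ : Cell K => n.divisors).filter (fun x => ∏ a, x a = n),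
        tupleWeight K N S x := by
  rw [← sum_colorings_eq hn]
  refine Finset.sum_of_injOn (fun l p => (slot K N p, l p)) ?_ (fun _ _ => mem_univ _) ?_ ?_
  · intro l _ l' _ h
    funext p
    exact congrArg Prod.snd (congrFun h p)
  · intro c _ hc
    by_contra hne
    refine hc ⟨fun p => (c p).2, mem_univ _, ?_⟩
    funext p
    refine Prod.ext ?_ rfl
    have hOK := (cellOK_of_tupleWeight_ne_zero hne).1 (c p)
    have hd := (prime_dvd_colorProd c (c p) p).2 rfl
    exact hOK.2.2.1 p (Nat.mem_primeFactors.2 ⟨Nat.prime_of_mem_primeFactors p.2, hd,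
      hOK.1.ne_zero⟩)
  · intro l _
    rw [tupleWeight_colorProd hn ho]

theorem sum_good_pattern_eq (K N : ℕ) (S : Finset (Cell K)) :
    ∑ n ∈ Icc 1 N with Squarefree n ∧ Odd n ∧ Good K N n,
      (1 / 9) ^ #n.primeFactors * ∑ l : n.primeFactors → Label × Label with pattern K N n l = S,
        (labelSign n (fun p => (l p).1) * labelSign n (fun p => (l p).2)) =
    ∑ x ∈ (Fintype.piFinset fun _ : Cell K => Icc 1 N).filter (fun x => ∏ c, x c ≤ N),
        tupleWeight K N S x := by
  have h1 : ∀ n ∈ Icc 1 N, (∑ x ∈ (Fintype.piFinset fun _ : Cell K => Icc 1 N).filter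
      (fun x => ∏ a, x a = n), tupleWeight K N S x) =
      if Squarefree n ∧ Odd n ∧ Good K N n then (1 / 9) ^ #n.primeFactors *
        ∑ l : n.primeFactors → Label × Label with pattern K N n l = S,
        (labelSign n (fun p => (l p).1) * labelSign n (fun p => (l p).2)) else 0 := by
    intro n hn
    obtain ⟨hn1, hnN⟩ := Finset.mem_Icc.1 hn
    have e : (Fintype.piFinset fun _ : Cell K => Icc 1 N).filter (fun x => ∏ a, x a = n) =
        (Fintype.piFinset fun _ : Cell K => n.divisors).filter (fun x => ∏ a, x a = n) := by
      ext x
      simp only [mem_filter, Fintype.mem_piFinset, mem_Icc, Nat.mem_divisors]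
      refine and_congr_left fun hx => forall_congr' fun a => ?_
      have hd : x a ∣ n := hx ▸ Finset.dvd_prod_of_mem x (mem_univ a)
      have := Nat.le_of_dvd hn1 hd
      have := Nat.pos_of_dvd_of_pos hd hn1
      constructor
      · intro _; exact ⟨hd, by omega⟩
      · intro _; omega
    rw [e]
    by_cases hso : Squarefree n ∧ Odd n
    · rw [← sum_pattern_eq hso.1 hso.2, ← Finset.sum_filter]
      by_cases hg : Good K N n
      · simp only [hg, hso.1, hso.2, and_true, if_true]
        rw [Finset.mul_sum]
      · simp [hg]
    · rw [if_neg (fun h => hso ⟨h.1, h.2.1⟩)]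
      refine Finset.sum_eq_zero fun x hx => ?_
      by_contra hne
      have := squarefree_of_tupleWeight_ne_zero hne
      rw [(Finset.mem_filter.1 hx).2] at this
      exact hso this
  rw [Finset.sum_filter, ← Finset.sum_congr rfl h1]
  rw [← Finset.sum_fiberwise_of_maps_to (g := fun x : Cell K → ℕ => ∏ a, x a) (t := Icc 1 N)]
  · refine Finset.sum_congr rfl fun n hn => ?_
    rw [Finset.filter_filter]
    refine Finset.sum_congr (Finset.filter_congr fun x _ => ?_) fun _ _ => rfl
    have := (Finset.mem_Icc.1 hn).2
    constructor
    · intro h; exact ⟨h.trans_le this, h⟩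
    · exact fun h => h.2
  · intro x hx
    simp only [mem_filter, Fintype.mem_piFinset, mem_Icc] at hx ⊢
    exact ⟨Nat.succ_le_of_lt (Finset.prod_pos fun a _ => (hx.1 a).1), hx.2⟩

end

/-- Both values of the selection bit occur among the primes outside slot `0`, and all indices
occur. -/
def Mixed (K N n : ℕ) (l : n.primeFactors → Label) : Prop :=
  (∀ i, ∃ p : n.primeFactors, (l p).1 = i) ∧
    ∀ b, ∃ p : n.primeFactors, 1 ≤ (slot K N p : ℕ) ∧ (l p).2 = b

/-- The sum of the signs of mixed labellings. -/
def mixedSum (K N n : ℕ) : ℝ := ∑ l : n.primeFactors → Label with Mixed K N n l, labelSign n l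

/-- The condition on patterns corresponding to `Mixed`. -/
def MixedPattern {K : ℕ} (S : Finset (Cell K)) : Prop :=
  ((∀ i, ∃ a ∈ S, a.2.1.1 = i) ∧ ∀ b, ∃ a ∈ S, 1 ≤ (a.1 : ℕ) ∧ a.2.1.2 = b) ∧
    (∀ i, ∃ a ∈ S, a.2.2.1 = i) ∧ ∀ b, ∃ a ∈ S, 1 ≤ (a.1 : ℕ) ∧ a.2.2.2 = b

theorem linked36_comm (u v : Label × Label) : linked36 u v = linked36 v u := by
  have h : ∀ u v : Label, linked6 u v = linked6 v u := by decide
  rw [linked36, linked36, h, h u.2]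

theorem linked36_self (u : Label × Label) : linked36 u u = false := by
  simp [linked36, linked6]

section
variable {K N : ℕ} {S : Finset (Cell K)}

theorem card_slots_ge_nine_le (hS : MixedPattern S)
    (hun : ∀ a ∈ S, ∀ b ∈ S, 1 ≤ (a.1 : ℕ) → (a.1 : ℕ) + 3 ≤ b.1 → linked36 a.2 b.2 = false) :
    #{j : Fin (K + 1) | 9 ≤ #{u | (j, u) ∈ S}} ≤ 181 := by
  let J : Label × Label → Finset (Fin (K + 1)) := fun u => {j | 1 ≤ (j : ℕ) ∧ (j, u) ∈ S}
  let W : Finset (Label × Label) := {u | 6 ≤ #(J u)}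
  have hfar : ∀ w ∈ W, ∀ v ∈ S, 1 ≤ (v.1 : ℕ) → linked36 w v.2 = false := by
    intro w hw v hv hv1
    have : ∃ j ∈ J w, (j : ℕ) + 3 ≤ v.1 ∨ (v.1 : ℕ) + 3 ≤ j := by
      by_contra! h
      have h1 : #(J w) ≤ #(Finset.Icc ((v.1 : ℕ) - 2) (v.1 + 2)) :=
        Finset.card_le_card_of_injOn (fun j => (j : ℕ)) (fun j hj => by
          have := h j hj
          simp only [coe_Icc, Set.mem_Icc]
          omega) (fun _ _ _ _ h => Fin.ext h)
      have h2 : 6 ≤ #(J w) := by simpa [W] using hw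
      rw [Nat.card_Icc] at h1
      omega
    obtain ⟨j, hj, h⟩ := this
    simp only [J, mem_filter, mem_univ, true_and] at hj
    rcases h with h | h
    · exact hun _ hj.2 _ hv hj.1 h
    · rw [linked36_comm]; exact hun _ hv _ hj.2 hv1 h
  have hW1 : ∀ w ∈ W, ∃ j : Fin (K + 1), 1 ≤ (j : ℕ) ∧ (j, w) ∈ S := by
    intro w hw
    have h2 : 6 ≤ #(J w) := by simpa [W] using hw
    obtain ⟨j, hj⟩ := Finset.card_pos.1 (by omega : 0 < #(J w))
    exact ⟨j, by simpa [J] using hj⟩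
  have hWW : ∀ w ∈ W, ∀ w' ∈ W, linked36 w w' = false := by
    intro w hw w' hw'
    obtain ⟨j, hj1, hj⟩ := hW1 w' hw'
    exact hfar w hw _ hj hj1
  have hW8 : #W ≤ 8 := by
    by_contra h8
    have hne : W.Nonempty := Finset.card_pos.1 (by omega)
    obtain ⟨w, hw⟩ := hne
    obtain ⟨a, ha, ha1, hab⟩ := hS.1.2 (!w.1.2)
    have hins : ∀ u ∈ insert a.2 W, ∀ u' ∈ insert a.2 W, linked36 u u' = false := by
      intro u hu u' hu'
      rcases Finset.mem_insert.1 hu with rfl | hu <;> rcases Finset.mem_insert.1 hu' with rfl | hu'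
      · exact linked36_self _
      · rw [linked36_comm]; exact hfar _ hu' a ha ha1
      · exact hfar _ hu a ha ha1
      · exact hWW _ hu _ hu'
    rcases card_unlinked hins with h | ⟨b, b', h⟩
    · exact h8 ((Finset.card_le_card (Finset.subset_insert _ _)).trans h)
    · have h1 := (h a.2 (Finset.mem_insert_self _ _)).1
      have h2 := (h w (Finset.mem_insert_of_mem hw)).1
      rw [h1, h2] at hab
      cases b <;> simp at hab
  have hsub : (univ.filter fun j : Fin (K + 1) => 9 ≤ #{u | (j, u) ∈ S}) ⊆
      insert 0 ((univ \ W).biUnion J) := by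
    intro j hj
    simp only [mem_filter, mem_univ, true_and] at hj
    by_contra hc
    simp only [mem_insert, mem_biUnion, not_or, not_exists, not_and] at hc
    have hj1 : 1 ≤ (j : ℕ) := Nat.pos_of_ne_zero fun h => hc.1 (Fin.ext h)
    have : (univ.filter fun u => (j, u) ∈ S) ⊆ W := by
      intro u hu
      by_contra huW
      exact hc.2 u (Finset.mem_sdiff.2 ⟨mem_univ _, huW⟩) (by simpa [J, hj1] using hu)
    have := Finset.card_le_card this
    omega
  calc _ ≤ _ := Finset.card_le_card hsub
    _ ≤ #((univ \ W).biUnion J) + 1 := Finset.card_insert_le _ _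
    _ ≤ #(univ \ W) * 5 + 1 := by
        refine Nat.add_le_add_right (Finset.card_biUnion_le_card_mul _ _ _ fun u hu => ?_) 1
        have : ¬ 6 ≤ #(J u) := by simpa [W] using hu
        omega
    _ ≤ 36 * 5 + 1 := by
        have : #(univ \ W) ≤ #(univ : Finset (Label × Label)) := Finset.card_le_card sdiff_subset
        have h36 : #(univ : Finset (Label × Label)) = 36 := rfl
        omega
    _ = 181 := rfl

theorem abs_labelSign_le_one (n : ℕ) (l : n.primeFactors → Label) : |labelSign n l| ≤ 1 := by
  unfold labelSign
  simp only [Finset.abs_prod]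
  exact Finset.prod_le_one (fun _ _ => Finset.prod_nonneg fun _ _ => abs_nonneg _) fun c _ =>
    Finset.prod_le_one (fun _ _ => abs_nonneg _) fun d _ =>
      abs_le_one_of_cube (couple_cube _ _ _ _)

theorem abs_sum_pattern_le (n : ℕ) : |(1 / 9 : ℝ) ^ #n.primeFactors *
      ∑ l : n.primeFactors → Label × Label with pattern K N n l = S,
        (labelSign n (fun p => (l p).1) * labelSign n (fun p => (l p).2))| ≤
    ∏ p ∈ n.primeFactors, (#{u | (slot K N p, u) ∈ S} / 9 : ℝ) := by
  rw [abs_mul, abs_of_nonneg (by positivity)]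
  have h1 : |∑ l : n.primeFactors → Label × Label with pattern K N n l = S,
      (labelSign n (fun p => (l p).1) * labelSign n (fun p => (l p).2))| ≤
      ∏ p ∈ n.primeFactors, (#{u | (slot K N p, u) ∈ S} : ℝ) := by
    calc _ ≤ ∑ l : n.primeFactors → Label × Label with pattern K N n l = S, (1 : ℝ) := by
          refine (Finset.abs_sum_le_sum_abs _ _).trans (Finset.sum_le_sum fun l _ => ?_)
          rw [abs_mul]
          exact mul_le_one₀ (abs_labelSign_le_one _ _) (abs_nonneg _) (abs_labelSign_le_one _ _)
      _ = #{l : n.primeFactors → Label × Label | pattern K N n l = S} := by simp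
      _ ≤ #(Fintype.piFinset fun p : n.primeFactors =>
            (univ.filter fun u => (slot K N p, u) ∈ S)) := by
          refine Nat.cast_le.2 (Finset.card_le_card fun l hl => ?_)
          rw [Fintype.mem_piFinset]
          intro p
          have hl' : pattern K N n l = S := by simpa using hl
          simp only [mem_filter, mem_univ, true_and]
          rw [← hl']
          exact Finset.mem_image_of_mem _ (mem_univ p)
      _ = _ := by
          rw [Fintype.card_piFinset, Nat.cast_prod]
          exact Finset.prod_coe_sort n.primeFactors
            (fun p => ((#{u | (slot K N p, u) ∈ S} : ℕ) : ℝ))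
  rw [Finset.prod_div_distrib, Finset.prod_const, mul_comm, one_div_pow, div_eq_mul_one_div (∏ _ ∈ _, _)]
  exact mul_le_mul_of_nonneg_right h1 (by positivity)

theorem mixedSum_sq (K N n : ℕ) : mixedSum K N n ^ 2 =
    ∑ S : Finset (Cell K) with MixedPattern S,
      ∑ l : n.primeFactors → Label × Label with pattern K N n l = S,
        (labelSign n (fun p => (l p).1) * labelSign n (fun p => (l p).2)) := by
  have key : ∀ l : n.primeFactors → Label × Label, MixedPattern (pattern K N n l) ↔
      Mixed K N n (fun p => (l p).1) ∧ Mixed K N n (fun p => (l p).2) := by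
    intro l
    simp only [MixedPattern, Mixed, pattern, Finset.exists_mem_image, mem_univ, true_and]
  rw [sq, mixedSum, Finset.sum_mul_sum, ← Finset.sum_product']
  trans ∑ l : n.primeFactors → Label × Label with MixedPattern (pattern K N n l),
      (labelSign n (fun p => (l p).1) * labelSign n (fun p => (l p).2))
  · refine Finset.sum_nbij' (fun x p => (x.1 p, x.2 p))
      (fun l => (fun p => (l p).1, fun p => (l p).2)) ?_ ?_ ?_ ?_ ?_
    · intro x hx
      simpa [key] using hx
    · intro l hl
      simpa [key] using hl
    · intro x _; rfl
    · intro l _; rfl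
    · intro x _; rfl
  · rw [← Finset.sum_fiberwise_of_maps_to (t := univ.filter fun S => MixedPattern S)
      (g := pattern K N n) (fun l hl => by simpa using hl)]
    refine Finset.sum_congr rfl fun S hS => Finset.sum_congr ?_ fun _ _ => rfl
    ext l
    simp only [mem_filter, mem_univ, true_and] at hS ⊢
    exact ⟨fun h => h.2, fun h => ⟨h ▸ hS, h⟩⟩

theorem abs_sum_unlinked_le (hK : 0 < K) (hN : 0 < Real.log (Real.log N)) (hN3 : 3 ≤ N)
    (hS : MixedPattern S)
    (hun : ∀ a ∈ S, ∀ b ∈ S, 1 ≤ (a.1 : ℕ) → (a.1 : ℕ) + 3 ≤ b.1 → linked36 a.2 b.2 = false) :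
    |∑ n ∈ Finset.Icc 1 N with Squarefree n ∧ Odd n ∧ Good K N n, (1 / 9 : ℝ) ^ #n.primeFactors *
      ∑ l : n.primeFactors → Label × Label with pattern K N n l = S,
        (labelSign n (fun p => (l p).1) * labelSign n (fun p => (l p).2))| ≤
    9 * N * Real.exp (8 / 9 * (Real.log (Real.log N) + 4) +
      724 * (Real.log (Real.log N) / K + 7)) / Real.log N := by
  set y := Real.log (Real.log N)
  let g : ℕ → ℝ := fun p => #{u | (slot K N p, u) ∈ S} / 9
  have hg : ∀ p, 0 ≤ g p := fun p => by positivity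
  have hg4 : ∀ p, g p ≤ 4 := by
    intro p
    have : #{u | (slot K N p, u) ∈ S} ≤ 36 :=
      (Finset.card_le_univ _).trans_eq (by rfl)
    have : (#{u | (slot K N p, u) ∈ S} : ℝ) ≤ 36 := by exact_mod_cast this
    simp only [g]; linarith
  let E : Finset (Fin (K + 1)) := {j | 9 ≤ #{u | (j, u) ∈ S}}
  have hE : #E ≤ 181 := card_slots_ge_nine_le hS hun
  have hyK : 0 ≤ y / K + 7 := by positivity
  have hsum : ∑ p ∈ Nat.primesLE N, g p / p ≤ 8 / 9 * (y + 4) + 724 * (y / K + 7) := by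
    have h1 : ∀ p ∈ Nat.primesLE N, g p / p ≤
        8 / 9 * (1 / p) + 4 * ∑ j ∈ E, if slot K N p = j then (1 / p : ℝ) else 0 := by
      intro p _
      rw [Finset.sum_ite_eq]
      split_ifs with h
      · have := hg4 p
        have : g p / p ≤ 4 / p := by gcongr
        have : (0 : ℝ) ≤ 1 / p := by positivity
        have : (4 / p : ℝ) = 4 * (1 / p) := by ring
        linarith
      · have h8 : #{u | (slot K N p, u) ∈ S} ≤ 8 := by
          have : ¬ 9 ≤ #{u | (slot K N p, u) ∈ S} := by simpa [E] using h
          omega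
        have h8 : (#{u | (slot K N p, u) ∈ S} : ℝ) ≤ 8 := by exact_mod_cast h8
        have : g p / p ≤ (8 / 9) / p := by simp only [g]; gcongr
        have : (8 / 9 / p : ℝ) = 8 / 9 * (1 / p) := by ring
        linarith
    refine (Finset.sum_le_sum h1).trans ?_
    rw [Finset.sum_add_distrib, ← Finset.mul_sum, ← Finset.mul_sum, Finset.sum_comm]
    have h2 : ∑ j ∈ E, ∑ p ∈ Nat.primesLE N, (if slot K N p = j then (1 / p : ℝ) else 0) ≤
        #E • (y / K + 7) := by
      refine Finset.sum_le_card_nsmul _ _ _ fun j _ => ?_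
      rw [← Finset.sum_filter]
      exact sum_inv_slot_le hK hN j
    have h3 : #E • (y / K + 7) ≤ 181 * (y / K + 7) := by
      rw [nsmul_eq_mul]
      have : (#E : ℝ) ≤ 181 := by exact_mod_cast hE
      gcongr
    have h4 := sum_inv_prime_le_loglog hN3
    linarith
  have hlog : 0 < Real.log N := by linarith [one_le_log_of_three_le hN3]
  rw [le_div_iff₀ hlog]
  calc _ ≤ (∑ n ∈ Finset.Icc 1 N, sqfMul g n) * Real.log N := by
        refine mul_le_mul_of_nonneg_right ?_ hlog.le
        refine (Finset.abs_sum_le_sum_abs _ _).trans ?_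
        rw [Finset.sum_filter]
        refine Finset.sum_le_sum fun n _ => ?_
        split_ifs with h
        · refine (abs_sum_pattern_le n).trans_eq ?_
          rw [sqfMul, if_pos h.1]
        · exact sqfMul_nonneg hg n
    _ ≤ (2 * 4 + 1) * N * Real.exp (∑ p ∈ Nat.primesLE N, g p / p) := by
        rw [mul_comm]; exact log_mul_sum_sqfMul_le hg hg4 N
    _ ≤ _ := by
        have := Real.exp_le_exp.2 hsum
        calc _ ≤ (2 * 4 + 1) * N * Real.exp (8 / 9 * (y + 4) + 724 * (y / K + 7)) := by gcongr
          _ = _ := by ring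

theorem sum_good_mixedSum_sq_le (hK : 0 < K) (hN : 0 < Real.log (Real.log N)) (hN3 : 3 ≤ N)
    (h4 : 4 ≤ Real.exp (Real.log (Real.log N) / K)) :
    ∑ n ∈ Finset.Icc 1 N with Squarefree n ∧ Odd n ∧ Good K N n,
      (1 / 9 : ℝ) ^ #n.primeFactors * mixedSum K N n ^ 2 ≤
    2 ^ Fintype.card (Cell K) *
      (N * (2 * √((5 + Real.log N) / Real.exp (Real.exp (Real.log (Real.log N) / K)))) *
          (1 + Real.log N) ^ Fintype.card (Cell K) +
        9 * N * Real.exp (8 / 9 * (Real.log (Real.log N) + 4) +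
          724 * (Real.log (Real.log N) / K + 7)) / Real.log N) := by
  have hlog : 0 < Real.log N := by linarith [one_le_log_of_three_le hN3]
  simp only [mixedSum_sq, Finset.mul_sum]
  rw [Finset.sum_comm]
  simp only [← Finset.mul_sum]
  set B := (N * (2 * √((5 + Real.log N) / Real.exp (Real.exp (Real.log (Real.log N) / K)))) *
          (1 + Real.log N) ^ Fintype.card (Cell K) +
        9 * N * Real.exp (8 / 9 * (Real.log (Real.log N) + 4) +
          724 * (Real.log (Real.log N) / K + 7)) / Real.log N) with hB
  have hB0 : 0 ≤ B := by positivity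
  refine (Finset.sum_le_card_nsmul _ _ B fun S hS => ?_).trans ?_
  · have hS : MixedPattern S := by simpa using hS
    refine (le_abs_self _).trans ?_
    by_cases hun : ∀ a ∈ S, ∀ b ∈ S, 1 ≤ (a.1 : ℕ) → (a.1 : ℕ) + 3 ≤ b.1 →
        linked36 a.2 b.2 = false
    · refine (abs_sum_unlinked_le hK hN hN3 hS hun).trans (le_add_of_nonneg_left (by positivity))
    · push Not at hun
      obtain ⟨a, ha, b, hb, h1, h3, hl⟩ := hun
      have hl : linked36 a.2 b.2 = true := by simpa using hl
      rw [sum_good_pattern_eq]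
      exact (abs_sum_tupleWeight_le hK hN h4 hl h1 h3 ha hb).trans
        (le_add_of_nonneg_right (by positivity))
  · rw [nsmul_eq_mul]
    refine mul_le_mul_of_nonneg_right ?_ hB0
    have : #(univ.filter fun S : Finset (Cell K) => MixedPattern S) ≤
        2 ^ Fintype.card (Cell K) :=
      (Finset.card_le_univ _).trans_eq (Fintype.card_finset)
    exact_mod_cast this

end

theorem prod_couple_color {A : Type*} [Fintype A] [DecidableEq A] {n : ℕ} (hn : Squarefree n)
    (c : n.primeFactors → A) (u : A → Label) :
    labelSign n (fun p => u (c p)) =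
      ∏ a, ∏ b, couple (u a) (u b) (colorProd n c a) (colorProd n c b) := by
  have h1 : ∀ a b, couple (u a) (u b) (colorProd n c a) (colorProd n c b) =
      ∏ p with c p = a, ∏ q with c q = b, couple (u (c p)) (u (c q)) p q := by
    intro a b
    rw [couple_eq_prod _ _ (squarefree_colorProd hn c a) (squarefree_colorProd hn c b),
      prod_primeFactors_colorProd c a (fun p =>
        ∏ q ∈ (colorProd n c b).primeFactors, couple (u a) (u b) p q)]
    refine Finset.prod_congr rfl fun p hp => ?_
    rw [prod_primeFactors_colorProd c b (fun q => couple (u a) (u b) p q)]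
    refine Finset.prod_congr rfl fun q hq => ?_
    rw [(Finset.mem_filter.1 hp).2, (Finset.mem_filter.1 hq).2]
  simp only [h1]
  symm
  unfold labelSign
  rw [← Finset.prod_fiberwise univ c]
  refine Finset.prod_congr rfl fun a _ => ?_
  rw [Finset.prod_comm]
  refine Finset.prod_congr rfl fun p _ => ?_
  rw [← Finset.prod_fiberwise univ c]

theorem jacobiSym_mul_swap {a b : ℕ} (ha : Odd a) (hb : Odd b) (hab : a.Coprime b) :
    (jacobiSym a b : ℝ) * jacobiSym b a = if a % 4 = 3 ∧ b % 4 = 3 then -1 else 1 := by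
  have hs : (jacobiSym b a : ℝ) * jacobiSym b a = 1 := jacobiSym_mul_self hab.symm
  split_ifs with h
  · rw [jacobiSym.quadratic_reciprocity_three_mod_four h.1 h.2]
    push_cast
    linarith
  · have : a % 4 = 1 ∨ b % 4 = 1 := by
      have := Nat.odd_iff.1 ha
      have := Nat.odd_iff.1 hb
      omega
    rcases this with h1 | h1
    · rw [jacobiSym.quadratic_reciprocity_one_mod_four h1 hb, hs]
    · rw [← jacobiSym.quadratic_reciprocity_one_mod_four h1 ha, hs]

theorem odd_colorProd {A : Type*} [Fintype A] [DecidableEq A] {n : ℕ} (hn : Squarefree n)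
    (ho : Odd n) (c : n.primeFactors → A) (a : A) : Odd (colorProd n c a) := by
  refine Odd.of_dvd_nat ho ?_
  conv_rhs => rw [← prod_colorProd hn c]
  exact Finset.dvd_prod_of_mem _ (mem_univ a)

theorem labelSign_true {n : ℕ} (hn : Squarefree n) (h3 : n % 4 = 3)
    (σ : n.primeFactors → Fin 3) :
    labelSign n (fun p => (σ p, true)) =
      (1 + ∑ i, ((ZMod.χ₄ (colorProd n σ i) : ℤ) : ℝ)) / 2 := by
  have ho : Odd n := Nat.odd_iff.2 (by omega)
  rw [prod_couple_color hn σ (fun i => (i, true))]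
  have hprod := prod_colorProd hn σ
  have hx := odd_colorProd hn ho σ
  have hc : ∀ i j, i ≠ j → (colorProd n σ i).Coprime (colorProd n σ j) :=
    fun i j h => coprime_colorProd σ h
  generalize colorProd n σ = x at *
  have hχ : ∀ i, ((ZMod.χ₄ (x i) : ℤ) : ℝ) = if x i % 4 = 3 then -1 else 1 := by
    intro i
    rw [ZMod.χ₄_nat_eq_if_mod_four]
    have := Nat.odd_iff.1 (hx i)
    rw [if_neg (by omega)]
    split_ifs <;> first | omega | simp
  have e01 := jacobiSym_mul_swap (hx 0) (hx 1) (hc 0 1 (by decide))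
  have e02 := jacobiSym_mul_swap (hx 0) (hx 2) (hc 0 2 (by decide))
  have e12 := jacobiSym_mul_swap (hx 1) (hx 2) (hc 1 2 (by decide))
  have hl : ∏ a : Fin 3, ∏ b : Fin 3, couple (a, true) (b, true) (x a) (x b) =
      ((jacobiSym (x 0) (x 1) : ℝ) * jacobiSym (x 1) (x 0)) *
      ((jacobiSym (x 0) (x 2) : ℝ) * jacobiSym (x 2) (x 0)) *
      ((jacobiSym (x 1) (x 2) : ℝ) * jacobiSym (x 2) (x 1)) := by
    simp only [Fin.prod_univ_three, couple]
    simp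
    ring
  rw [hl, e01, e02, e12]
  simp only [hχ, Fin.sum_univ_three]
  rw [Fin.prod_univ_three] at hprod
  have hmod : (x 0 % 4) * (x 1 % 4) * (x 2 % 4) % 4 = 3 := by
    have := congrArg (· % 4) hprod
    simpa [Nat.mul_mod, h3] using this
  have h0 : x 0 % 4 = 1 ∨ x 0 % 4 = 3 := by have := Nat.odd_iff.1 (hx 0); omega
  have h1 : x 1 % 4 = 1 ∨ x 1 % 4 = 3 := by have := Nat.odd_iff.1 (hx 1); omega
  have h2 : x 2 % 4 = 1 ∨ x 2 % 4 = 3 := by have := Nat.odd_iff.1 (hx 2); omega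
  rcases h0 with h0 | h0 <;> rcases h1 with h1 | h1 <;> rcases h2 with h2 | h2 <;>
    simp only [h0, h1, h2] at hmod ⊢ <;> first | omega | norm_num

theorem couple_mul_self (u v : Label) {p q : ℕ} (h : u.1 ≠ v.1 → p.Coprime q) :
    couple u v p q * couple u v p q = 1 := by
  unfold couple
  split_ifs with hh
  · exact jacobiSym_mul_self (h hh.2)
  · simp

theorem coprime_of_label_ne {n : ℕ} {A : Type*} (l : n.primeFactors → A) (p q : n.primeFactors)
    (h : l p ≠ l q) : (p : ℕ).Coprime q :=
  (Nat.coprime_primes (Nat.prime_of_mem_primeFactors p.2) (Nat.prime_of_mem_primeFactors q.2)).2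
    fun hh => h (by rw [Subtype.ext hh])

/-- Complementing the selection bits changes the sign in a controlled way. -/
theorem labelSign_not {n : ℕ} (l : n.primeFactors → Label) :
    labelSign n (fun p => ((l p).1, !(l p).2)) =
      labelSign n (fun p => ((l p).1, true)) * labelSign n l := by
  have hsq : labelSign n l * labelSign n l = 1 := by
    unfold labelSign
    simp only [← Finset.prod_mul_distrib]
    exact Finset.prod_eq_one fun p _ => Finset.prod_eq_one fun q _ =>
      couple_mul_self _ _ fun h => coprime_of_label_ne (fun p => (l p).1) p q h
  have hm : labelSign n (fun p => ((l p).1, !(l p).2)) * labelSign n l =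
      labelSign n (fun p => ((l p).1, true)) := by
    unfold labelSign
    simp only [← Finset.prod_mul_distrib]
    refine Finset.prod_congr rfl fun p _ => Finset.prod_congr rfl fun q _ => ?_
    unfold couple
    cases (l p).2 <;> simp
  rw [← hm, mul_assoc, hsq, mul_one]

/-- The selection bits of a labelling are constant outside slot `0`. -/
def OffConst (K N n : ℕ) (b : Bool) (l : n.primeFactors → Label) : Prop :=
  ∀ p : n.primeFactors, slot K N p ≠ 0 → (l p).2 = b

/-- The primes dividing `n` in slot `0`. -/
abbrev SmallPrime (K N n : ℕ) := {p : n.primeFactors // slot K N p = 0}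

/-- The primes dividing `n` outside slot `0`. -/
abbrev LargePrime (K N n : ℕ) := {p : n.primeFactors // ¬ slot K N p = 0}

/-- The weight attached to an optional colour. -/
def chiWeight (k : Option (Fin 3)) (i : Fin 3) (q : ℕ) : ℝ :=
  if k = some i then ((ZMod.χ₄ q : ℤ) : ℝ) else 1

section
variable {K N n : ℕ}

theorem sum_offConst_eq (hn : Squarefree n) (h3 : n % 4 = 3) :
    ∑ l : n.primeFactors → Label with OffConst K N n false l, labelSign n l +
      ∑ l : n.primeFactors → Label with OffConst K N n true l, labelSign n l =
    ∑ l : n.primeFactors → Label with OffConst K N n false l,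
      (3 + ∑ i, ((ZMod.χ₄ (colorProd n (fun p => (l p).1) i) : ℤ) : ℝ)) / 2 * labelSign n l := by
  have h : ∑ l : n.primeFactors → Label with OffConst K N n true l, labelSign n l =
      ∑ l : n.primeFactors → Label with OffConst K N n false l,
        labelSign n (fun p => ((l p).1, !(l p).2)) := by
    refine Finset.sum_nbij' (fun l p => ((l p).1, !(l p).2)) (fun l p => ((l p).1, !(l p).2))
      ?_ ?_ ?_ ?_ ?_
    · intro l hl
      simpa [OffConst] using hl
    · intro l hl
      simpa [OffConst] using hl
    · intro l _; simp
    · intro l _; simp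
    · intro l _; simp
  rw [h, ← Finset.sum_add_distrib]
  refine Finset.sum_congr rfl fun l _ => ?_
  rw [labelSign_not, labelSign_true hn h3]
  ring

theorem prod_chiWeight (σ : n.primeFactors → Fin 3) (i : Fin 3) :
    ((ZMod.χ₄ (colorProd n σ i) : ℤ) : ℝ) = ∏ q, chiWeight (some i) (σ q) q := by
  unfold colorProd chiWeight
  push_cast
  rw [map_prod, Finset.prod_filter]
  push_cast
  refine Finset.prod_congr rfl fun q _ => ?_
  by_cases h : σ q = i
  · simp [h]
  · simp [h, Ne.symm h]

theorem sum_chiWeight_labelSign (k : Option (Fin 3)) :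
    ∑ l : n.primeFactors → Label with OffConst K N n false l,
      (∏ q, chiWeight k (l q).1 q) * labelSign n l =
    ∑ m : SmallPrime K N n → Label,
      ((∏ q, chiWeight k (m q).1 q.1) * ∏ p, ∏ q, couple (m p) (m q) p.1 q.1) *
      ∏ q : LargePrime K N n, ∑ i, chiWeight k i q.1 *
        ∏ p : SmallPrime K N n, couple (m p) (i, false) p.1 q.1 := by
  have h1 : ∀ m : SmallPrime K N n → Label,
      ∏ q : LargePrime K N n, ∑ i, chiWeight k i q.1 *
        ∏ p : SmallPrime K N n, couple (m p) (i, false) p.1 q.1 =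
      ∑ s : LargePrime K N n → Fin 3, ∏ q : LargePrime K N n, (chiWeight k (s q) q.1 *
        ∏ p : SmallPrime K N n, couple (m p) (s q, false) p.1 q.1) := by
    intro m
    rw [Finset.prod_univ_sum, Fintype.piFinset_univ]
  simp only [h1, Finset.mul_sum]
  rw [← Finset.sum_product']
  refine Finset.sum_nbij' (fun l => (fun p => l p.1, fun q => (l q.1).1))
    (fun x p => if h : slot K N p = 0 then x.1 ⟨p, h⟩ else (x.2 ⟨p, h⟩, false)) ?_ ?_ ?_ ?_ ?_
  · intro l _; simp
  · intro x _
    simp only [mem_filter, mem_univ, true_and]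
    intro p hp
    simp [hp]
  · intro l hl
    have hl : OffConst K N n false l := by simpa using hl
    funext p
    by_cases hp : slot K N p = 0
    · simp [hp]
    · simp only [hp, dite_false]
      rw [← hl p hp]
  · intro x _
    ext p
    · simp [p.2]
    · simp [p.2]
    · simp [p.2]
  · intro l hl
    have hl : OffConst K N n false l := by simpa using hl
    rw [labelSign, ← Fintype.prod_subtype_mul_prod_subtype (fun p : n.primeFactors => slot K N p = 0)
      (fun p => chiWeight k (l p).1 p),
      ← Fintype.prod_subtype_mul_prod_subtype (fun p : n.primeFactors => slot K N p = 0)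
      (fun p => ∏ q, couple (l p) (l q) p q)]
    have h2 : ∏ p : LargePrime K N n, ∏ q, couple (l p.1) (l q) p.1 q = 1 :=
      Finset.prod_eq_one fun p _ => Finset.prod_eq_one fun q _ => by
        simp [couple, hl p.1 p.2]
    have h4 : ∀ p : SmallPrime K N n, ∏ q, couple (l p.1) (l q) p.1 q =
        (∏ q : SmallPrime K N n, couple (l p.1) (l q.1) p.1 q.1) *
        ∏ q : LargePrime K N n, couple (l p.1) ((l q.1).1, false) p.1 q.1 := fun p =>
      (Fintype.prod_subtype_mul_prod_subtype (fun p : n.primeFactors => slot K N p = 0)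
        (fun q => couple (l p.1) (l q) p.1 q)).symm
    rw [h2, mul_one]
    simp only [h4]
    rw [Finset.prod_mul_distrib, Finset.prod_mul_distrib,
      Finset.prod_comm (s := (univ : Finset (SmallPrime K N n)))
        (t := (univ : Finset (LargePrime K N n)))]
    ring

theorem abs_sum_signs_le {f : Fin 3 → ℝ} (hf : ∀ i, f i = 1 ∨ f i = -1) {i j : Fin 3}
    (hij : i ≠ j) : |∑ i, f i| ≤ 2 + f i * f j := by
  rw [Fin.sum_univ_three]
  rcases hf 0 with h0 | h0 <;> rcases hf 1 with h1 | h1 <;> rcases hf 2 with h2 | h2 <;>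
    fin_cases i <;> fin_cases j <;> simp_all <;> norm_num [abs_le]

/-- A quadratic character, possibly twisted by the character modulo `4`. -/
def twist (D : ℕ) (s : Bool) (q : ℕ) : ℝ :=
  (jacobiSym q D : ℝ) * if s then ((ZMod.χ₄ q : ℤ) : ℝ) else 1

theorem jacobiSym_mul_chi4_eq_twist {D q : ℕ} (hD : Odd D) (hq : Odd q) (s : Bool) :
    (if s then ((ZMod.χ₄ q : ℤ) : ℝ) else 1) * (jacobiSym D q : ℝ) =
      twist D (s ^^ decide (D % 4 = 3)) q := by
  unfold twist
  have hχ : ((ZMod.χ₄ q : ℤ) : ℝ) = if q % 4 = 3 then -1 else 1 := by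
    rw [ZMod.χ₄_nat_eq_if_mod_four]
    have := Nat.odd_iff.1 hq
    rw [if_neg (by omega)]
    split_ifs <;> first | omega | simp
  have hr : (jacobiSym D q : ℝ) = jacobiSym q D * if D % 4 = 3 ∧ q % 4 = 3 then -1 else 1 := by
    split_ifs with h
    · rw [jacobiSym.quadratic_reciprocity_three_mod_four h.1 h.2]; push_cast; ring
    · rw [mul_one]
      have : D % 4 = 1 ∨ q % 4 = 1 := by
        have := Nat.odd_iff.1 hD
        have := Nat.odd_iff.1 hq
        omega
      rcases this with h1 | h1
      · rw [jacobiSym.quadratic_reciprocity_one_mod_four h1 hq]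
      · rw [jacobiSym.quadratic_reciprocity_one_mod_four h1 hD]
  rw [hr, hχ]
  by_cases h1 : D % 4 = 3 <;> by_cases h2 : q % 4 = 3 <;> cases s <;> simp [h1, h2]

end

/-- The nontrivial twists with modulus dividing `M`. -/
def twistIndex (M : ℕ) : Finset (ℕ × Bool) :=
  (M.divisors ×ˢ univ).filter fun x => 1 < x.1 ∨ x.2 = true

theorem jacobiSym_finset_prod_left {ι : Type*} (s : Finset ι) (f : ι → ℕ) (n : ℕ) :
    jacobiSym (∏ p ∈ s, f p : ℕ) n = ∏ p ∈ s, jacobiSym (f p) n := by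
  induction s using Finset.induction_on with
  | empty => simp [jacobiSym.one_left]
  | insert a s ha ih => rw [Finset.prod_insert ha, Finset.prod_insert ha, ← ih]; push_cast
                        rw [jacobiSym.mul_left]

theorem abs_chiWeight_le_one (k : Option (Fin 3)) (i : Fin 3) (q : ℕ) : |chiWeight k i q| ≤ 1 := by
  unfold chiWeight
  split_ifs
  · exact abs_chi4_le_one _
  · simp

theorem chi4_mul_self {q : ℕ} (hq : Odd q) :
    ((ZMod.χ₄ q : ℤ) : ℝ) * ((ZMod.χ₄ q : ℤ) : ℝ) = 1 := by
  rw [ZMod.χ₄_nat_eq_if_mod_four]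
  have := Nat.odd_iff.1 hq
  rw [if_neg (by omega)]
  split_ifs <;> simp

theorem abs_twist_le_one (D : ℕ) (s : Bool) (q : ℕ) : |twist D s q| ≤ 1 := by
  unfold twist
  rw [abs_mul]
  refine mul_le_one₀ (abs_jacobiSym_le_one _ _) (abs_nonneg _) ?_
  split_ifs
  · exact abs_chi4_le_one _
  · simp

section
variable {K N n : ℕ}

theorem slotProd_dvd_self (j : Fin (K + 1)) : slotProd K N n j ∣ n :=
  (Finset.prod_dvd_prod_of_subset _ _ _ (Finset.filter_subset _ _)).trans
    (Nat.prod_primeFactors_dvd n)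

theorem prod_smallPrime_dvd (s : Finset (SmallPrime K N n)) :
    ∏ p ∈ s, (p.1 : ℕ) ∣ slotProd K N n 0 := by
  refine Finset.prod_dvd_of_isRelPrime ?_ ?_
  · intro p _ q _ hpq
    refine Nat.coprime_iff_isRelPrime.1 ?_
    exact (Nat.coprime_primes (Nat.prime_of_mem_primeFactors p.1.2)
      (Nat.prime_of_mem_primeFactors q.1.2)).2 fun h => hpq (Subtype.ext (Subtype.ext h))
  · intro p _
    exact Finset.dvd_prod_of_mem (fun p => p) (Finset.mem_filter.2 ⟨p.1.2, p.2⟩)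

theorem exists_twist_bound (ho : Odd n) (k : Option (Fin 3)) (m : SmallPrime K N n → Label)
    (h : k ≠ none ∨ ∃ p, (m p).2 = true) :
    ∃ x ∈ twistIndex (slotProd K N n 0), ∀ q : LargePrime K N n,
      |∑ i, chiWeight k i q.1 * ∏ p : SmallPrime K N n, couple (m p) (i, false) p.1 q.1| ≤
        2 + twist x.1 x.2 q.1 := by
  have hM0 : slotProd K N n 0 ≠ 0 := (slotProd_pos n 0).ne'
  let D : Fin 3 → Fin 3 → ℕ := fun i j => ∏ p : SmallPrime K N n with
    (m p).2 = true ∧ ((m p).1 = i ∨ (m p).1 = j), (p.1 : ℕ)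
  have hD : ∀ i j, D i j ∣ slotProd K N n 0 := fun i j => prod_smallPrime_dvd _
  have hDo : ∀ i j, Odd (D i j) := fun i j => Odd.of_dvd_nat ho ((hD i j).trans (slotProd_dvd_self 0))
  have main : ∀ i j, i ≠ j → ∀ q : LargePrime K N n,
      |∑ i, chiWeight k i q.1 * ∏ p : SmallPrime K N n, couple (m p) (i, false) p.1 q.1| ≤
        2 + twist (D i j) (decide (k = some i ∨ k = some j) ^^ decide (D i j % 4 = 3)) q.1 := by
    intro i j hij q
    have hq : Odd (q.1 : ℕ) := Odd.of_dvd_nat ho (Nat.dvd_of_mem_primeFactors q.1.2)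
    have hcop : ∀ p : SmallPrime K N n, (p.1 : ℕ).Coprime q.1 := fun p =>
      coprime_of_label_ne (fun p : n.primeFactors => slot K N p) p.1 q.1
        (fun hh => q.2 (hh.symm.trans p.2))
    refine (abs_sum_signs_le (fun i => ?_) hij).trans_eq ?_
    · rw [← mul_self_eq_one_iff, mul_mul_mul_comm, ← Finset.prod_mul_distrib,
        Finset.prod_eq_one (fun p _ => couple_mul_self _ _ fun _ => hcop p), mul_one]
      unfold chiWeight
      split_ifs
      · exact chi4_mul_self hq
      · simp
    · rw [← jacobiSym_mul_chi4_eq_twist (hDo i j) hq, mul_mul_mul_comm,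
        ← Finset.prod_mul_distrib]
      congr 2
      · unfold chiWeight
        rcases eq_or_ne k (some i) with rfl | h1
        · simp [hij]
        · by_cases h2 : k = some j <;> simp [h1, h2, hij.symm]
      · simp only [D]
        rw [jacobiSym_finset_prod_left, Int.cast_prod, Finset.prod_filter]
        refine Finset.prod_congr rfl fun p _ => ?_
        have hs := jacobiSym_mul_self (hcop p)
        unfold couple
        by_cases hb : (m p).2 = true
        · by_cases h1 : (m p).1 = i
          · have h2 : (m p).1 ≠ j := h1 ▸ hij
            simp [hb, h1, hij]
          · by_cases h2 : (m p).1 = j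
            · simp [hb, h2, hij.symm]
            · simp [hb, h1, h2, hs]
        · simp [hb]
  have fin : ∀ i j, i ≠ j → (1 < D i j ∨ (D i j = 1 ∧ (k = some i ∨ k = some j))) →
      ∃ x ∈ twistIndex (slotProd K N n 0), ∀ q : LargePrime K N n,
      |∑ i, chiWeight k i q.1 * ∏ p : SmallPrime K N n, couple (m p) (i, false) p.1 q.1| ≤
        2 + twist x.1 x.2 q.1 := by
    intro i j hij hh
    have hm := main i j hij
    have hd := hD i j
    clear_value D
    refine ⟨(D i j, decide (k = some i ∨ k = some j) ^^ decide (D i j % 4 = 3)), ?_, hm⟩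
    simp only [twistIndex, mem_filter, mem_product, Nat.mem_divisors, mem_univ, and_true]
    refine ⟨⟨hd, hM0⟩, ?_⟩
    rcases hh with hh | ⟨h1, hh⟩
    · exact Or.inl hh
    · right
      simp [h1, hh]
  have hne : ∀ i : Fin 3, i ≠ i + 1 := by decide
  by_cases hb : ∃ p, (m p).2 = true
  · obtain ⟨p, hp⟩ := hb
    refine fin (m p).1 ((m p).1 + 1) (hne _) (Or.inl ?_)
    have hd : (p.1 : ℕ) ∣ D (m p).1 ((m p).1 + 1) :=
      Finset.dvd_prod_of_mem (fun p : SmallPrime K N n => (p.1 : ℕ))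
        (Finset.mem_filter.2 ⟨mem_univ _, hp, Or.inl rfl⟩)
    exact (Nat.prime_of_mem_primeFactors p.1.2).one_lt.trans_le
      (Nat.le_of_dvd (hDo _ _).pos hd)
  · obtain ⟨i, hi⟩ := Option.ne_none_iff_exists'.1 (h.resolve_right hb)
    refine fin i (i + 1) (hne i) ?_
    by_cases h1 : D i (i + 1) = 1
    · exact Or.inr ⟨h1, Or.inl hi⟩
    · exact Or.inl (lt_of_le_of_ne (hDo _ _).pos (Ne.symm h1))

theorem abs_sum_offConst_sub_le (hn : Squarefree n) (h3 : n % 4 = 3) :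
    |∑ l : n.primeFactors → Label with OffConst K N n false l, labelSign n l +
      ∑ l : n.primeFactors → Label with OffConst K N n true l, labelSign n l -
      3 / 2 * 3 ^ #n.primeFactors| ≤
    3 * 6 ^ Fintype.card (SmallPrime K N n) * ∑ x ∈ twistIndex (slotProd K N n 0),
      ∏ q : LargePrime K N n, (2 + twist x.1 x.2 q.1) := by
  have ho : Odd n := Nat.odd_iff.2 (by omega)
  set E := ∑ x ∈ twistIndex (slotProd K N n 0),
      ∏ q : LargePrime K N n, (2 + twist x.1 x.2 q.1) with hE
  let B : Option (Fin 3) → (SmallPrime K N n → Label) → ℝ := fun k m =>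
      ((∏ q, chiWeight k (m q).1 q.1) * ∏ p, ∏ q, couple (m p) (m q) p.1 q.1) *
      ∏ q : LargePrime K N n, ∑ i, chiWeight k i q.1 *
        ∏ p : SmallPrime K N n, couple (m p) (i, false) p.1 q.1
  have hpos : ∀ x ∈ twistIndex (slotProd K N n 0),
      0 ≤ ∏ q : LargePrime K N n, (2 + twist x.1 x.2 q.1) := fun x _ =>
    Finset.prod_nonneg fun q _ => by linarith [(abs_le.1 (abs_twist_le_one x.1 x.2 q.1)).1]
  have hB : ∀ k m, (k ≠ none ∨ ∃ p, (m p).2 = true) → |B k m| ≤ E := by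
    intro k m h
    obtain ⟨x, hx, hb⟩ := exists_twist_bound ho k m h
    simp only [B, abs_mul, Finset.abs_prod]
    calc _ ≤ 1 * ∏ q : LargePrime K N n, (2 + twist x.1 x.2 q.1) := by
          refine mul_le_mul ?_ ?_ (Finset.prod_nonneg fun _ _ => abs_nonneg _) zero_le_one
          · refine mul_le_one₀ (Finset.prod_le_one (fun _ _ => abs_nonneg _)
              fun _ _ => abs_chiWeight_le_one _ _ _)
              (Finset.prod_nonneg fun _ _ => Finset.prod_nonneg fun _ _ => abs_nonneg _) ?_
            exact Finset.prod_le_one (fun _ _ => Finset.prod_nonneg fun _ _ => abs_nonneg _)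
              fun c _ => Finset.prod_le_one (fun _ _ => abs_nonneg _) fun d _ =>
              abs_le_one_of_cube (couple_cube _ _ _ _)
          · exact Finset.prod_le_prod (fun _ _ => abs_nonneg _) fun q _ => by
              simpa only [abs_mul, Finset.abs_prod] using hb q
      _ ≤ E := by
          rw [one_mul]
          exact Finset.single_le_sum hpos hx
  have hcard : ∀ s : Finset (SmallPrime K N n → Label),
      (#s : ℝ) ≤ 6 ^ Fintype.card (SmallPrime K N n) := by
    intro s
    have : #s ≤ 6 ^ Fintype.card (SmallPrime K N n) := by
      refine (Finset.card_le_univ s).trans_eq ?_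
      simp [Fintype.card_pi, Label]
    exact_mod_cast this
  have hE0 : 0 ≤ E := Finset.sum_nonneg hpos
  have hsome : ∀ i, |∑ m, B (some i) m| ≤ 6 ^ Fintype.card (SmallPrime K N n) * E := by
    intro i
    refine (Finset.abs_sum_le_sum_abs _ _).trans
      ((Finset.sum_le_card_nsmul _ _ E fun m _ => hB _ _ (Or.inl (by simp))).trans ?_)
    rw [nsmul_eq_mul]
    exact mul_le_mul_of_nonneg_right (hcard _) hE0
  have hnone : |∑ m, B none m - 3 ^ #n.primeFactors| ≤
      6 ^ Fintype.card (SmallPrime K N n) * E := by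
    rw [← Finset.sum_filter_add_sum_filter_not univ (fun m => ∀ p, (m p).2 = false)]
    have h1 : ∑ m : SmallPrime K N n → Label with ∀ p, (m p).2 = false, B none m =
        3 ^ #n.primeFactors := by
      have e : ∀ m ∈ univ.filter (fun m : SmallPrime K N n → Label => ∀ p, (m p).2 = false),
          B none m = 3 ^ Fintype.card (LargePrime K N n) := by
        intro m hm
        have hm : ∀ p, (m p).2 = false := by simpa using hm
        simp [B, chiWeight, couple, hm]
      rw [Finset.sum_congr rfl e, Finset.sum_const, nsmul_eq_mul]
      have hc : #(univ.filter (fun m : SmallPrime K N n → Label => ∀ p, (m p).2 = false)) =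
          3 ^ Fintype.card (SmallPrime K N n) := by
        have : univ.filter (fun m : SmallPrime K N n → Label => ∀ p, (m p).2 = false) =
            Fintype.piFinset fun _ => univ.filter fun u : Label => u.2 = false := by
          ext m; simp
        rw [this, Fintype.card_piFinset, Finset.prod_const]
        rfl
      rw [hc, Nat.cast_pow, Nat.cast_ofNat, ← pow_add]
      congr 1
      have h1 : Fintype.card (LargePrime K N n) =
          Fintype.card n.primeFactors - Fintype.card (SmallPrime K N n) :=
        Fintype.card_subtype_compl (fun p : n.primeFactors => slot K N p = 0)
      have h2 : Fintype.card (SmallPrime K N n) ≤ Fintype.card n.primeFactors :=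
        Fintype.card_subtype_le (fun p : n.primeFactors => slot K N p = 0)
      rw [Fintype.card_coe] at h1 h2
      omega
    rw [h1, add_sub_cancel_left]
    refine (Finset.abs_sum_le_sum_abs _ _).trans
      ((Finset.sum_le_card_nsmul _ _ E fun m hm => hB _ _ (Or.inr ?_)).trans ?_)
    · have hm := (Finset.mem_filter.1 hm).2
      push Not at hm
      obtain ⟨p, hp⟩ := hm
      exact ⟨p, by simpa using hp⟩
    · rw [nsmul_eq_mul]
      exact mul_le_mul_of_nonneg_right (hcard _) hE0
  have hS : ∀ k, ∑ l : n.primeFactors → Label with OffConst K N n false l,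
      (∏ q, chiWeight k (l q).1 q) * labelSign n l = ∑ m, B k m := fun k =>
    sum_chiWeight_labelSign k
  have e : ∑ l : n.primeFactors → Label with OffConst K N n false l,
      (3 + ∑ i, ((ZMod.χ₄ (colorProd n (fun p => (l p).1) i) : ℤ) : ℝ)) / 2 * labelSign n l =
      (3 * ∑ m, B none m + ∑ i, ∑ m, B (some i) m) / 2 := by
    simp only [← hS]
    rw [Finset.sum_comm (s := (univ : Finset (Fin 3))), Finset.mul_sum, ← Finset.sum_add_distrib,
      Finset.sum_div]
    refine Finset.sum_congr rfl fun l _ => ?_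
    have h1 : ∏ q : n.primeFactors, chiWeight none (l q).1 q = 1 :=
      Finset.prod_eq_one fun q _ => by simp [chiWeight]
    rw [h1, ← Finset.sum_mul]
    simp only [prod_chiWeight]
    ring
  rw [sum_offConst_eq hn h3, e, Fin.sum_univ_three]
  have a0 := abs_le.1 (hsome 0)
  have a1 := abs_le.1 (hsome 1)
  have a2 := abs_le.1 (hsome 2)
  have a3 := abs_le.1 hnone
  rw [abs_le]
  constructor <;> linarith [a0.1, a0.2, a1.1, a1.2, a2.1, a2.2, a3.1, a3.2]

end

/-- The sum of the signs of the labellings in which all indices occur. -/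
def surjSum (n : ℕ) : ℝ :=
  ∑ l : n.primeFactors → Label with ∀ i, ∃ p : n.primeFactors, (l p).1 = i, labelSign n l

/-- The local factors bounding the number of non-surjective labellings. -/
def nonsurjFactor (K N p : ℕ) : ℝ := if slot K N p = 0 then 4 / 3 else 2 / 3

/-- The local factors bounding the contribution of a twist. -/
def twistFactor (K N : ℕ) (x : ℕ × Bool) (p : ℕ) : ℝ :=
  if slot K N p = 0 then 2 else (2 + twist x.1 x.2 p) / 3

theorem ite_eq_add_ite {P Q R : Prop} {d₁ : Decidable P} {d₂ : Decidable Q} {d₃ : Decidable R}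
    {d₄ : Decidable (P ∧ ¬ Q ∧ ¬ R)} {d₅ : Decidable (¬ P ∧ Q)} {d₆ : Decidable (¬ P ∧ R)}
    (h : ¬ (Q ∧ R)) (x : ℝ) :
    (if P then x else 0) = (if P ∧ ¬ Q ∧ ¬ R then x else 0) +
      ((if Q then x else 0) - if ¬ P ∧ Q then x else 0) +
      ((if R then x else 0) - if ¬ P ∧ R then x else 0) := by
  by_cases h1 : P <;> by_cases h2 : Q <;> by_cases h3 : R <;> simp_all

section
variable {K N n : ℕ}

theorem abs_sum_nonsurj_le (b : Bool) :
    |∑ l : n.primeFactors → Label with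
      (¬ ∀ i, ∃ p : n.primeFactors, (l p).1 = i) ∧ OffConst K N n b l, labelSign n l| ≤
    3 * ∏ p ∈ n.primeFactors, (if slot K N p = 0 then 4 else 2 : ℝ) := by
  have h1 : ∀ i : Fin 3, (#(Fintype.piFinset fun p : n.primeFactors =>
      univ.filter fun u : Label => u.1 ≠ i ∧ (slot K N p ≠ 0 → u.2 = b)) : ℝ) =
      ∏ p ∈ n.primeFactors, (if slot K N p = 0 then 4 else 2 : ℝ) := by
    intro i
    rw [Fintype.card_piFinset, Nat.cast_prod, ← Finset.prod_coe_sort n.primeFactors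
      (fun p => (if slot K N p = 0 then 4 else 2 : ℝ))]
    refine Finset.prod_congr rfl fun p _ => ?_
    have e1 : ∀ i : Fin 3, #(univ.filter fun u : Label => u.1 ≠ i) = 4 := by decide
    have e2 : ∀ (i : Fin 3) (b : Bool),
      #(univ.filter fun u : Label => u.1 ≠ i ∧ u.2 = b) = 2 := by decide
    split_ifs with h
    · simp only [h, ne_eq, not_true_eq_false, false_imp_iff, and_true]
      have := e1 i
      simp only [ne_eq] at this
      convert (congrArg (Nat.cast : ℕ → ℝ) this) using 3
      norm_num
    · simp only [ne_eq, h, not_false_eq_true, true_imp_iff]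
      have := e2 i b
      simp only [ne_eq] at this
      convert (congrArg (Nat.cast : ℕ → ℝ) this) using 3
      norm_num
  calc _ ≤ ∑ l : n.primeFactors → Label with
      (¬ ∀ i, ∃ p : n.primeFactors, (l p).1 = i) ∧ OffConst K N n b l, (1 : ℝ) :=
        (Finset.abs_sum_le_sum_abs _ _).trans (Finset.sum_le_sum fun l _ =>
          abs_labelSign_le_one n l)
    _ = #(univ.filter fun l : n.primeFactors → Label =>
      (¬ ∀ i, ∃ p : n.primeFactors, (l p).1 = i) ∧ OffConst K N n b l) := by simp
    _ ≤ #((univ : Finset (Fin 3)).biUnion fun i => Fintype.piFinset fun p : n.primeFactors =>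
      univ.filter fun u : Label => u.1 ≠ i ∧ (slot K N p ≠ 0 → u.2 = b)) := by
        refine Nat.cast_le.2 (Finset.card_le_card fun l hl => ?_)
        obtain ⟨h1, h2⟩ := (Finset.mem_filter.1 hl).2
        push Not at h1
        obtain ⟨i, hi⟩ := h1
        refine Finset.mem_biUnion.2 ⟨i, mem_univ _, Fintype.mem_piFinset.2 fun p => ?_⟩
        exact Finset.mem_filter.2 ⟨mem_univ _, hi p, h2 p⟩
    _ ≤ ∑ i : Fin 3, #(Fintype.piFinset fun p : n.primeFactors =>
      univ.filter fun u : Label => u.1 ≠ i ∧ (slot K N p ≠ 0 → u.2 = b)) :=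
        Nat.cast_le.2 Finset.card_biUnion_le
    _ = _ := by
        rw [Nat.cast_sum, Finset.sum_congr rfl (fun i _ => h1 i)]
        simp

theorem surjSum_eq (hex : ∃ p : n.primeFactors, slot K N p ≠ 0) :
    surjSum n = mixedSum K N n +
      (∑ l : n.primeFactors → Label with OffConst K N n false l, labelSign n l -
        ∑ l : n.primeFactors → Label with
          (¬ ∀ i, ∃ p : n.primeFactors, (l p).1 = i) ∧ OffConst K N n false l, labelSign n l) +
      (∑ l : n.primeFactors → Label with OffConst K N n true l, labelSign n l -
        ∑ l : n.primeFactors → Label with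
          (¬ ∀ i, ∃ p : n.primeFactors, (l p).1 = i) ∧ OffConst K N n true l, labelSign n l) := by
  simp only [surjSum, mixedSum, Finset.sum_filter, ← Finset.sum_add_distrib,
    ← Finset.sum_sub_distrib]
  refine Finset.sum_congr rfl fun l _ => ?_
  obtain ⟨p₀, hp₀⟩ := hex
  have hnot : ¬ (OffConst K N n false l ∧ OffConst K N n true l) := by
    rintro ⟨h1, h2⟩
    have := (h1 p₀ hp₀).symm.trans (h2 p₀ hp₀)
    simp at this
  have hmix : Mixed K N n l ↔ (∀ i, ∃ p : n.primeFactors, (l p).1 = i) ∧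
      ¬ OffConst K N n false l ∧ ¬ OffConst K N n true l := by
    have hs : ∀ p : n.primeFactors, 1 ≤ (slot K N p : ℕ) ↔ slot K N p ≠ 0 := fun p => by
      rw [Nat.one_le_iff_ne_zero, ne_eq, ne_eq, Fin.ext_iff]; rfl
    simp only [Mixed, OffConst, hs, Bool.forall_bool]
    push Not
    simp only [Bool.not_eq_false, Bool.not_eq_true]
    tauto
  rw [hmix]
  exact ite_eq_add_ite hnot _

theorem prod_twistFactor (x : ℕ × Bool) :
    (6 : ℝ) ^ Fintype.card (SmallPrime K N n) * ∏ q : LargePrime K N n, (2 + twist x.1 x.2 q.1) =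
      3 ^ #n.primeFactors * ∏ p ∈ n.primeFactors, twistFactor K N x p := by
  rw [← Finset.prod_const, ← Finset.prod_mul_distrib, ← Finset.prod_coe_sort n.primeFactors
    (fun p => 3 * twistFactor K N x p), ← Fintype.prod_subtype_mul_prod_subtype
      (fun p : n.primeFactors => slot K N p = 0) (fun p => 3 * twistFactor K N x p)]
  congr 1
  · rw [Finset.prod_congr rfl (fun (p : SmallPrime K N n) _ => show
      3 * twistFactor K N x p.1 = 6 by rw [twistFactor, if_pos p.2]; norm_num)]
    simp
  · refine Finset.prod_congr rfl fun q _ => ?_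
    rw [twistFactor, if_neg q.2]
    ring

theorem abs_surjSum_div_sub_le (hn : Squarefree n) (h3 : n % 4 = 3)
    (hex : ∃ p : n.primeFactors, slot K N p ≠ 0) :
    |surjSum n / 3 ^ #n.primeFactors - 3 / 2| ≤
      |mixedSum K N n| / 3 ^ #n.primeFactors +
      6 * ∏ p ∈ n.primeFactors, nonsurjFactor K N p +
      3 * ∑ x ∈ twistIndex (slotProd K N n 0), ∏ p ∈ n.primeFactors, twistFactor K N x p := by
  have h0 : (0 : ℝ) < 3 ^ #n.primeFactors := by positivity
  have e1 : 3 ^ #n.primeFactors * ∏ p ∈ n.primeFactors, nonsurjFactor K N p =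
      ∏ p ∈ n.primeFactors, (if slot K N p = 0 then 4 else 2 : ℝ) := by
    rw [← Finset.prod_const, ← Finset.prod_mul_distrib]
    refine Finset.prod_congr rfl fun p _ => ?_
    unfold nonsurjFactor
    split_ifs <;> norm_num
  have hm := abs_sum_offConst_sub_le (K := K) (N := N) hn h3
  rw [mul_assoc, Finset.mul_sum, Finset.sum_congr rfl (fun x _ => prod_twistFactor x),
    ← Finset.mul_sum] at hm
  have b1 := abs_sum_nonsurj_le (K := K) (N := N) (n := n) false
  have b2 := abs_sum_nonsurj_le (K := K) (N := N) (n := n) true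
  rw [← e1] at b1 b2
  have hs := surjSum_eq hex
  have key : |surjSum n - 3 / 2 * 3 ^ #n.primeFactors| ≤ |mixedSum K N n| +
      6 * (3 ^ #n.primeFactors * ∏ p ∈ n.primeFactors, nonsurjFactor K N p) +
      3 * (3 ^ #n.primeFactors * ∑ x ∈ twistIndex (slotProd K N n 0),
        ∏ p ∈ n.primeFactors, twistFactor K N x p) := by
    have hh := neg_abs_le (mixedSum K N n)
    have hh' := le_abs_self (mixedSum K N n)
    rw [abs_le] at *
    constructor <;> linarith [hm.1, hm.2, b1.1, b1.2, b2.1, b2.2]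
  rw [← mul_le_mul_iff_left₀ h0]
  calc _ = |surjSum n - 3 / 2 * 3 ^ #n.primeFactors| := by
        rw [← abs_of_pos h0, ← abs_mul, abs_of_pos h0, sub_mul, div_mul_cancel₀ _ h0.ne']
    _ ≤ _ := key
    _ = _ := by field_simp

end

theorem sqfMul_mul_le {g : ℕ → ℝ} (hg : ∀ p, 0 ≤ g p) (a b : ℕ) :
    sqfMul g (a * b) ≤ sqfMul g a * sqfMul g b := by
  by_cases h : Squarefree (a * b)
  · have hc := Nat.coprime_of_squarefree_mul h
    rw [sqfMul, if_pos h, sqfMul, if_pos h.of_mul_left, sqfMul, if_pos h.of_mul_right,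
      hc.primeFactors_mul, Finset.prod_union hc.disjoint_primeFactors]
  · rw [sqfMul, if_neg h]
    exact mul_nonneg (sqfMul_nonneg hg _) (sqfMul_nonneg hg _)

theorem sum_sqfMul_dvd_le {g : ℕ → ℝ} (hg : ∀ p, 0 ≤ g p) {D : ℕ} (hD : 0 < D) (N : ℕ) :
    ∑ n ∈ Icc 1 N with D ∣ n, sqfMul g n ≤
      sqfMul g D * ∑ m ∈ Icc 1 (N / D), sqfMul g m := by
  rw [Finset.mul_sum]
  calc _ ≤ ∑ n ∈ Icc 1 N with D ∣ n, sqfMul g D * sqfMul g (n / D) := by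
        refine Finset.sum_le_sum fun n hn => ?_
        have h := (Finset.mem_filter.1 hn).2
        conv_lhs => rw [← Nat.mul_div_cancel' h]
        exact sqfMul_mul_le hg _ _
    _ = _ := by
        refine Finset.sum_nbij' (fun n => n / D) (fun m => D * m) ?_ ?_ ?_ ?_ ?_
        · intro n hn
          simp only [mem_filter, Finset.mem_Icc] at hn ⊢
          exact ⟨Nat.div_pos (Nat.le_of_dvd hn.1.1 hn.2) hD, Nat.div_le_div_right hn.1.2⟩
        · intro m hm
          simp only [mem_filter, Finset.mem_Icc] at hm ⊢
          refine ⟨⟨Nat.mul_pos hD hm.1, ?_⟩, dvd_mul_right _ _⟩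
          rw [mul_comm]
          exact (Nat.le_div_iff_mul_le hD).1 hm.2
        · intro n hn
          exact Nat.mul_div_cancel' (Finset.mem_filter.1 hn).2
        · intro m _
          exact Nat.mul_div_cancel_left _ hD
        · intro n _; rfl

section
variable {K N : ℕ}

theorem sum_inv_slot_zero_le (hK : 0 < K) (hN : 0 < Real.log (Real.log N)) :
    ∑ p ∈ Nat.primesLE N, (if slot K N p = 0 then (1 / p : ℝ) else 0) ≤
      Real.log (Real.log N) / K + 7 := by
  rw [← Finset.sum_filter]
  exact sum_inv_slot_le hK hN 0

theorem sum_nonsurjFactor_le (hK : 0 < K) (hN : 0 < Real.log (Real.log N)) (hN3 : 3 ≤ N) :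
    ∑ n ∈ Icc 1 N, sqfMul (nonsurjFactor K N) n ≤
      4 * N * Real.exp (2 / 3 * (Real.log (Real.log N) + 4) +
        (Real.log (Real.log N) / K + 7)) / Real.log N := by
  have hlog : 0 < Real.log N := by linarith [one_le_log_of_three_le hN3]
  have hg : ∀ p, 0 ≤ nonsurjFactor K N p := fun p => by
    unfold nonsurjFactor; split_ifs <;> norm_num
  have hB : ∀ p, nonsurjFactor K N p ≤ 4 / 3 := fun p => by
    unfold nonsurjFactor; split_ifs <;> norm_num
  have hs : ∑ p ∈ Nat.primesLE N, nonsurjFactor K N p / p ≤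
      2 / 3 * (Real.log (Real.log N) + 4) + (Real.log (Real.log N) / K + 7) := by
    calc _ ≤ ∑ p ∈ Nat.primesLE N, (2 / 3 * (1 / (p : ℝ)) +
          if slot K N p = 0 then (1 / p : ℝ) else 0) := by
          refine Finset.sum_le_sum fun p _ => ?_
          have : (0 : ℝ) ≤ 1 / p := by positivity
          unfold nonsurjFactor
          split_ifs
          · rw [div_eq_mul_one_div]; linarith
          · rw [div_eq_mul_one_div]; linarith
      _ ≤ _ := by
          rw [Finset.sum_add_distrib, ← Finset.mul_sum]
          have := sum_inv_prime_le_loglog hN3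
          have := sum_inv_slot_zero_le hK hN
          linarith
  rw [le_div_iff₀ hlog, mul_comm]
  refine (log_mul_sum_sqfMul_le hg hB N).trans ?_
  have := Real.exp_le_exp.2 hs
  gcongr
  norm_num

theorem exists_twist_eq_neg_one {D : ℕ} {s : Bool} (hD : Squarefree D) (ho : Odd D)
    (h : 1 < D ∨ s = true) : ∃ a : ℕ, a.Coprime (4 * D) ∧ qchar D s h a = -1 := by
  by_cases h1 : 1 < D
  · obtain ⟨p, hp, hpD⟩ := Nat.exists_prime_and_dvd h1.ne'
    obtain ⟨D', rfl⟩ := hpD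
    have hp2 : p ≠ 2 := by
      rintro rfl
      exact (Nat.not_even_iff_odd.2 ho) (even_two.mul_right _)
    obtain ⟨a, ha, ha1, haj⟩ := exists_coprime_jacobiSym_eq_neg_one hp hp2
      (Nat.odd_mul.1 ho).2 (Nat.coprime_of_squarefree_mul hD)
    refine ⟨a, ha, ?_⟩
    have hχ : ZMod.χ₄ a = 1 := ZMod.χ₄_nat_one_mod_four ha1
    rw [qchar_apply, haj, hχ]
    simp
  · have hs := h.resolve_left h1
    have hD1 : D = 1 := by have := ho.pos; omega
    subst hD1 hs
    refine ⟨3, by decide, ?_⟩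
    rw [qchar_apply]
    have : ZMod.χ₄ ((3 : ℕ) : ZMod 4) = -1 := by decide
    rw [this]
    simp

theorem sum_twistFactor_le (hK : 0 < K) (hN : 0 < Real.log (Real.log N)) (hN3 : 3 ≤ N)
    {D : ℕ} {s : Bool} (hD : Squarefree D) (ho : Odd D) (h : 1 < D ∨ s = true)
    (hDM : (D : ℝ) ≤ Real.exp (Real.exp (2 * (Real.log (Real.log N) / K)))) :
    ∑ p ∈ Nat.primesLE N, twistFactor K N (D, s) p / p ≤
      2 / 3 * (Real.log (Real.log N) + 4) + (2 * (Real.log (Real.log N) / K) + 13) / 3 +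
        2 * (Real.log (Real.log N) / K + 7) := by
  set L := Real.log (Real.log N) / K
  have hL : 0 ≤ L := by positivity
  have hD0 : 0 < D := ho.pos
  obtain ⟨a, ha, haθ⟩ := exists_twist_eq_neg_one hD ho h
  have hT := sum_primes_character_div_le (θ := qchar D s h) (Q := 4 * D) (by omega)
    qchar_add_period abs_qchar_le_one ha haθ hN3
  have hlog : Real.log (Real.log ((4 * D : ℕ) : ℝ) + 3) ≤ 2 * L + 5 := by
    have hD0' : (0 : ℝ) < D := by exact_mod_cast hD0
    have h1 : Real.log ((4 * D : ℕ) : ℝ) ≤ 2 + Real.exp (2 * L) := by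
      push_cast
      rw [Real.log_mul (by norm_num) hD0'.ne']
      have h4 : Real.log 4 ≤ 2 := by
        have : Real.log 4 = 2 * Real.log 2 := by
          rw [show (4 : ℝ) = 2 ^ 2 by norm_num, Real.log_pow]; norm_num
        linarith [Real.log_two_lt_d9]
      have h5 := Real.log_le_log hD0' hDM
      rw [Real.log_exp] at h5
      linarith
    have h0 : 0 ≤ Real.log ((4 * D : ℕ) : ℝ) := Real.log_natCast_nonneg _
    have h2 : Real.log ((4 * D : ℕ) : ℝ) + 3 ≤ 6 * Real.exp (2 * L) := by
      have := Real.one_le_exp (by positivity : 0 ≤ 2 * L)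
      linarith
    calc _ ≤ Real.log (6 * Real.exp (2 * L)) := Real.log_le_log (by linarith) h2
      _ = Real.log 6 + 2 * L := by
          rw [Real.log_mul (by norm_num) (Real.exp_pos _).ne', Real.log_exp]
      _ ≤ _ := by linarith [Real.log_le_sub_one_of_pos (by norm_num : (0 : ℝ) < 6)]
  calc _ ≤ ∑ p ∈ Nat.primesLE N, (2 / 3 * (1 / (p : ℝ)) + 1 / 3 * (qchar D s h p / p) +
        2 * if slot K N p = 0 then (1 / p : ℝ) else 0) := by
        refine Finset.sum_le_sum fun p _ => ?_
        have h0 : (0 : ℝ) ≤ 1 / p := by positivity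
        have hq : qchar D s h p = twist D s p := by
          rw [qchar_apply, twist]; push_cast; split_ifs <;> simp
        have ht := (abs_le.1 (abs_twist_le_one D s p)).1
        rw [hq]
        unfold twistFactor
        split_ifs
        · have : 0 ≤ (2 + twist D s p) / 3 * (1 / (p : ℝ)) :=
            mul_nonneg (by linarith) h0
          rw [div_eq_mul_one_div 2 (p : ℝ), div_eq_mul_one_div (twist D s p)]
          linarith
        · rw [div_eq_mul_one_div _ (p : ℝ), div_eq_mul_one_div (twist D s p)]
          linarith
    _ ≤ _ := by
        rw [Finset.sum_add_distrib, Finset.sum_add_distrib, ← Finset.mul_sum, ← Finset.mul_sum,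
          ← Finset.mul_sum]
        have h1 := sum_inv_prime_le_loglog hN3
        have h2 := sum_inv_slot_zero_le hK hN
        linarith

theorem sum_twist_le (hK : 0 < K) (hN : 0 < Real.log (Real.log N)) (hN3 : 3 ≤ N)
    {D : ℕ} {s : Bool} (hD : Squarefree D) (ho : Odd D) (h : 1 < D ∨ s = true)
    (hDM : (D : ℝ) ≤ Real.exp (Real.exp (2 * (Real.log (Real.log N) / K))))
    (hM : 2 * Real.exp (Real.exp (2 * (Real.log (Real.log N) / K))) ≤ √N)
    (hslot : ∀ p ∈ D.primeFactors, slot K N p = 0) :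
    ∑ n ∈ Icc 1 N with D ∣ n, sqfMul (twistFactor K N (D, s)) n ≤
      sqfMul (fun p => if slot K N p = 0 then 2 else 0) D / D * (10 * N / Real.log N *
      Real.exp (2 / 3 * (Real.log (Real.log N) + 4) + (2 * (Real.log (Real.log N) / K) + 13) / 3 +
        2 * (Real.log (Real.log N) / K + 7))) := by
  have hs := sum_twistFactor_le hK hN hN3 hD ho h hDM
  set R := 2 / 3 * (Real.log (Real.log N) + 4) + (2 * (Real.log (Real.log N) / K) + 13) / 3 +
        2 * (Real.log (Real.log N) / K + 7)
  have hlog : 0 < Real.log N := by linarith [one_le_log_of_three_le hN3]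
  have hD0 : 0 < D := ho.pos
  have hD0' : (0 : ℝ) < D := by exact_mod_cast hD0
  have hN0 : (0 : ℝ) < N := by exact_mod_cast (by omega : 0 < N)
  have hg : ∀ p, 0 ≤ twistFactor K N (D, s) p := fun p => by
    have ht := (abs_le.1 (abs_twist_le_one D s p)).1
    unfold twistFactor; split_ifs
    · norm_num
    · simp only; linarith
  have hB : ∀ p, twistFactor K N (D, s) p ≤ 2 := fun p => by
    have ht := (abs_le.1 (abs_twist_le_one D s p)).2
    unfold twistFactor; split_ifs
    · norm_num
    · simp only; linarith
  have hg2 : ∀ p, 0 ≤ (fun p => if slot K N p = 0 then (2 : ℝ) else 0) p := fun p => by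
    simp only; split_ifs <;> norm_num
  have e : sqfMul (twistFactor K N (D, s)) D =
      sqfMul (fun p => if slot K N p = 0 then 2 else 0) D := by
    rw [sqfMul, if_pos hD, sqfMul, if_pos hD]
    refine Finset.prod_congr rfl fun p hp => ?_
    rw [twistFactor, if_pos (hslot p hp), if_pos (hslot p hp)]
  refine (sum_sqfMul_dvd_le hg hD0 N).trans ?_
  rw [e, div_mul_eq_mul_div, mul_div_assoc]
  refine mul_le_mul_of_nonneg_left ?_ (sqfMul_nonneg hg2 D)
  have hsq : √N * √N = (N : ℝ) := Real.mul_self_sqrt hN0.le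
  have hsq0 : 0 < √(N : ℝ) := Real.sqrt_pos.2 hN0
  have hND : √N ≤ ((N / D : ℕ) : ℝ) := by
    have h1 : (N : ℝ) / D < (N / D : ℕ) + 1 := by
      rw [div_lt_iff₀ hD0']
      have := Nat.lt_div_mul_add (a := N) hD0
      have : N < (N / D + 1) * D := by rw [add_mul, one_mul]; exact this
      exact_mod_cast this
    have h2 : 2 * √(N : ℝ) ≤ N / D := by
      rw [le_div_iff₀ hD0']
      have : 2 * (D : ℝ) ≤ √N := by linarith
      nlinarith
    have h3 : 1 ≤ √(N : ℝ) := by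
      have : (1 : ℝ) ≤ D := by exact_mod_cast hD0
      linarith
    linarith
  have hlogND : Real.log N / 2 ≤ Real.log ((N / D : ℕ) : ℝ) := by
    rw [← Real.log_sqrt hN0.le]
    exact Real.log_le_log hsq0 hND
  have hH := log_mul_sum_sqfMul_le hg hB (N / D)
  have hS0 : 0 ≤ ∑ m ∈ Icc 1 (N / D), sqfMul (twistFactor K N (D, s)) m :=
    Finset.sum_nonneg fun m _ => sqfMul_nonneg hg m
  have hsub : ∑ p ∈ Nat.primesLE (N / D), twistFactor K N (D, s) p / p ≤ R := by
    refine (Finset.sum_le_sum_of_subset_of_nonneg ?_ fun p _ _ =>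
      div_nonneg (hg p) (Nat.cast_nonneg _)).trans hs
    intro p hp
    rw [Nat.mem_primesLE] at hp ⊢
    exact ⟨hp.1.trans (Nat.div_le_self _ _), hp.2⟩
  have hle : ((N / D : ℕ) : ℝ) ≤ N / D := Nat.cast_div_le
  have h1 : Real.log N / 2 * ∑ m ∈ Icc 1 (N / D), sqfMul (twistFactor K N (D, s)) m ≤
      5 * (N / D) * Real.exp R := by
    calc _ ≤ _ := mul_le_mul_of_nonneg_right hlogND hS0
      _ ≤ _ := hH
      _ ≤ (2 * 2 + 1) * (N / D) * Real.exp R := by gcongr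
      _ = _ := by norm_num
  rw [le_div_iff₀ hD0', ← mul_le_mul_iff_right₀ (half_pos hlog)]
  calc _ = (Real.log N / 2 * ∑ m ∈ Icc 1 (N / D), sqfMul (twistFactor K N (D, s)) m) * D := by
        ring
    _ ≤ 5 * (N / D) * Real.exp R * D := mul_le_mul_of_nonneg_right h1 hD0'.le
    _ = _ := by field_simp; ring

theorem sum_good_twist_le (hK : 0 < K) (hN : 0 < Real.log (Real.log N)) (hN3 : 3 ≤ N)
    (hM : 2 * Real.exp (Real.exp (2 * (Real.log (Real.log N) / K))) ≤ √N) :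
    ∑ n ∈ Icc 1 N with Squarefree n ∧ Odd n ∧ Good K N n,
      ∑ x ∈ twistIndex (slotProd K N n 0), ∏ p ∈ n.primeFactors, twistFactor K N x p ≤
    2 * Real.exp (2 * (Real.log (Real.log N) / K + 7)) * (10 * N / Real.log N *
      Real.exp (2 / 3 * (Real.log (Real.log N) + 4) + (2 * (Real.log (Real.log N) / K) + 13) / 3 +
        2 * (Real.log (Real.log N) / K + 7))) := by
  set L := Real.log (Real.log N) / K
  set C := (10 * N / Real.log N *
      Real.exp (2 / 3 * (Real.log (Real.log N) + 4) + (2 * L + 13) / 3 + 2 * (L + 7)))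
  have hlog : 0 < Real.log N := by linarith [one_le_log_of_three_le hN3]
  have hC : 0 ≤ C := by positivity
  have hg : ∀ x p, 0 ≤ twistFactor K N x p := fun x p => by
    have ht := (abs_le.1 (abs_twist_le_one x.1 x.2 p)).1
    unfold twistFactor; split_ifs
    · norm_num
    · linarith
  have hg2 : ∀ p, 0 ≤ (fun p => if slot K N p = 0 then (2 : ℝ) else 0) p := fun p => by
    simp only; split_ifs <;> norm_num
  let T : Finset (ℕ × Bool) := (Icc 1 N ×ˢ univ).filter fun x =>
    (1 < x.1 ∨ x.2 = true) ∧ Squarefree x.1 ∧ Odd x.1 ∧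
      (x.1 : ℝ) ≤ Real.exp (Real.exp (2 * L)) ∧ ∀ p ∈ x.1.primeFactors, slot K N p = 0
  calc _ ≤ ∑ n ∈ Icc 1 N, ∑ x ∈ T, if x.1 ∣ n then sqfMul (twistFactor K N x) n else 0 := by
        rw [Finset.sum_filter]
        refine Finset.sum_le_sum fun n hn => ?_
        have hn := Finset.mem_Icc.1 hn
        have h0 : ∀ x ∈ T, 0 ≤ if x.1 ∣ n then sqfMul (twistFactor K N x) n else 0 :=
          fun x _ => by
            split_ifs
            · exact sqfMul_nonneg (hg x) n
            · exact le_rfl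
        split_ifs with h
        · obtain ⟨hsq, hodd, hgood⟩ := h
          have hdn : slotProd K N n 0 ∣ n := slotProd_dvd_self 0
          have hM0 : slotProd K N n 0 ≠ 0 := (slotProd_pos n 0).ne'
          have hgd := hgood 0
          rw [Real.log_le_iff_le_exp (by exact_mod_cast slotProd_pos n 0)] at hgd
          have e2 : ((0 : Fin (K + 1)) : ℕ) = 0 := rfl
          rw [e2, Nat.cast_zero, zero_add, mul_div_assoc] at hgd
          refine le_trans (Finset.sum_le_sum fun x hx => ?_)
            (Finset.sum_le_sum_of_subset_of_nonneg (s := twistIndex (slotProd K N n 0)) ?_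
              fun x hx _ => h0 x hx)
          · simp only [twistIndex, mem_filter, mem_product, Nat.mem_divisors] at hx
            rw [if_pos (hx.1.1.1.trans hdn), sqfMul, if_pos hsq]
          · intro x hx
            simp only [twistIndex, mem_filter, mem_product, Nat.mem_divisors, mem_univ,
              and_true] at hx
            obtain ⟨⟨hxd, -⟩, hx1⟩ := hx
            have hxn := hxd.trans hdn
            have hx0 : 0 < x.1 := Nat.pos_of_dvd_of_pos hxn hn.1
            have hxs : x.1 ≤ slotProd K N n 0 := Nat.le_of_dvd (slotProd_pos n 0) hxd
            simp only [T, mem_filter, mem_product, mem_univ, and_true, Finset.mem_Icc]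
            refine ⟨⟨hx0, (Nat.le_of_dvd hn.1 hxn).trans hn.2⟩, hx1, hsq.squarefree_of_dvd hxn,
              Odd.of_dvd_nat hodd hxn, le_trans (by exact_mod_cast hxs) hgd, fun p hp => ?_⟩
            have hpp := Nat.prime_of_mem_primeFactors hp
            obtain ⟨q, hq, hpq⟩ := (Prime.dvd_finsetProd_iff hpp.prime _).1
              ((Nat.dvd_of_mem_primeFactors hp).trans hxd)
            have hq := Finset.mem_filter.1 hq
            rw [(Nat.prime_dvd_prime_iff_eq hpp (Nat.prime_of_mem_primeFactors hq.1)).1 hpq]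
            exact hq.2
        · exact Finset.sum_nonneg h0
    _ = ∑ x ∈ T, ∑ n ∈ Icc 1 N with x.1 ∣ n, sqfMul (twistFactor K N x) n := by
        rw [Finset.sum_comm]
        simp only [Finset.sum_filter]
    _ ≤ ∑ x ∈ T, sqfMul (fun p => if slot K N p = 0 then 2 else 0) x.1 / x.1 * C := by
        refine Finset.sum_le_sum fun x hx => ?_
        obtain ⟨-, h1, h2, h3, h4, h5⟩ := Finset.mem_filter.1 hx
        exact sum_twist_le hK hN hN3 h2 h3 h1 h4 hM h5
    _ ≤ ∑ x ∈ Icc 1 N ×ˢ (univ : Finset Bool),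
          sqfMul (fun p => if slot K N p = 0 then 2 else 0) x.1 / x.1 * C :=
        Finset.sum_le_sum_of_subset_of_nonneg (Finset.filter_subset _ _) fun x _ _ =>
          mul_nonneg (div_nonneg (sqfMul_nonneg hg2 _) (Nat.cast_nonneg _)) hC
    _ = 2 * (∑ D ∈ Icc 1 N, sqfMul (fun p => if slot K N p = 0 then 2 else 0) D / D) * C := by
        rw [Finset.sum_product, Finset.mul_sum, Finset.sum_mul]
        refine Finset.sum_congr rfl fun D _ => ?_
        simp
        ring
    _ ≤ _ := by
        have h1 := sum_sqfMul_div_le hg2 N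
        have h2 : ∑ p ∈ Nat.primesLE N, (if slot K N p = 0 then (2 : ℝ) else 0) / p ≤
            2 * (L + 7) := by
          refine le_trans (le_of_eq ?_) (mul_le_mul_of_nonneg_left (sum_inv_slot_zero_le hK hN)
            zero_le_two)
          rw [Finset.mul_sum]
          refine Finset.sum_congr rfl fun p _ => ?_
          split_ifs <;> ring
        have h3 := h1.trans (Real.exp_le_exp.2 h2)
        gcongr

end

theorem jacobiSym_finsetProd_right {ι : Type*} (a : ℤ) (s : Finset ι) (f : ι → ℕ)
    (h : ∀ i ∈ s, f i ≠ 0) : jacobiSym a (∏ i ∈ s, f i) = ∏ i ∈ s, jacobiSym a (f i) := by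
  induction s using Finset.induction_on with
  | empty => simp [jacobiSym.one_right]
  | insert i s hi ih =>
    rw [Finset.prod_insert hi, Finset.prod_insert hi,
      jacobiSym.mul_right' _ (h i (mem_insert_self i s))
        (Finset.prod_ne_zero_iff.2 fun j hj => h j (mem_insert_of_mem hj)),
      ih fun j hj => h j (mem_insert_of_mem hj)]

theorem sum_labelSign_eq {n : ℕ} (σ : n.primeFactors → Fin 3) :
    ∑ τ : n.primeFactors → Bool, labelSign n (fun p => (σ p, τ p)) =
      ∏ i, ∏ p ∈ (colorProd n σ i).primeFactors,
        (1 + ∏ j with j ≠ i, (jacobiSym p (colorProd n σ j) : ℝ)) := by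
  have h1 : ∀ p : n.primeFactors,
      ∏ q : n.primeFactors, couple (σ p, true) (σ q, true) p q =
        ∏ j with j ≠ σ p, (jacobiSym p (colorProd n σ j) : ℝ) := by
    intro p
    rw [Finset.prod_filter, ← Finset.prod_fiberwise univ σ]
    refine Finset.prod_congr rfl fun j _ => ?_
    unfold colorProd
    rw [jacobiSym_finsetProd_right _ _ _ fun q _ => (Nat.prime_of_mem_primeFactors q.2).ne_zero]
    split_ifs with hj
    · rw [Int.cast_prod]
      refine Finset.prod_congr rfl fun q hq => ?_
      have : σ q = j := (Finset.mem_filter.1 hq).2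
      simp [couple, this, Ne.symm hj]
    · refine Finset.prod_eq_one fun q hq => ?_
      have : σ q = j := (Finset.mem_filter.1 hq).2
      simp [couple, this, not_not.1 hj]
  have h2 : ∀ τ : n.primeFactors → Bool, labelSign n (fun p => (σ p, τ p)) =
      ∏ p, if τ p = true then
        ∏ j with j ≠ σ p, (jacobiSym p (colorProd n σ j) : ℝ) else 1 := by
    intro τ
    unfold labelSign
    refine Finset.prod_congr rfl fun p _ => ?_
    rw [← h1 p]
    split_ifs with h
    · simp [couple, h]
    · simp [couple, h]
  simp only [h2]
  have h3 := Finset.prod_univ_sum (fun _ : n.primeFactors => (univ : Finset Bool))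
    (fun p b => if b = true then
        ∏ j with j ≠ σ p, (jacobiSym p (colorProd n σ j) : ℝ) else 1)
  rw [Fintype.piFinset_univ] at h3
  rw [← h3, ← Finset.prod_fiberwise univ σ]
  refine Finset.prod_congr rfl fun i _ => ?_
  rw [prod_primeFactors_colorProd σ i
    (fun p => 1 + ∏ j with j ≠ i, (jacobiSym p (colorProd n σ j) : ℝ))]
  refine Finset.prod_congr rfl fun p hp => ?_
  rw [(Finset.mem_filter.1 hp).2, Fintype.sum_bool]
  simp [add_comm]

/-- The local factor attached to an ordered factorization into three natural numbers. -/
def factTerm (x : Fin 3 → ℕ) : ℝ :=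
  if ∀ i, x i ≠ 1 then
    ∏ i, ∏ p ∈ (x i).primeFactors, (1 + ∏ j with j ≠ i, (jacobiSym p (x j) : ℝ)) else 0

theorem surjSum_eq_sum_factTerm {n : ℕ} (hn : Squarefree n) :
    surjSum n = ∑ x ∈ (Fintype.piFinset fun _ : Fin 3 => n.divisors).filter
      (fun x => ∏ a, x a = n), factTerm x := by
  rw [← sum_colorings_eq hn factTerm]
  unfold surjSum
  rw [Finset.sum_filter, ← (Equiv.arrowProdEquivProdArrow n.primeFactors (fun _ => Fin 3)
    (fun _ => Bool)).symm.sum_comp, Fintype.sum_prod_type]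
  refine Finset.sum_congr rfl fun σ _ => ?_
  unfold factTerm
  simp only [colorProd_ne_one]
  rw [← sum_labelSign_eq]
  simp only [Equiv.arrowProdEquivProdArrow, Equiv.coe_fn_symm_mk]
  split_ifs with h
  · exact Finset.sum_congr rfl fun τ _ => if_pos h
  · exact Finset.sum_eq_zero fun τ _ => if_neg h

theorem natAbs_mod_four {t : ℤ} (h : t % 4 = 1) :
    ZMod.χ₄ t.natAbs * (t.natAbs : ℤ) = t := by
  rw [ZMod.χ₄_nat_eq_if_mod_four]
  rcases Int.natAbs_eq t with h' | h'
  · have : t.natAbs % 4 = 1 := by omega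
    rw [if_neg (by omega), if_pos this]; omega
  · have : t.natAbs % 4 = 3 := by omega
    rw [if_neg (by omega), if_neg (by omega)]; omega

theorem isFundDisc_iff_of_odd {t : ℤ} (h : t % 2 = 1) :
    IsFundDisc t ↔ t % 4 = 1 ∧ Squarefree t := by
  unfold IsFundDisc
  constructor
  · rintro (h' | ⟨m, rfl, -⟩)
    · exact h'
    · omega
  · exact Or.inl

theorem jacobiSym_of_mod_four {t : ℤ} (h : t % 4 = 1) {p : ℕ} (hp : Odd p) :
    jacobiSym t p = jacobiSym p t.natAbs := by
  have ho : Odd t.natAbs := Nat.odd_iff.2 (by omega)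
  conv_lhs => rw [← natAbs_mod_four h, jacobiSym.mul_left]
  rw [jacobiSym.quadratic_reciprocity' hp ho, qrSign]

theorem tripleTerm_eq {t : ℤ × ℤ × ℤ} (h1 : t.1 % 4 = 1) (h2 : t.2.1 % 4 = 1)
    (h3 : t.2.2 % 4 = 1) (hne : t.1 ≠ 1 ∧ t.2.1 ≠ 1 ∧ t.2.2 ≠ 1) :
    (tripleTerm t : ℝ) = factTerm ![t.1.natAbs, t.2.1.natAbs, t.2.2.natAbs] := by
  have key : ∀ a b c : ℤ, a % 4 = 1 → b % 4 = 1 → c % 4 = 1 →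
      ((∏ p ∈ a.natAbs.primeFactors, (1 + kron (b * c) p) : ℤ) : ℝ) =
      ∏ p ∈ a.natAbs.primeFactors,
        (1 + (jacobiSym p b.natAbs : ℝ) * (jacobiSym p c.natAbs : ℝ)) := by
    intro a b c ha hb hc
    rw [Int.cast_prod]
    refine Finset.prod_congr rfl fun p hp => ?_
    have ho : Odd p := Odd.of_dvd_nat (Nat.odd_iff.2 (by omega)) (Nat.dvd_of_mem_primeFactors hp)
    have hp2 : p ≠ 2 := by rintro rfl; exact absurd ho (by decide)
    rw [kron, if_neg hp2, jacobiSym.mul_left, jacobiSym_of_mod_four hb ho,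
      jacobiSym_of_mod_four hc ho]
    push_cast
    rfl
  have hf : ∀ (i : Fin 3) (f : Fin 3 → ℝ), ∏ j with j ≠ i, f j =
      ∏ j, if j ≠ i then f j else 1 := fun i f => Finset.prod_filter _ _
  unfold factTerm
  rw [if_pos]
  · unfold tripleTerm
    push_cast [key]
    simp only [Fin.prod_univ_three]
    simp only [hf, Fin.prod_univ_three]
    have e1 := key t.2.2 t.1 t.2.1 h3 h1 h2
    have e2 := key t.2.1 t.1 t.2.2 h2 h1 h3
    have e3 := key t.1 t.2.1 t.2.2 h1 h2 h3
    push_cast at e1 e2 e3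
    rw [e1, e2, e3]
    simp
    ring
  · intro i
    fin_cases i <;> simp <;> omega

theorem sum_tripleTerm_eq {d : ℤ} (hd : d < 0) (hs : Squarefree d) (h4 : d % 4 = 1) :
    ∑ t ∈ fdTriples d, (tripleTerm t : ℝ) = surjSum d.natAbs := by
  have hsn : Squarefree d.natAbs := Int.squarefree_natAbs.2 hs
  have hn0 : d.natAbs ≠ 0 := hsn.ne_zero
  have hmem : ∀ t ∈ fdTriples d, t.1 % 4 = 1 ∧ t.2.1 % 4 = 1 ∧ t.2.2 % 4 = 1 ∧
      (t.1 ≠ 1 ∧ t.2.1 ≠ 1 ∧ t.2.2 ≠ 1) ∧ t.1 * t.2.1 * t.2.2 = d := by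
    intro t ht
    obtain ⟨-, f1, f2, f3, n1, n2, n3, -, -, -, hp⟩ := Finset.mem_filter.1 ht
    have hodd : ∀ a : ℤ, a ∣ d → a % 2 = 1 := by
      rintro a ⟨b, rfl⟩
      rcases Int.emod_two_eq_zero_or_one a with h | h
      · have := Int.mul_emod a b 2
        rw [h] at this
        omega
      · exact h
    have o1 := hodd t.1 ⟨t.2.1 * t.2.2, by rw [← hp]; ring⟩
    have o2 := hodd t.2.1 ⟨t.1 * t.2.2, by rw [← hp]; ring⟩
    have o3 := hodd t.2.2 ⟨t.1 * t.2.1, by rw [← hp]; ring⟩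
    exact ⟨((isFundDisc_iff_of_odd o1).1 f1).1, ((isFundDisc_iff_of_odd o2).1 f2).1,
      ((isFundDisc_iff_of_odd o3).1 f3).1, ⟨n1, n2, n3⟩, hp⟩
  have hz : ∀ x, factTerm x ≠ 0 → ∀ i, x i ≠ 1 := fun x h => of_not_not fun h' => h (if_neg h')
  rw [surjSum_eq_sum_factTerm hsn, ← Finset.sum_filter_of_ne fun x _ => hz x]
  refine Finset.sum_bij (fun t _ => ![t.1.natAbs, t.2.1.natAbs, t.2.2.natAbs]) ?_ ?_ ?_ ?_
  · intro t ht
    obtain ⟨h1, h2, h3, ⟨n1, n2, n3⟩, hp⟩ := hmem t ht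
    have hpn : t.1.natAbs * t.2.1.natAbs * t.2.2.natAbs = d.natAbs := by
      rw [← hp, Int.natAbs_mul, Int.natAbs_mul]
    refine Finset.mem_filter.2 ⟨Finset.mem_filter.2 ⟨Fintype.mem_piFinset.2 fun i => ?_, ?_⟩, ?_⟩
    · refine Nat.mem_divisors.2 ⟨?_, hn0⟩
      rw [← hpn]
      fin_cases i
      · exact ⟨t.2.1.natAbs * t.2.2.natAbs, by simp; ring⟩
      · exact ⟨t.1.natAbs * t.2.2.natAbs, by simp; ring⟩
      · exact ⟨t.1.natAbs * t.2.1.natAbs, by simp; ring⟩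
    · rw [Fin.prod_univ_three]
      exact hpn
    · intro i
      fin_cases i <;> simp <;> omega
  · intro t ht t' ht' h
    obtain ⟨h1, h2, h3, -, -⟩ := hmem t ht
    obtain ⟨h1', h2', h3', -, -⟩ := hmem t' ht'
    have a1 := congrFun h 0
    have a2 := congrFun h 1
    have a3 := congrFun h 2
    simp at a1 a2 a3
    exact Prod.ext (by omega) (Prod.ext (by omega) (by omega))
  · intro x hx
    obtain ⟨hx, hne⟩ := Finset.mem_filter.1 hx
    obtain ⟨hx, hp⟩ := Finset.mem_filter.1 hx
    have hdv : ∀ i, x i ∣ d.natAbs := fun i => (Nat.mem_divisors.1 (Fintype.mem_piFinset.1 hx i)).1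
    have hle : ∀ i, x i ≤ d.natAbs := fun i => Nat.le_of_dvd (Nat.pos_of_ne_zero hn0) (hdv i)
    rw [Fin.prod_univ_three] at hp
    have hod : ∀ i, x i % 2 = 1 := fun i =>
      Nat.odd_iff.1 (Odd.of_dvd_nat (Nat.odd_iff.2 (by omega)) (hdv i))
    have hy : ∀ i, ∃ a : ℤ, a.natAbs = x i ∧ a % 4 = 1 := by
      intro i
      have := hod i
      by_cases h : x i % 4 = 1
      · exact ⟨x i, by simp, by omega⟩
      · exact ⟨-x i, by simp, by omega⟩
    choose y hyx hy4 using hy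
    have hsq : ∀ i, Squarefree (y i) := fun i => Int.squarefree_natAbs.1
      (by rw [hyx]; exact hsn.squarefree_of_dvd (hdv i))
    have hpd : y 0 * y 1 * y 2 = d := by
      have hm : (y 0 * y 1 * y 2) % 4 = 1 := by
        rw [Int.mul_emod, Int.mul_emod (y 0), hy4, hy4, hy4]; rfl
      have ha : (y 0 * y 1 * y 2).natAbs = d.natAbs := by
        rw [Int.natAbs_mul, Int.natAbs_mul, hyx, hyx, hyx, hp]
      generalize y 0 * y 1 * y 2 = z at *
      omega
    have hcop : ∀ i j, x i * x j ∣ d.natAbs → IsCoprime (y i) (y j) := by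
      intro i j h
      rw [Int.isCoprime_iff_gcd_eq_one, Int.gcd, hyx, hyx]
      exact Nat.coprime_of_squarefree_mul (hsn.squarefree_of_dvd h)
    have hI : ∀ i, y i ∈ Finset.Icc (-(d.natAbs : ℤ)) (d.natAbs : ℤ) := by
      intro i
      have := hle i
      have := hyx i
      rw [Finset.mem_Icc]
      omega
    have hn1 : ∀ i, y i ≠ 1 := by
      intro i h
      have := hne i
      rw [← hyx i, h] at this
      simp at this
    refine ⟨(y 0, y 1, y 2), Finset.mem_filter.2 ⟨?_, Or.inl ⟨hy4 0, hsq 0⟩,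
      Or.inl ⟨hy4 1, hsq 1⟩, Or.inl ⟨hy4 2, hsq 2⟩, hn1 0, hn1 1, hn1 2,
      hcop 0 1 ?_, hcop 0 2 ?_, hcop 1 2 ?_, hpd⟩, ?_⟩
    · simp only [Finset.mem_product]
      exact ⟨hI 0, hI 1, hI 2⟩
    · exact ⟨x 2, hp.symm⟩
    · exact ⟨x 1, by rw [← hp]; ring⟩
    · exact ⟨x 0, by rw [← hp]; ring⟩
    · funext i
      fin_cases i <;> simp [hyx]
  · intro t ht
    obtain ⟨h1, h2, h3, hne, -⟩ := hmem t ht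
    exact tripleTerm_eq h1 h2 h3 hne

theorem ftilde_div_eq {d : ℤ} (hd : d < 0) (hs : Squarefree d) (h4 : d % 4 = 1) :
    ftilde d / 3 ^ omegaZ d = (1 / 48) * (surjSum d.natAbs / 3 ^ #d.natAbs.primeFactors) := by
  unfold ftilde omegaZ alphaFD
  rw [sum_tripleTerm_eq hd hs h4, if_neg (by omega)]
  ring

section
variable {K N n : ℕ}

theorem exists_slot_ne_zero (hn : Squarefree n) (hg : Good K N n)
    (hlt : Real.exp (Real.exp (2 * (Real.log (Real.log N) / K))) < n) :
    ∃ p : n.primeFactors, slot K N p ≠ 0 := by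
  by_contra h
  push Not at h
  have h1 : slotProd K N n 0 = n := by
    unfold slotProd
    rw [Finset.filter_true_of_mem fun p hp => h ⟨p, hp⟩]
    exact Nat.prod_primeFactors_of_squarefree hn
  have h2 := hg 0
  rw [h1] at h2
  have hn0 : (0 : ℝ) < n := Nat.cast_pos.2 (Nat.pos_of_ne_zero hn.ne_zero)
  rw [Real.log_le_iff_le_exp hn0] at h2
  refine absurd (h2.trans (le_of_eq ?_)) (not_le.2 hlt)
  congr 2
  simp
  ring

theorem twistFactor_nonneg (x : ℕ × Bool) (p : ℕ) : 0 ≤ twistFactor K N x p := by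
  unfold twistFactor
  have := (abs_le.1 (abs_twist_le_one x.1 x.2 p)).1
  split_ifs
  · norm_num
  · linarith

theorem nonsurjFactor_pos (p : ℕ) : 0 < nonsurjFactor K N p := by
  unfold nonsurjFactor; split_ifs <;> norm_num

theorem one_le_of_lt_add {ε a b c : ℝ} (hε : 0 < ε) (hb : 0 ≤ b) (hc : 0 ≤ c)
    (ha : 0 ≤ a) (h : ε < a + 6 * b + 3 * c) :
    1 ≤ 9 / ε ^ 2 * a ^ 2 + 18 / ε * b + 9 / ε * c := by
  have h1 : 0 ≤ 18 / ε * b := by positivity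
  have h2 : 0 ≤ 9 / ε * c := by positivity
  have h3 : 0 ≤ 9 / ε ^ 2 * a ^ 2 := by positivity
  rcases le_or_gt (ε / 3) a with h4 | h4
  · have : 1 ≤ 9 / ε ^ 2 * a ^ 2 := by
      rw [div_mul_eq_mul_div, le_div_iff₀ (by positivity)]
      nlinarith
    linarith
  rcases le_or_gt (ε / 3) (6 * b) with h5 | h5
  · have : 1 ≤ 18 / ε * b := by
      rw [div_mul_eq_mul_div, le_div_iff₀ hε]
      linarith
    linarith
  · have : 1 ≤ 9 / ε * c := by
      rw [div_mul_eq_mul_div, le_div_iff₀ hε]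
      linarith
    linarith

/-- The integers at which the normalized sum of signs is far from its typical value. -/
def exceptional (ε : ℝ) (N : ℕ) : Finset ℕ :=
  {n ∈ Icc 1 N | Squarefree n ∧ n % 4 = 3 ∧ ε < |surjSum n / 3 ^ #n.primeFactors - 3 / 2|}

theorem card_exceptional_le {ε : ℝ} (hε : 0 < ε) (hK : 0 < K)
    (hN : 0 < Real.log (Real.log N)) (hN3 : 3 ≤ N)
    (h4 : 4 ≤ Real.exp (Real.log (Real.log N) / K))
    (hM : 2 * Real.exp (Real.exp (2 * (Real.log (Real.log N) / K))) ≤ √N) :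
    (#(exceptional ε N) : ℝ) ≤
      √N + (K + 1) * (3 * N * Real.exp (-(Real.log (Real.log N) / K))) +
      (9 / ε ^ 2 * (2 ^ Fintype.card (Cell K) *
        (N * (2 * √((5 + Real.log N) / Real.exp (Real.exp (Real.log (Real.log N) / K)))) *
            (1 + Real.log N) ^ Fintype.card (Cell K) +
          9 * N * Real.exp (8 / 9 * (Real.log (Real.log N) + 4) +
            724 * (Real.log (Real.log N) / K + 7)) / Real.log N)) +
       18 / ε * (4 * N * Real.exp (2 / 3 * (Real.log (Real.log N) + 4) +
          (Real.log (Real.log N) / K + 7)) / Real.log N) +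
       9 / ε * (2 * Real.exp (2 * (Real.log (Real.log N) / K + 7)) * (10 * N / Real.log N *
          Real.exp (2 / 3 * (Real.log (Real.log N) + 4) +
            (2 * (Real.log (Real.log N) / K) + 13) / 3 +
            2 * (Real.log (Real.log N) / K + 7))))) := by
  set M := Real.exp (Real.exp (2 * (Real.log (Real.log N) / K))) with hMdef
  set G := {n ∈ Icc 1 N | Squarefree n ∧ Odd n ∧ Good K N n} with hG
  set B : Fin (K + 1) → Finset ℕ := fun j =>
    {n ∈ Icc 1 N | Real.exp (((j : ℕ) + 2) * Real.log (Real.log N) / K) <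
      Real.log (slotProd K N n j)} with hB
  set E := {n ∈ exceptional ε N | Good K N n ∧ M < n} with hE
  have hsub : exceptional ε N ⊆ Icc 1 ⌊M⌋₊ ∪ univ.biUnion B ∪ E := by
    intro n hn
    have hnI := (Finset.mem_filter.1 hn).1
    simp only [Finset.mem_union, Finset.mem_biUnion, mem_univ, true_and]
    by_cases h1 : M < n
    · by_cases h2 : Good K N n
      · exact Or.inr (Finset.mem_filter.2 ⟨hn, h2, h1⟩)
      · unfold Good at h2
        push Not at h2
        obtain ⟨j, hj⟩ := h2
        exact Or.inl (Or.inr ⟨j, Finset.mem_filter.2 ⟨hnI, hj⟩⟩)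
    · exact Or.inl (Or.inl (Finset.mem_Icc.2 ⟨(Finset.mem_Icc.1 hnI).1,
        Nat.le_floor (not_lt.1 h1)⟩))
  have hcard : (#(exceptional ε N) : ℝ) ≤ (⌊M⌋₊ : ℝ) + ∑ j, (#(B j) : ℝ) + #E := by
    have h1 := (Finset.card_le_card hsub).trans ((Finset.card_union_le _ _).trans
      (Nat.add_le_add_right ((Finset.card_union_le _ _).trans
        (Nat.add_le_add_left Finset.card_biUnion_le _)) _))
    rw [Nat.card_Icc, Nat.add_sub_cancel] at h1
    exact_mod_cast h1
  have hMle : (⌊M⌋₊ : ℝ) ≤ √N := by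
    have h0 : 0 < M := Real.exp_pos _
    linarith [Nat.floor_le h0.le]
  have hBle : ∑ j, (#(B j) : ℝ) ≤
      (K + 1) * (3 * N * Real.exp (-(Real.log (Real.log N) / K))) := by
    refine (Finset.sum_le_sum fun j _ => card_large_slotProd_le hK hN j).trans (le_of_eq ?_)
    simp
  have hEle : (#E : ℝ) ≤ ∑ n ∈ G, (9 / ε ^ 2 * ((1 / 9 : ℝ) ^ #n.primeFactors *
      mixedSum K N n ^ 2) + 18 / ε * sqfMul (nonsurjFactor K N) n +
      9 / ε * ∑ x ∈ twistIndex (slotProd K N n 0), ∏ p ∈ n.primeFactors, twistFactor K N x p) := by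
    have hb0 : ∀ n, 0 ≤ sqfMul (nonsurjFactor K N) n := fun n =>
      sqfMul_nonneg (fun p => (nonsurjFactor_pos p).le) n
    have hc0 : ∀ n, 0 ≤ ∑ x ∈ twistIndex (slotProd K N n 0),
        ∏ p ∈ n.primeFactors, twistFactor K N x p := fun n =>
      Finset.sum_nonneg fun x _ => Finset.prod_nonneg fun p _ => twistFactor_nonneg x p
    have hEG : E ⊆ G := by
      intro n hn
      obtain ⟨hn, hg, -⟩ := Finset.mem_filter.1 hn
      obtain ⟨hI, hs, h3, -⟩ := Finset.mem_filter.1 hn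
      exact Finset.mem_filter.2 ⟨hI, hs, Nat.odd_iff.2 (by omega), hg⟩
    calc (#E : ℝ) = ∑ n ∈ E, 1 := by simp
      _ ≤ ∑ n ∈ E, (9 / ε ^ 2 * ((1 / 9 : ℝ) ^ #n.primeFactors *
          mixedSum K N n ^ 2) + 18 / ε * sqfMul (nonsurjFactor K N) n +
          9 / ε * ∑ x ∈ twistIndex (slotProd K N n 0),
            ∏ p ∈ n.primeFactors, twistFactor K N x p) := by
        refine Finset.sum_le_sum fun n hn => ?_
        obtain ⟨hn, hg, hlt⟩ := Finset.mem_filter.1 hn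
        obtain ⟨hI, hs, h3, hd⟩ := Finset.mem_filter.1 hn
        have hle := abs_surjSum_div_sub_le hs h3 (exists_slot_ne_zero hs hg hlt)
        have hsq : sqfMul (nonsurjFactor K N) n = ∏ p ∈ n.primeFactors, nonsurjFactor K N p :=
          if_pos hs
        rw [← hsq] at hle
        have := one_le_of_lt_add hε (hb0 n) (hc0 n) (by positivity) (hd.trans_le hle)
        refine this.trans (le_of_eq ?_)
        have h9 : ((3 : ℝ) ^ #n.primeFactors) ^ 2 = 9 ^ #n.primeFactors := by
          rw [← pow_mul, mul_comm _ 2, pow_mul]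
          norm_num
        rw [div_pow, sq_abs, one_div, inv_pow, h9, div_eq_inv_mul (mixedSum K N n ^ 2)]
      _ ≤ _ := Finset.sum_le_sum_of_subset_of_nonneg hEG fun n _ _ =>
        add_nonneg (add_nonneg (by positivity) (mul_nonneg (by positivity) (hb0 n)))
          (mul_nonneg (by positivity) (hc0 n))
  rw [Finset.sum_add_distrib, Finset.sum_add_distrib, ← Finset.mul_sum, ← Finset.mul_sum,
    ← Finset.mul_sum] at hEle
  have h1 := sum_good_mixedSum_sq_le hK hN hN3 h4
  have h2 := sum_nonsurjFactor_le hK hN hN3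
  have h3 := sum_good_twist_le hK hN hN3 hM
  have h2' : ∑ n ∈ G, sqfMul (nonsurjFactor K N) n ≤
      ∑ n ∈ Icc 1 N, sqfMul (nonsurjFactor K N) n :=
    Finset.sum_le_sum_of_subset_of_nonneg (Finset.filter_subset _ _) fun n _ _ =>
      sqfMul_nonneg (fun p => (nonsurjFactor_pos p).le) n
  refine hcard.trans (add_le_add (add_le_add hMle hBle) (hEle.trans ?_))
  gcongr
  exact h2'.trans h2

end

theorem tendsto_sqrt_mul_pow_zero (k m : ℕ) :
    Tendsto (fun u : ℝ => √((5 + u ^ k) / Real.exp u) * (1 + u ^ k) ^ m) atTop (nhds 0) := by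
  have h1 := Polynomial.tendsto_div_exp_atTop
    ((5 + Polynomial.X ^ k) * ((1 + Polynomial.X ^ k) ^ m) ^ 2 : Polynomial ℝ)
  have h2 := (Real.continuous_sqrt.tendsto 0).comp h1
  rw [Real.sqrt_zero] at h2
  refine h2.congr' ?_
  filter_upwards [eventually_ge_atTop 0] with u hu
  have h0 : 0 ≤ (1 + u ^ k) ^ m := by positivity
  simp only [Function.comp, Polynomial.eval_mul, Polynomial.eval_add, Polynomial.eval_pow,
    Polynomial.eval_X, Polynomial.eval_one, Polynomial.eval_ofNat]
  rw [mul_div_right_comm, Real.sqrt_mul (by positivity), Real.sqrt_sq h0]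

theorem tendsto_exp_linear {f : ℕ → ℝ} (hf : Tendsto f atTop atTop) {a : ℝ} (ha : 0 < a) (b : ℝ) :
    Tendsto (fun N => Real.exp (b - a * f N)) atTop (nhds 0) := by
  refine Real.tendsto_exp_atBot.comp ?_
  exact tendsto_atBot_add_const_left _ b (tendsto_neg_atTop_atBot.comp (hf.const_mul_atTop ha))

theorem tendsto_loglog : Tendsto (fun N : ℕ => Real.log (Real.log N)) atTop atTop :=
  Real.tendsto_log_atTop.comp (Real.tendsto_log_atTop.comp tendsto_natCast_atTop_atTop)

/-- Almost all integers which are squarefree and `3` modulo `4` are not exceptional. -/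
theorem tendsto_card_exceptional_div {ε : ℝ} (hε : 0 < ε) :
    Tendsto (fun N : ℕ => (#(exceptional ε N) : ℝ) / N) atTop (nhds 0) := by
  obtain ⟨K, hKdef⟩ : ∃ K : ℕ, K = 10000 := ⟨_, rfl⟩
  have hK : 0 < K := by omega
  have hKr : (K : ℝ) = 10000 := by rw [hKdef]; norm_num
  have hy := tendsto_loglog
  have hu : Tendsto (fun N : ℕ => Real.exp (Real.log (Real.log N) / K)) atTop atTop :=
    Real.tendsto_exp_atTop.comp (hy.atTop_div_const (by positivity))
  have hlN : Tendsto (fun N : ℕ => Real.log N) atTop atTop :=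
    Real.tendsto_log_atTop.comp tendsto_natCast_atTop_atTop
  obtain ⟨C, hC⟩ : ∃ C : ℕ, C = Fintype.card (Cell K) := ⟨_, rfl⟩
  have t1 : Tendsto (fun N : ℕ => (√N)⁻¹) atTop (nhds 0) :=
    (Real.tendsto_sqrt_atTop.comp tendsto_natCast_atTop_atTop).inv_tendsto_atTop
  have t2 := (tendsto_exp_linear hy (show (0 : ℝ) < 1 / K by positivity) 0).const_mul
    ((K + 1) * 3 : ℝ)
  have t3 := ((tendsto_sqrt_mul_pow_zero K C).comp hu).const_mul (9 / ε ^ 2 * 2 ^ C * 2)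
  have t4 := (tendsto_exp_linear hy (show (0 : ℝ) < 1 / 9 - 724 / K by rw [hKr]; norm_num)
    (8 / 9 * 4 + 724 * 7)).const_mul (9 / ε ^ 2 * 2 ^ C * 9)
  have t5 := (tendsto_exp_linear hy (show (0 : ℝ) < 1 / 3 - 1 / K by rw [hKr]; norm_num)
    (2 / 3 * 4 + 7)).const_mul (18 / ε * 4)
  have t6 := (tendsto_exp_linear hy
    (show (0 : ℝ) < 1 / 3 - (2 / 3 + 4) / K by rw [hKr]; norm_num)
    (2 / 3 * 4 + 13 / 3 + 28)).const_mul (9 / ε * 20)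
  have t := ((((t1.add t2).add t3).add t4).add t5).add t6
  simp only [mul_zero, add_zero] at t
  refine squeeze_zero' (Eventually.of_forall fun N =>
    div_nonneg (Nat.cast_nonneg _) (Nat.cast_nonneg _)) ?_ t
  have hM : ∀ᶠ N : ℕ in atTop,
      2 * Real.exp (Real.exp (2 * (Real.log (Real.log N) / K))) ≤ √N := by
    filter_upwards [hy.eventually_ge_atTop (2 : ℝ), hlN.eventually_ge_atTop (6 : ℝ),
      eventually_ge_atTop 1] with N h2 h3 h1
    have hN0 : (0 : ℝ) < N := by exact_mod_cast h1
    have hl : Real.exp (Real.log (Real.log N)) = Real.log N := Real.exp_log (by linarith)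
    have hs : √(N : ℝ) = Real.exp (Real.log N / 2) := by
      rw [Real.exp_half, Real.exp_log hN0]
    have h5 : Real.exp (2 * (Real.log (Real.log N) / K)) ≤ Real.log N / 3 := by
      have h6 : Real.exp (2 * (Real.log (Real.log N) / K)) ≤
          Real.exp (Real.log (Real.log N) - 1.2) := by
        refine Real.exp_le_exp.2 ?_
        rw [hKr]
        linarith
      have h7 : Real.exp (1.2 : ℝ) ≥ 3 := by
        have := Real.quadratic_le_exp_of_nonneg (show (0 : ℝ) ≤ 1.2 by norm_num)
        have h8 := Real.sum_le_exp_of_nonneg (show (0 : ℝ) ≤ 1.2 by norm_num) 5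
        norm_num [Finset.sum_range_succ, Nat.factorial] at h8
        norm_num
        linarith
      rw [Real.exp_sub, hl] at h6
      exact h6.trans (div_le_div_of_nonneg_left (by linarith) (by norm_num) h7)
    have h9 : (2 : ℝ) ≤ Real.exp 1 := by linarith [Real.add_one_le_exp (1 : ℝ)]
    rw [hs]
    calc 2 * Real.exp (Real.exp (2 * (Real.log (Real.log N) / K)))
        ≤ Real.exp 1 * Real.exp (Real.log N / 3) :=
          mul_le_mul h9 (Real.exp_le_exp.2 h5) (Real.exp_pos _).le (Real.exp_pos _).le
      _ = Real.exp (1 + Real.log N / 3) := (Real.exp_add _ _).symm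
      _ ≤ _ := Real.exp_le_exp.2 (by linarith)
  filter_upwards [hM, hy.eventually_gt_atTop 0, eventually_ge_atTop 3,
    hu.eventually_ge_atTop 4, hlN.eventually_gt_atTop 0] with N hM hN hN3 h4 hl0
  have hN0 : (0 : ℝ) < N := by exact_mod_cast (by omega : 0 < N)
  have hb := card_exceptional_le hε hK hN hN3 h4 hM
  rw [← hC] at hb
  rw [div_le_iff₀ hN0]
  refine hb.trans (le_of_eq ?_)
  have hlog : Real.log N = Real.exp (Real.log (Real.log N)) := (Real.exp_log hl0).symm
  have hpow : Real.exp (Real.log (Real.log N) / K) ^ K = Real.log N := by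
    rw [← Real.exp_nat_mul, mul_div_cancel₀ _ (by positivity), ← hlog]
  have hsq : √(N : ℝ) = (√(N : ℝ))⁻¹ * N := by
    rw [inv_mul_eq_div, Real.div_sqrt]
  have hinv : ∀ x : ℝ, x / Real.log N = x * Real.exp (-Real.log (Real.log N)) := by
    intro x
    rw [Real.exp_neg, ← hlog, div_eq_mul_inv]
  simp only [Function.comp, hpow]
  have e4 : Real.exp (8 / 9 * 4 + 724 * 7 - (1 / 9 - 724 / K) * Real.log (Real.log N)) =
      Real.exp (8 / 9 * (Real.log (Real.log N) + 4) +
            724 * (Real.log (Real.log N) / K + 7)) * Real.exp (-Real.log (Real.log N)) := by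
    rw [← Real.exp_add]; congr 1; ring
  have e5 : Real.exp (2 / 3 * 4 + 7 - (1 / 3 - 1 / K) * Real.log (Real.log N)) =
      Real.exp (2 / 3 * (Real.log (Real.log N) + 4) +
          (Real.log (Real.log N) / K + 7)) * Real.exp (-Real.log (Real.log N)) := by
    rw [← Real.exp_add]; congr 1; ring
  have e6 : Real.exp (2 / 3 * 4 + 13 / 3 + 28 -
        (1 / 3 - (2 / 3 + 4) / K) * Real.log (Real.log N)) =
      Real.exp (2 * (Real.log (Real.log N) / K + 7)) * Real.exp (-Real.log (Real.log N)) *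
        Real.exp (2 / 3 * (Real.log (Real.log N) + 4) +
            (2 * (Real.log (Real.log N) / K) + 13) / 3 +
            2 * (Real.log (Real.log N) / K + 7)) := by
    rw [← Real.exp_add, ← Real.exp_add]; congr 1; ring
  have e2 : Real.exp (0 - 1 / K * Real.log (Real.log N)) =
      Real.exp (-(Real.log (Real.log N) / K)) := by congr 1; ring
  obtain ⟨z, hz⟩ : ∃ z, z = (√(N : ℝ))⁻¹ := ⟨_, rfl⟩
  rw [← hz] at hsq ⊢
  rw [e2, e4, e5, e6, hsq]
  simp only [hinv]
  ring

theorem sum_inv_odd_sq_le (N : ℕ) :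
    ∑ k ∈ Icc 1 N, (1 : ℝ) / (2 * k + 1) ^ 2 ≤ 1 / 4 - 1 / 72 := by
  have h : ∀ N : ℕ, ∑ k ∈ Icc 1 (N + 1), (1 : ℝ) / (2 * k + 1) ^ 2 ≤
      1 / 4 - 1 / 72 - 1 / (4 * ((N : ℝ) + 2)) := by
    intro N
    induction N with
    | zero => norm_num
    | succ N ih =>
      rw [Finset.sum_Icc_succ_top (by omega)]
      have : (1 : ℝ) / (2 * ((N + 1 + 1 : ℕ) : ℝ) + 1) ^ 2 ≤
          1 / (4 * (N + 2)) - 1 / (4 * (((N + 1 : ℕ) : ℝ) + 2)) := by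
        push_cast
        rw [div_sub_div _ _ (by positivity) (by positivity),
          div_le_div_iff₀ (by positivity) (by positivity)]
        nlinarith [(Nat.cast_nonneg N : (0 : ℝ) ≤ N)]
      linarith
  have h2 : ∑ k ∈ Icc 1 N, (1 : ℝ) / (2 * k + 1) ^ 2 ≤
      ∑ k ∈ Icc 1 (N + 1), (1 : ℝ) / (2 * k + 1) ^ 2 :=
    Finset.sum_le_sum_of_subset_of_nonneg (Finset.Icc_subset_Icc_right (by omega))
      fun _ _ _ => by positivity
  have h3 : (0 : ℝ) ≤ 1 / (4 * ((N : ℝ) + 2)) := by positivity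
  linarith [h N]

theorem le_card_squarefree_three_mod_four (N : ℕ) :
    (N : ℝ) / 72 - 1 ≤ #{n ∈ Icc 1 N | Squarefree n ∧ n % 4 = 3} := by
  have h1 : N / 4 ≤ #{n ∈ Icc 1 N | n % 4 = 3} := by
    have : ((Finset.range (N / 4)).image fun k => 4 * k + 3) ⊆ {n ∈ Icc 1 N | n % 4 = 3} := by
      intro n hn
      obtain ⟨k, hk, rfl⟩ := Finset.mem_image.1 hn
      have := Finset.mem_range.1 hk
      exact Finset.mem_filter.2 ⟨Finset.mem_Icc.2 ⟨by omega, by omega⟩, by omega⟩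
    have h := Finset.card_le_card this
    rwa [Finset.card_image_of_injective _ (fun a b (h : 4 * a + 3 = 4 * b + 3) => by omega),
      Finset.card_range] at h
  have hsub : ({n ∈ Icc 1 N | n % 4 = 3} : Finset ℕ) ⊆
      {n ∈ Icc 1 N | Squarefree n ∧ n % 4 = 3} ∪
        (Icc 1 N).biUnion fun k => {n ∈ Ioc 0 N | (2 * k + 1) ^ 2 ∣ n} := by
    intro n hn
    obtain ⟨hI, h3⟩ := Finset.mem_filter.1 hn
    have hI' := Finset.mem_Icc.1 hI
    by_cases hs : Squarefree n
    · exact Finset.mem_union_left _ (Finset.mem_filter.2 ⟨hI, hs, h3⟩)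
    · unfold Squarefree at hs
      push Not at hs
      obtain ⟨x, hx, hu⟩ := hs
      have hxo : x % 2 = 1 := Nat.odd_iff.1
        (Odd.of_dvd_nat (Nat.odd_iff.2 (by omega)) (dvd_of_mul_left_dvd hx))
      have hx1 : x ≠ 1 := fun h => hu (Nat.isUnit_iff.2 h)
      have hxn : x ≤ n := Nat.le_of_dvd (by omega) (dvd_of_mul_left_dvd hx)
      refine Finset.mem_union_right _ (Finset.mem_biUnion.2 ⟨x / 2, Finset.mem_Icc.2
        ⟨by omega, by omega⟩, Finset.mem_filter.2 ⟨Finset.mem_Ioc.2 ⟨by omega, hI'.2⟩, ?_⟩⟩)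
      rw [show 2 * (x / 2) + 1 = x by omega, pow_two]
      exact hx
  have hcard := h1.trans ((Finset.card_le_card hsub).trans ((Finset.card_union_le _ _).trans
    (Nat.add_le_add_left Finset.card_biUnion_le _)))
  have hmul : ((∑ k ∈ Icc 1 N, #{n ∈ Ioc 0 N | (2 * k + 1) ^ 2 ∣ n} : ℕ) : ℝ) ≤
      N * (1 / 4 - 1 / 72) := by
    refine le_trans ?_ (mul_le_mul_of_nonneg_left (sum_inv_odd_sq_le N) (Nat.cast_nonneg N))
    rw [Nat.cast_sum, Finset.mul_sum]
    refine Finset.sum_le_sum fun k _ => ?_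
    rw [Nat.Ioc_filter_dvd_card_eq_div, mul_one_div]
    refine Nat.cast_div_le.trans (le_of_eq ?_)
    push_cast
    rfl
  have h4 : (N : ℝ) / 4 - 1 ≤ ((N / 4 : ℕ) : ℝ) := by
    have : N ≤ 4 * (N / 4) + 4 := by omega
    have : (N : ℝ) ≤ 4 * ((N / 4 : ℕ) : ℝ) + 4 := by exact_mod_cast this
    linarith
  have h5 : ((N / 4 : ℕ) : ℝ) ≤ (#{n ∈ Icc 1 N | Squarefree n ∧ n % 4 = 3} : ℝ) +
      ((∑ k ∈ Icc 1 N, #{n ∈ Ioc 0 N | (2 * k + 1) ^ 2 ∣ n} : ℕ) : ℝ) := by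
    exact_mod_cast hcard
  linarith

theorem le_card_DnegOdd {X : ℝ} (hX : 146 ≤ ⌊X⌋₊) : (⌊X⌋₊ : ℝ) / 144 ≤ #(DnegOdd X) := by
  have hX0 : 0 ≤ X := by
    by_contra h
    rw [Nat.floor_of_nonpos (by linarith)] at hX
    omega
  have h := le_card_squarefree_three_mod_four (⌊X⌋₊ - 1)
  have hc : (((⌊X⌋₊ - 1 : ℕ) : ℝ)) = ⌊X⌋₊ - 1 := by
    rw [Nat.cast_sub (by omega)]; simp
  have hX' : (146 : ℝ) ≤ ⌊X⌋₊ := by exact_mod_cast hX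
  have hle : #{n ∈ Icc 1 (⌊X⌋₊ - 1) | Squarefree n ∧ n % 4 = 3} ≤ #(DnegOdd X) := by
    refine Finset.card_le_card_of_injOn (fun n : ℕ => -(n : ℤ)) ?_ fun a _ b _ h => by
      simpa using h
    intro n hn
    obtain ⟨hI, hs, h3⟩ := Finset.mem_filter.1 hn
    have hI' := Finset.mem_Icc.1 hI
    have hlt : (n : ℝ) < X := lt_of_lt_of_le (by exact_mod_cast (by omega : n < ⌊X⌋₊))
      (Nat.floor_le hX0)
    have hceil : (n : ℤ) ≤ ⌈X⌉ := by exact_mod_cast hlt.le.trans (Int.le_ceil X)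
    refine Finset.mem_filter.2 ⟨Finset.mem_Icc.2 ⟨by simpa using hceil, by simp⟩,
      by simp; omega, ?_, by dsimp only; omega, by push_cast; linarith⟩
    exact Int.squarefree_natAbs.1 (by simpa using hs)
  have hle' : (#{n ∈ Icc 1 (⌊X⌋₊ - 1) | Squarefree n ∧ n % 4 = 3} : ℝ) ≤ #(DnegOdd X) := by
    exact_mod_cast hle
  linarith

theorem card_far_le {ε : ℝ} {X : ℝ} :
    #{d ∈ DnegOdd X | ε / 48 < |ftilde d / 3 ^ omegaZ d - 1 / 32|} ≤ #(exceptional ε ⌊X⌋₊) := by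
  refine Finset.card_le_card_of_injOn Int.natAbs ?_ ?_
  · intro d hd
    obtain ⟨hd, hf⟩ := Finset.mem_filter.1 hd
    obtain ⟨-, h0, hs, h4, hX⟩ := Finset.mem_filter.1 hd
    rw [ftilde_div_eq h0 hs h4] at hf
    refine Finset.mem_filter.2 ⟨Finset.mem_Icc.2 ⟨by omega, Nat.le_floor ?_⟩,
      Int.squarefree_natAbs.2 hs, by omega, ?_⟩
    · rw [Nat.cast_natAbs, abs_of_neg h0]
      push_cast
      linarith
    · have : 1 / 48 * (surjSum d.natAbs / 3 ^ #d.natAbs.primeFactors) - 1 / 32 =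
          1 / 48 * (surjSum d.natAbs / 3 ^ #d.natAbs.primeFactors - 3 / 2) := by ring
      rw [this, abs_mul, abs_of_pos (by norm_num : (0 : ℝ) < 1 / 48)] at hf
      linarith
  · intro a ha b hb h
    have h1 := (Finset.mem_filter.1 (Finset.mem_filter.1 (Finset.mem_coe.1 ha)).1).2.1
    have h2 := (Finset.mem_filter.1 (Finset.mem_filter.1 (Finset.mem_coe.1 hb)).1).2.1
    omega

theorem weak_convergence_point_mass_neg (φ : ℝ → ℝ)
    (hφc : Continuous φ) (hφb : ∃ C : ℝ, ∀ x : ℝ, |φ x| ≤ C) :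
    Tendsto
      (fun X : ℝ =>
        (∑ d ∈ DnegOdd X, φ (ftilde d / 3 ^ omegaZ d)) / ((DnegOdd X).card : ℝ))
      atTop (nhds (φ (1 / 32))) := by
  obtain ⟨C, hC⟩ := hφb
  have hC0 : 0 ≤ C := (abs_nonneg _).trans (hC 0)
  rw [Metric.tendsto_nhds]
  intro η hη
  obtain ⟨δ, hδ, hφδ⟩ := Metric.continuous_iff.1 hφc (1 / 32) (η / 2) (half_pos hη)
  have hexc := (tendsto_card_exceptional_div (ε := 24 * δ) (by positivity)).comp
    (tendsto_nat_floor_atTop (α := ℝ))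
  have hfl := tendsto_nat_floor_atTop (α := ℝ)
  filter_upwards [hexc.eventually_lt_const (show 0 < η / (2 * (288 * C + 1)) by positivity),
    hfl.eventually_ge_atTop 146] with X h1 hX
  simp only [Function.comp] at h1
  have hX' : (146 : ℝ) ≤ ⌊X⌋₊ := by exact_mod_cast hX
  have hcard := le_card_DnegOdd hX
  have hpos : (0 : ℝ) < #(DnegOdd X) := by linarith
  set F := {d ∈ DnegOdd X | 24 * δ / 48 < |ftilde d / 3 ^ omegaZ d - 1 / 32|}
  have hfar : (#F : ℝ) ≤ #(exceptional (24 * δ) ⌊X⌋₊) := 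
    Nat.cast_le.2 card_far_le
  have hsum : |∑ d ∈ DnegOdd X, (φ (ftilde d / 3 ^ omegaZ d) - φ (1 / 32))| ≤
      η / 2 * #(DnegOdd X) + 2 * C * #F := by
    calc _ ≤ ∑ d ∈ DnegOdd X, |φ (ftilde d / 3 ^ omegaZ d) - φ (1 / 32)| :=
          Finset.abs_sum_le_sum_abs _ _
      _ ≤ ∑ d ∈ DnegOdd X, (η / 2 +
          if 24 * δ / 48 < |ftilde d / 3 ^ omegaZ d - 1 / 32| then 2 * C else 0) := by
        refine Finset.sum_le_sum fun d _ => ?_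
        split_ifs with h
        · have h2 := abs_sub (φ (ftilde d / 3 ^ omegaZ d)) (φ (1 / 32))
          linarith [hC (ftilde d / 3 ^ omegaZ d), hC (1 / 32)]
        · have h2 := hφδ (ftilde d / 3 ^ omegaZ d)
            (by rw [Real.dist_eq]; linarith)
          rw [Real.dist_eq] at h2
          linarith
      _ = _ := by
        rw [Finset.sum_add_distrib, Finset.sum_const, ← Finset.sum_filter, Finset.sum_const]
        simp only [nsmul_eq_mul]
        ring
  have heq : (∑ d ∈ DnegOdd X, φ (ftilde d / 3 ^ omegaZ d)) / (#(DnegOdd X) : ℝ) - φ (1 / 32) =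
      (∑ d ∈ DnegOdd X, (φ (ftilde d / 3 ^ omegaZ d) - φ (1 / 32))) / (#(DnegOdd X) : ℝ) := by
    rw [Finset.sum_sub_distrib, Finset.sum_const, nsmul_eq_mul, sub_div,
      mul_div_cancel_left₀ _ hpos.ne']
  rw [Real.dist_eq, heq, abs_div, abs_of_pos hpos, div_lt_iff₀ hpos]
  refine hsum.trans_lt ?_
  rw [div_lt_div_iff₀ (by linarith) (by positivity)] at h1
  have h3 : 2 * C * (#F : ℝ) ≤ 2 * C * #(exceptional (24 * δ) ⌊X⌋₊) :=
    mul_le_mul_of_nonneg_left hfar (by positivity)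
  have h4 : η * (⌊X⌋₊ : ℝ) / 144 ≤ η * #(DnegOdd X) := by
    rw [mul_div_assoc]
    exact mul_le_mul_of_nonneg_left hcard hη.le
  have h5 : (0 : ℝ) ≤ #(exceptional (24 * δ) ⌊X⌋₊) := Nat.cast_nonneg _
  rcases h5.eq_or_lt with h6 | h6
  · rw [← h6, mul_zero] at h3
    nlinarith
  · nlinarith
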